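/- arXiv:2208.11159 — 3 statements merged into one kernel-verified Lean document; each statement's English description precedes it below -/
import Mathlib

section
/- Let h₋ > 0, U⁻ ∈ C²([−h₋, 0]; ℝ). For c ∈ ℝ \ U⁻([−h₋, 0]) and K ≥ 0, let y⁻(c, √K, ·) be the unique solution on [−h₋, 0] of −y'' + (K + (U⁻)''/(U⁻ − c)) y = 0 with y(−h₋) = 0, y'(−h₋) = 1, and set Y⁻(c, √K) := (y⁻)'(c, √K, 0)/y⁻(c, √K, 0). If (U⁻)'' > 0 on [−h₋, 0], then for every c ∈ ℝ \ U⁻([−h₋, 0]) and every K ≥ 0 the mixed derivative ∂_K ∂_c Y⁻(c, √K) exists and is strictly negative; if (U⁻)'' < 0 on [−h₋, 0], it is strictly positive. In other words, sgn(∂_{Kc} Y⁻) = − sgn((U⁻)''). -/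
open Set MeasureTheory intervalIntegral

structure Sol (a b : ℝ) (q y y' : ℝ → ℝ) : Prop where
  d1 : ∀ x ∈ Icc a b, HasDerivAt y (y' x) x
  d2 : ∀ x ∈ Icc a b, HasDerivAt y' (q x * y x) x
  y0 : y a = 0
  y1 : y' a = 1

theorem Sol.cont {a b : ℝ} {q y y' : ℝ → ℝ} (h : Sol a b q y y') : ContinuousOn y (Icc a b) :=
  fun x hx => (h.d1 x hx).continuousAt.continuousWithinAt

theorem Sol.cont' {a b : ℝ} {q y y' : ℝ → ℝ} (h : Sol a b q y y') : ContinuousOn y' (Icc a b) :=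
  fun x hx => (h.d2 x hx).continuousAt.continuousWithinAt

theorem Sol.bound {a b B : ℝ} {q y y' : ℝ → ℝ} (h : Sol a b q y y') (hB : 0 ≤ B)
    (hq : ∀ x ∈ Icc a b, |q x| ≤ B) :
    ∀ x ∈ Icc a b, |y x| ≤ Real.exp ((B+1)*(b-a)) * (x-a) := by
  have key : ∀ x ∈ Icc a b, |y' x| ≤ Real.exp ((B+1)*(b-a)) := by
    intro x hx
    have := norm_le_gronwallBound_of_norm_deriv_right_le (f := fun x => (y x, y' x))
      (f' := fun x => (y' x, q x * y x)) (δ := 1) (K := B+1) (ε := 0) (a := a) (b := b)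
      (h.cont.prodMk h.cont')
      (fun x hx => ((h.d1 x (Ico_subset_Icc_self hx)).prodMk
        (h.d2 x (Ico_subset_Icc_self hx))).hasDerivWithinAt)
      (by simp [h.y0, h.y1, Prod.norm_def])
      (by
        intro x hx
        have hqx := hq x (Ico_subset_Icc_self hx)
        simp only [Prod.norm_def, Real.norm_eq_abs, add_zero, abs_mul]
        have h1 : |y x| ≤ max |y x| |y' x| := le_max_left _ _
        have h2 : |y' x| ≤ max |y x| |y' x| := le_max_right _ _
        have h0 := abs_nonneg (y x)
        apply max_le
        · nlinarith
        · nlinarith [abs_nonneg (q x)]) x hx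
    rw [gronwallBound_ε0] at this
    calc |y' x| ≤ ‖(y x, y' x)‖ := by simp [Prod.norm_def]
      _ ≤ _ := this
      _ ≤ _ := by
        rw [one_mul]
        apply Real.exp_le_exp.mpr
        have := hx.2
        gcongr
  intro x hx
  have ha : a ∈ Icc a b := ⟨le_rfl, hx.1.trans hx.2⟩
  have := (convex_Icc a b).norm_image_sub_le_of_norm_hasDerivWithin_le (f := y) (f' := y')
    (fun x hx => (h.d1 x hx).hasDerivWithinAt) key ha hx
  simpa [h.y0, abs_of_nonneg (sub_nonneg.2 hx.1)] using this

theorem Sol.ne {a b K : ℝ} {q y y' W W' W'' : ℝ → ℝ} (h : Sol a b q y y') (hK : 0 ≤ K)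
    (hW : ∀ x ∈ Icc a b, HasDerivAt W (W' x) x) (hW' : ∀ x ∈ Icc a b, HasDerivAt W' (W'' x) x)
    (hW0 : ∀ x ∈ Icc a b, W x ≠ 0) (hq : ∀ x ∈ Icc a b, q x = K + W'' x / W x) :
    ∀ x ∈ Ioc a b, y x ≠ 0 := by
  -- energy
  have hN : ∀ x ∈ Icc a b, HasDerivAt (fun x => W x * y' x - W' x * y x) (K * W x * y x) x := by
    intro x hx
    refine (((hW x hx).mul (h.d2 x hx)).sub ((hW' x hx).mul (h.d1 x hx))).congr_deriv ?_
    have := hW0 x hx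
    rw [hq x hx]; field_simp; ring
  have hu : ∀ x ∈ Icc a b, HasDerivAt (fun x => y x / W x)
      ((W x * y' x - W' x * y x) / W x ^ 2) x := by
    intro x hx
    refine ((h.d1 x hx).div (hW x hx) (hW0 x hx)).congr_deriv ?_
    ring
  have hE : MonotoneOn (fun x => y x / W x * (W x * y' x - W' x * y x)) (Icc a b) := by
    apply monotoneOn_of_hasDerivWithinAt_nonneg (convex_Icc a b)
      (fun x hx => ((hu x hx).mul (hN x hx)).continuousAt.continuousWithinAt)
      (fun x hx => ((hu x (interior_subset hx)).mul (hN x (interior_subset hx))).hasDerivWithinAt)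
    intro x hx
    have := hW0 x (interior_subset hx)
    have e : (W x * y' x - W' x * y x) / W x ^ 2 * (W x * y' x - W' x * y x) +
      y x / W x * (K * W x * y x) = (W x * y' x - W' x * y x)^2 / W x ^ 2 + K * y x ^ 2 := by
      field_simp
    rw [e]; positivity
  have hE0 : ∀ x ∈ Icc a b, 0 ≤ y x / W x * (W x * y' x - W' x * y x) := by
    intro x hx
    have := hE ⟨le_rfl, hx.1.trans hx.2⟩ hx hx.1
    simpa [h.y0] using this
  have hS : MonotoneOn (fun x => y x / W x * (y x / W x)) (Icc a b) := by
    apply monotoneOn_of_hasDerivWithinAt_nonneg (convex_Icc a b)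
      (fun x hx => ((hu x hx).mul (hu x hx)).continuousAt.continuousWithinAt)
      (fun x hx => ((hu x (interior_subset hx)).mul (hu x (interior_subset hx))).hasDerivWithinAt)
    intro x hx
    have := hE0 x (interior_subset hx)
    have e : (W x * y' x - W' x * y x) / W x ^ 2 * (y x / W x) +
      y x / W x * ((W x * y' x - W' x * y x) / W x ^ 2)
       = 2 * (y x / W x * (W x * y' x - W' x * y x)) / W x ^ 2 := by ring
    rw [e]; positivity
  intro x hx h0
  have hz : ∀ z ∈ Ioc a x, y z = 0 := by
    intro z hz
    have hzI : z ∈ Icc a b := ⟨hz.1.le, hz.2.trans hx.2⟩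
    have := hS hzI (Ioc_subset_Icc_self hx) hz.2
    simp only [h0, zero_div, mul_zero] at this
    have h1 : y z / W z = 0 := by nlinarith [mul_self_nonneg (y z / W z)]
    exact (div_eq_zero_iff.1 h1).resolve_right (hW0 z hzI)
  have ha : a ∈ Icc a b := ⟨le_rfl, hx.1.le.trans hx.2⟩
  have h1 := (h.d1 a ha).eventually_ne (c := 0) (by rw [h.y1]; exact one_ne_zero)
  have h2 : ∀ᶠ z in nhdsWithin a (Ioi a), y z ≠ 0 :=
    h1.filter_mono (nhdsWithin_mono a (fun z hz => ne_of_gt hz))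
  have h3 : ∀ᶠ z in nhdsWithin a (Ioi a), z ∈ Ioc a x := Ioc_mem_nhdsGT hx.1
  obtain ⟨z, hz1, hz2⟩ := (h2.and h3).exists
  exact hz1 (hz z hz2)

theorem Sol.dslope_cont {a b : ℝ} {q y y' : ℝ → ℝ} (h : Sol a b q y y') :
    ContinuousOn (dslope y a) (Icc a b) := by
  intro x hx
  apply ContinuousAt.continuousWithinAt
  by_cases hxa : x = a
  · subst hxa
    exact continuousAt_dslope_same.2 (h.d1 x hx).differentiableAt
  · exact (continuousAt_dslope_of_ne hxa).2 (h.d1 x hx).continuousAt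

theorem Sol.dslope_a {a b : ℝ} {q y y' : ℝ → ℝ} (hab : a < b) (h : Sol a b q y y') :
    dslope y a a = 1 := by
  rw [dslope_same, (h.d1 a ⟨le_rfl, hab.le⟩).deriv, h.y1]

theorem Sol.dslope_mul {a b : ℝ} {q y y' : ℝ → ℝ} (h : Sol a b q y y') (x : ℝ) :
    y x = (x - a) * dslope y a x := by
  have := sub_smul_dslope y a x
  rw [h.y0, sub_zero, smul_eq_mul] at this
  exact this.symm

theorem Sol.lower {a b : ℝ} {q y y' : ℝ → ℝ} (hab : a < b) (h : Sol a b q y y')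
    (hne : ∀ x ∈ Ioc a b, y x ≠ 0) : ∃ m > 0, ∀ x ∈ Icc a b, m * (x - a) ≤ |y x| := by
  have hne' : ∀ x ∈ Icc a b, dslope y a x ≠ 0 := by
    intro x hx
    rcases hx.1.eq_or_lt with rfl | hlt
    · rw [h.dslope_a hab]; exact one_ne_zero
    · have := hne x ⟨hlt, hx.2⟩
      rw [h.dslope_mul x] at this
      exact right_ne_zero_of_mul this
  obtain ⟨x0, hx0, hmin⟩ := isCompact_Icc.exists_isMinOn (nonempty_Icc.2 hab.le)
    h.dslope_cont.abs
  refine ⟨|dslope y a x0|, abs_pos.2 (hne' x0 hx0), fun x hx => ?_⟩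
  rw [h.dslope_mul x, abs_mul, abs_of_nonneg (sub_nonneg.2 hx.1), mul_comm]
  exact mul_le_mul_of_nonneg_left (hmin hx) (sub_nonneg.2 hx.1)

/-- inner integrand -/
noncomputable def gg (a : ℝ) (v f : ℝ → ℝ) (s : ℝ) : ℝ := (∫ t in a..s, f t * v t) / v s ^ 2
noncomputable def HH (a : ℝ) (v f : ℝ → ℝ) (x : ℝ) : ℝ := ∫ s in a..x, gg a v f s

theorem gg_bound {a b M m F : ℝ} {v f : ℝ → ℝ} (hm : 0 < m)
    (hM : ∀ x ∈ Icc a b, |v x| ≤ M * (x - a)) (hl : ∀ x ∈ Icc a b, m * (x - a) ≤ |v x|)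
    (hf : ∀ x ∈ Icc a b, |f x| ≤ F * (x - a)) :
    ∀ s ∈ Icc a b, |gg a v f s| ≤ F * M / m ^ 2 * (s - a) := by
  intro s hs
  rcases hs.1.eq_or_lt with rfl | hlt
  · simp [gg]
  have hs0 : 0 < s - a := sub_pos.2 hlt
  have hF : 0 ≤ F := by
    have := (abs_nonneg _).trans (hf s hs)
    exact nonneg_of_mul_nonneg_left this hs0
  have hM0 : 0 ≤ M := by
    have := (abs_nonneg _).trans (hM s hs)
    exact nonneg_of_mul_nonneg_left this hs0
  have h1 : |∫ t in a..s, f t * v t| ≤ (F * (s-a)) * (M * (s-a)) * |s - a| := by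
    rw [← Real.norm_eq_abs (∫ t in a..s, f t * v t)]
    apply intervalIntegral.norm_integral_le_of_norm_le_const
    intro t ht
    rw [uIoc_of_le hs.1] at ht
    have htI : t ∈ Icc a b := ⟨ht.1.le, ht.2.trans hs.2⟩
    rw [Real.norm_eq_abs, abs_mul]
    have := ht.2
    have h1 : |f t| ≤ F * (s - a) := (hf t htI).trans (by gcongr)
    have h2 : |v t| ≤ M * (s - a) := (hM t htI).trans (by gcongr)
    exact mul_le_mul h1 h2 (abs_nonneg _) (by positivity)
  rw [abs_of_pos hs0] at h1
  have h2 := hl s hs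
  have h3 : (m * (s - a))^2 ≤ v s ^ 2 := by
    rw [← sq_abs (v s)]
    gcongr
  unfold gg
  rw [abs_div, abs_of_nonneg (sq_nonneg (v s))]
  calc _ ≤ ((F * (s-a)) * (M * (s-a)) * (s - a)) / (m * (s - a))^2 := by gcongr
    _ = _ := by field_simp

theorem gg_cont {a b M m F : ℝ} {v f : ℝ → ℝ} (hab : a < b) (hm : 0 < m)
    (hv : ContinuousOn v (Icc a b)) (hfc : ContinuousOn f (Icc a b))
    (hM : ∀ x ∈ Icc a b, |v x| ≤ M * (x - a)) (hl : ∀ x ∈ Icc a b, m * (x - a) ≤ |v x|)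
    (hf : ∀ x ∈ Icc a b, |f x| ≤ F * (x - a)) :
    ContinuousOn (gg a v f) (Icc a b) := by
  intro s hs
  rcases hs.1.eq_or_lt with rfl | hlt
  · have h0 : gg a v f a = 0 := by simp [gg]
    rw [ContinuousWithinAt, h0]
    apply squeeze_zero_norm' (a := fun s => F * M / m ^ 2 * (s - a))
    · filter_upwards [self_mem_nhdsWithin] with s hs
      exact gg_bound hm hM hl hf s hs
    · have : Continuous (fun s => F * M / m ^ 2 * (s - a)) := by fun_prop
      have h2 := (this.tendsto a).mono_left (nhdsWithin_le_nhds (s := Icc a b))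
      simpa using h2
  · have hint : ContinuousOn (fun s => ∫ t in a..s, f t * v t) (Icc a b) := by
      have := intervalIntegral.continuousOn_primitive_interval (μ := volume) (a := a) (b := b)
        (f := fun t => f t * v t)
        (by rw [uIcc_of_le hab.le]; exact (hfc.mul hv).integrableOn_Icc)
      rwa [uIcc_of_le hab.le] at this
    have hne : v s ≠ 0 := by
      have := hl s hs
      have h3 : 0 < m * (s - a) := mul_pos hm (sub_pos.2 hlt)
      exact abs_pos.1 (h3.trans_le this)
    exact (hint s hs).div ((hv s hs).pow 2) (pow_ne_zero 2 hne)

structure Base (a b M m : ℝ) (v : ℝ → ℝ) : Prop where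
  hab : a < b
  hm : 0 < m
  hM0 : 0 ≤ M
  cont : ContinuousOn v (Icc a b)
  hM : ∀ x ∈ Icc a b, |v x| ≤ M * (x - a)
  hl : ∀ x ∈ Icc a b, m * (x - a) ≤ |v x|

theorem Base.ne {a b M m : ℝ} {v : ℝ → ℝ} (B : Base a b M m v) : ∀ x ∈ Ioc a b, v x ≠ 0 := by
  intro x hx
  have := B.hl x (Ioc_subset_Icc_self hx)
  have h3 : 0 < m * (x - a) := mul_pos B.hm (sub_pos.2 hx.1)
  exact abs_pos.1 (h3.trans_le this)

theorem ii_of_cont {a b x z : ℝ} {f : ℝ → ℝ} (hf : ContinuousOn f (Icc a b)) (hx : x ∈ Icc a b)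
    (hz : z ∈ Icc a b) : IntervalIntegrable f volume x z :=
  (hf.mono (uIcc_subset_Icc hx hz)).intervalIntegrable

theorem Base.HH_bound {a b M m F : ℝ} {v f : ℝ → ℝ} (B : Base a b M m v) (hF : 0 ≤ F)
    (hf : ∀ x ∈ Icc a b, |f x| ≤ F * (x - a)) :
    ∀ x ∈ Icc a b, |HH a v f x| ≤ F * (M / m ^ 2 * (b - a) * (b - a)) := by
  intro x hx
  have hM0 := B.hM0
  have hm := B.hm
  have hba : 0 < b - a := sub_pos.2 B.hab
  have hx2 := hx.2
  have h1 : ‖HH a v f x‖ ≤ (F * M / m ^ 2 * (b - a)) * |x - a| := by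
    apply intervalIntegral.norm_integral_le_of_norm_le_const
    intro t ht
    rw [uIoc_of_le hx.1] at ht
    have htI : t ∈ Icc a b := ⟨ht.1.le, ht.2.trans hx.2⟩
    have := htI.2
    exact (gg_bound hm B.hM B.hl hf t htI).trans (by gcongr)
  rw [abs_of_nonneg (sub_nonneg.2 hx.1)] at h1
  calc |HH a v f x| ≤ _ := h1
    _ ≤ (F * M / m ^ 2 * (b - a)) * (b - a) := by gcongr
    _ = _ := by ring

theorem Base.gg_cont {a b M m F : ℝ} {v f : ℝ → ℝ} (B : Base a b M m v)
    (hfc : ContinuousOn f (Icc a b))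
    (hf : ∀ x ∈ Icc a b, |f x| ≤ F * (x - a)) :
    ContinuousOn (gg a v f) (Icc a b) :=
  _root_.gg_cont B.hab B.hm B.cont hfc B.hM B.hl hf

theorem Base.HH_sub {a b M m F F' : ℝ} {v f f' : ℝ → ℝ} (B : Base a b M m v)
    (hfc : ContinuousOn f (Icc a b)) (hf : ∀ x ∈ Icc a b, |f x| ≤ F * (x - a))
    (hfc' : ContinuousOn f' (Icc a b)) (hf' : ∀ x ∈ Icc a b, |f' x| ≤ F' * (x - a)) :
    ∀ x ∈ Icc a b, HH a v (fun t => f t - f' t) x = HH a v f x - HH a v f' x := by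
  intro x hx
  have ha : a ∈ Icc a b := ⟨le_rfl, B.hab.le⟩
  unfold HH
  rw [← intervalIntegral.integral_sub (ii_of_cont (B.gg_cont hfc hf) ha hx)
    (ii_of_cont (B.gg_cont hfc' hf') ha hx)]
  apply intervalIntegral.integral_congr
  intro s hs
  have hsI := uIcc_subset_Icc ha hx hs
  simp only [gg]
  have h5 : IntervalIntegrable (fun t => f t * v t) volume a s :=
    ii_of_cont (hfc.mul B.cont) ha hsI
  have h6 : IntervalIntegrable (fun t => f' t * v t) volume a s :=
    ii_of_cont (hfc'.mul B.cont) ha hsI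
  rw [← sub_div, ← intervalIntegral.integral_sub h5 h6]
  simp only [sub_mul]

theorem HH_const {a r : ℝ} {v f : ℝ → ℝ} (x : ℝ) :
    HH a v (fun t => r * f t) x = r * HH a v f x := by
  unfold HH
  rw [← intervalIntegral.integral_const_mul]
  congr 1
  funext s
  simp only [gg, mul_assoc, intervalIntegral.integral_const_mul, mul_div_assoc]

theorem Sol.wronskian {a b : ℝ} {q q1 v v' y y' : ℝ → ℝ} 
    (h : Sol a b q v v') (h1 : Sol a b q1 y y') (hq : ContinuousOn q (Icc a b))
    (hq1 : ContinuousOn q1 (Icc a b)) :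
    ∀ x ∈ Icc a b, y' x * v x - y x * v' x = ∫ t in a..x, ((q1 t - q t) * y t) * v t := by
  intro x hx
  have ha : a ∈ Icc a b := ⟨le_rfl, hx.1.trans hx.2⟩
  rw [intervalIntegral.integral_eq_sub_of_hasDerivAt (f := fun x => y' x * v x - y x * v' x)]
  · simp [h.y0, h1.y0]
  · intro t ht
    have htI := uIcc_subset_Icc ha hx ht
    refine (((h1.d2 t htI).mul (h.d1 t htI)).sub ((h1.d1 t htI).mul (h.d2 t htI))).congr_deriv ?_
    ring
  · exact ii_of_cont (((hq1.sub hq).mul h1.cont).mul h.cont) ha hx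

theorem Sol.rep {a b M m F : ℝ} {q q1 v v' y y' : ℝ → ℝ} (B : Base a b M m v)
    (h : Sol a b q v v') (h1 : Sol a b q1 y y') (hq : ContinuousOn q (Icc a b))
    (hq1 : ContinuousOn q1 (Icc a b)) 
    (hf : ∀ x ∈ Icc a b, |(q1 x - q x) * y x| ≤ F * (x - a)) :
    ∀ x ∈ Icc a b, y x = v x * (1 + HH a v (fun t => (q1 t - q t) * y t) x) := by
  intro x hx
  have hd : ∀ x ∈ Icc a b, dslope v a x ≠ 0 := by
    intro x hx
    rcases hx.1.eq_or_lt with rfl | hlt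
    · rw [h.dslope_a B.hab]; exact one_ne_zero
    · have := B.ne x ⟨hlt, hx.2⟩
      rw [h.dslope_mul x] at this
      exact right_ne_zero_of_mul this
  have ha : a ∈ Icc a b := ⟨le_rfl, B.hab.le⟩
  have hsub : Icc a x ⊆ Icc a b := Icc_subset_Icc_right hx.2
  have key := intervalIntegral.integral_eq_sub_of_hasDerivAt_of_le hx.1
    (f := fun x => dslope y a x / dslope v a x)
    (f' := gg a v (fun t => (q1 t - q t) * y t))
    ((h1.dslope_cont.div h.dslope_cont hd).mono hsub)
    (by
      intro s hs
      have hsI : s ∈ Icc a b := hsub (Ioo_subset_Icc_self hs)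
      have hvs := B.ne s ⟨hs.1, hsI.2⟩
      have h3 := (h1.d1 s hsI).div (h.d1 s hsI) hvs
      refine (h3.congr_deriv ?_).congr_of_eventuallyEq ?_
      · unfold gg
        rw [← h.wronskian h1 hq hq1 s hsI]
      · filter_upwards [Ioi_mem_nhds hs.1] with t ht
        have ht0 : t - a ≠ 0 := (sub_pos.2 ht).ne'
        show _ = y t / v t
        rw [h.dslope_mul t, h1.dslope_mul t, mul_div_mul_left _ _ ht0])
    (ii_of_cont (B.gg_cont ((hq1.sub hq).mul h1.cont) hf) ha hx)
  unfold HH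
  rw [key, h.dslope_a B.hab, h1.dslope_a B.hab]
  have := hd x hx
  rw [h.dslope_mul x, h1.dslope_mul x]
  field_simp
  ring

theorem Sol.stab {a b M m M1 D : ℝ} {q q1 v v' y y' : ℝ → ℝ} (B : Base a b M m v)
    (h : Sol a b q v v') (h1 : Sol a b q1 y y') (hq : ContinuousOn q (Icc a b))
    (hq1 : ContinuousOn q1 (Icc a b)) (hD0 : 0 ≤ D) (hM1 : 0 ≤ M1)
    (hD : ∀ x ∈ Icc a b, |q1 x - q x| ≤ D) 
    (hy : ∀ x ∈ Icc a b, |y x| ≤ M1 * (x - a)) :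
    ∀ x ∈ Icc a b, |y x - v x| ≤ D * (M1 * (M / m ^ 2 * (b - a) * (b - a)) * M) * (x - a) := by
  intro x hx
  have hf : ∀ x ∈ Icc a b, |(q1 x - q x) * y x| ≤ (D * M1) * (x - a) := by
    intro x hx
    rw [abs_mul, mul_assoc]
    exact mul_le_mul (hD x hx) (hy x hx) (abs_nonneg _) hD0
  have h2 := h.rep B h1 hq hq1 hf x hx
  have h3 := B.HH_bound (mul_nonneg hD0 hM1) hf x hx
  have h4 : y x - v x = v x * HH a v (fun t => (q1 t - q t) * y t) x := by
    linear_combination h2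
  rw [h4, abs_mul]
  calc _ ≤ (M * (x - a)) * (D * M1 * (M / m ^ 2 * (b - a) * (b - a))) :=
        mul_le_mul (B.hM x hx) h3 (abs_nonneg _) ((abs_nonneg _).trans (B.hM x hx))
    _ = _ := by ring

open Filter Topology

theorem domconv {a b C : ℝ} (hab : a ≤ b) {l : Filter ℝ} [l.IsCountablyGenerated]
    {F : ℝ → ℝ → ℝ} {G : ℝ → ℝ}
    (hc : ∀ᶠ n in l, ContinuousOn (F n) (Icc a b) ∧ ∀ x ∈ Icc a b, |F n x| ≤ C)
    (hl : ∀ x ∈ Icc a b, Tendsto (fun n => F n x) l (𝓝 (G x))) :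
    Tendsto (fun n => ∫ x in a..b, F n x) l (𝓝 (∫ x in a..b, G x)) := by
  have hsub : uIoc a b ⊆ Icc a b := by rw [uIoc_of_le hab]; exact Ioc_subset_Icc_self
  apply intervalIntegral.tendsto_integral_filter_of_dominated_convergence (fun _ => C)
  · filter_upwards [hc] with n hn
    exact (hn.1.mono hsub).aestronglyMeasurable measurableSet_uIoc
  · filter_upwards [hc] with n hn
    exact Eventually.of_forall fun x hx => hn.2 x (hsub hx)
  · exact intervalIntegrable_const
  · exact Eventually.of_forall fun x hx => hl x (hsub hx)

theorem tendsto_of_lin {l : Filter ℝ} {f : ℝ → ℝ} {z c C : ℝ} (hl : l ≤ 𝓝 c)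
    (h : ∀ᶠ t in l, |f t - z| ≤ C * |t - c|) : Tendsto f l (𝓝 z) := by
  rw [tendsto_iff_norm_sub_tendsto_zero]
  apply squeeze_zero' (Eventually.of_forall fun t => norm_nonneg _) h
  have : Continuous (fun t : ℝ => C * |t - c|) := by fun_prop
  have h2 := (this.tendsto c).mono_left hl
  simpa using h2

theorem Kderiv {a b M m M1 K0 : ℝ} {S : Set ℝ} {q v : ℝ → ℝ} {Y Y' : ℝ → ℝ → ℝ}
    (B : Base a b M m v) (hM1 : 0 ≤ M1) (hK0 : K0 ∈ S) (hv : v = Y K0)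
    (hq : ContinuousOn q (Icc a b))
    (hs : ∀ K ∈ S, Sol a b (fun x => K + q x) (Y K) (Y' K))
    (hY : ∀ K ∈ S, |K - K0| ≤ 1 → ∀ x ∈ Icc a b, |Y K x| ≤ M1 * (x - a)) :
    ∀ x ∈ Icc a b, HasDerivWithinAt (fun K => Y K x) (v x * HH a v v x) S K0 := by
  intro x hx
  have hS0 : Sol a b (fun x => K0 + q x) v (Y' K0) := hv ▸ hs K0 hK0
  have hba : 0 < b - a := sub_pos.2 B.hab
  have hM0 := B.hM0
  have hqc : ∀ K : ℝ, ContinuousOn (fun x => K + q x) (Icc a b) := fun K =>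
    continuousOn_const.add hq
  have hstab : ∀ K ∈ S, |K - K0| ≤ 1 → ∀ x ∈ Icc a b, |Y K x - v x| ≤
      |K - K0| * (M1 * (M / m ^ 2 * (b - a) * (b - a)) * M) * (x - a) := by
    intro K hK hK1
    apply hS0.stab B (hs K hK) (hqc _) (hqc _) (abs_nonneg _) hM1 _ (hY K hK hK1)
    intro x hx
    apply le_of_eq
    congr 1
    ring
  have hrep : ∀ K ∈ S, |K - K0| ≤ 1 → Y K x = v x * (1 + (K - K0) * HH a v (Y K) x) := by
    intro K hK hK1
    have := hS0.rep (F := |K - K0| * M1) B (hs K hK) (hqc _) (hqc _) (by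
      intro x hx
      have e : K + q x - (K0 + q x) = K - K0 := by ring
      rw [e, abs_mul, mul_assoc]
      exact mul_le_mul_of_nonneg_left (hY K hK hK1 x hx) (abs_nonneg _)) x hx
    rw [this]
    have e : (fun t => (K + q t - (K0 + q t)) * Y K t) = fun t => (K - K0) * Y K t := by
      funext t; ring
    rw [e, HH_const]
  rw [hasDerivWithinAt_iff_tendsto_slope]
  have hnear : ∀ᶠ K in 𝓝[S \ {K0}] K0, K ∈ S ∧ K ≠ K0 ∧ |K - K0| ≤ 1 := by
    have h1 : ∀ᶠ K in 𝓝[S \ {K0}] K0, K ∈ S \ {K0} := self_mem_nhdsWithin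
    have h2 : ∀ᶠ K in 𝓝[S \ {K0}] K0, K ∈ Metric.closedBall K0 1 :=
      nhdsWithin_le_nhds (Metric.closedBall_mem_nhds K0 one_pos)
    filter_upwards [h1, h2] with K h1 h2
    exact ⟨h1.1, h1.2, by simpa [Real.dist_eq] using h2⟩
  have hlim : Tendsto (fun K => HH a v (Y K) x) (𝓝[S \ {K0}] K0) (𝓝 (HH a v v x)) := by
    apply tendsto_of_lin (c := K0)
      (C := (M1 * (M / m ^ 2 * (b - a) * (b - a)) * M) * (M / m ^ 2 * (b - a) * (b - a)))
      nhdsWithin_le_nhds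
    filter_upwards [hnear] with K ⟨hK, hne, hK1⟩
    rw [← B.HH_sub (hs K hK).cont (hY K hK hK1) B.cont B.hM x hx]
    have := B.HH_bound (by positivity) (hstab K hK hK1) x hx
    refine this.trans (le_of_eq ?_)
    ring
  refine (hlim.const_mul (v x)).congr' ?_
  filter_upwards [hnear] with K ⟨hK, hne, hK1⟩
  rw [slope_def_field, ← hv]
  have : K - K0 ≠ 0 := sub_ne_zero.2 hne
  rw [eq_div_iff this]
  linear_combination - hrep K hK hK1

theorem Kint {a b M m M1 K0 : ℝ} {S : Set ℝ} {q v p : ℝ → ℝ} {Y Y' : ℝ → ℝ → ℝ}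
    (B : Base a b M m v) (hM1 : 0 ≤ M1) (hK0 : K0 ∈ S) (hv : v = Y K0)
    (hq : ContinuousOn q (Icc a b)) (hp : ContinuousOn p (Icc a b))
    (hs : ∀ K ∈ S, Sol a b (fun x => K + q x) (Y K) (Y' K))
    (hY : ∀ K ∈ S, |K - K0| ≤ 1 → ∀ x ∈ Icc a b, |Y K x| ≤ M1 * (x - a)) :
    HasDerivWithinAt (fun K => ∫ x in a..b, p x * Y K x ^ 2)
      (∫ x in a..b, p x * (2 * v x ^ 2 * HH a v v x)) S K0 := by
  have hS0 : Sol a b (fun x => K0 + q x) v (Y' K0) := hv ▸ hs K0 hK0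
  have hba : 0 < b - a := sub_pos.2 B.hab
  have hM0 := B.hM0
  have ha : a ∈ Icc a b := ⟨le_rfl, B.hab.le⟩
  have hb : b ∈ Icc a b := ⟨B.hab.le, le_rfl⟩
  have hqc : ∀ K : ℝ, ContinuousOn (fun x => K + q x) (Icc a b) := fun K =>
    continuousOn_const.add hq
  have hstab : ∀ K ∈ S, |K - K0| ≤ 1 → ∀ x ∈ Icc a b, |Y K x - v x| ≤
      |K - K0| * (M1 * (M / m ^ 2 * (b - a) * (b - a)) * M) * (x - a) := by
    intro K hK hK1
    apply hS0.stab B (hs K hK) (hqc _) (hqc _) (abs_nonneg _) hM1 _ (hY K hK hK1)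
    intro x hx
    apply le_of_eq
    congr 1
    ring
  rw [hasDerivWithinAt_iff_tendsto_slope]
  have hnear : ∀ᶠ K in 𝓝[S \ {K0}] K0, K ∈ S ∧ K ≠ K0 ∧ |K - K0| ≤ 1 := by
    have h1 : ∀ᶠ K in 𝓝[S \ {K0}] K0, K ∈ S \ {K0} := self_mem_nhdsWithin
    have h2 : ∀ᶠ K in 𝓝[S \ {K0}] K0, K ∈ Metric.closedBall K0 1 :=
      nhdsWithin_le_nhds (Metric.closedBall_mem_nhds K0 one_pos)
    filter_upwards [h1, h2] with K h1 h2
    exact ⟨h1.1, h1.2, by simpa [Real.dist_eq] using h2⟩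
  obtain ⟨P, hP⟩ := isCompact_Icc.exists_bound_of_continuousOn hp
  have hP0 : 0 ≤ P := (norm_nonneg _).trans (hP a ha)
  have main : Tendsto (fun K => ∫ x in a..b, p x * ((Y K x ^ 2 - v x ^ 2) / (K - K0)))
      (𝓝[S \ {K0}] K0) (𝓝 (∫ x in a..b, p x * (2 * v x ^ 2 * HH a v v x))) := by
    apply domconv B.hab.le (C := P * (((M1 * (M / m ^ 2 * (b - a) * (b - a)) * M) * (b - a)) *
      ((M1 + M) * (b - a))))
    · filter_upwards [hnear] with K ⟨hK, hne, hK1⟩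
      refine ⟨hp.mul ((((hs K hK).cont.pow 2).sub (B.cont.pow 2)).div_const _), ?_⟩
      intro x hx
      have hxa : x - a ≤ b - a := by linarith [hx.2]
      have hxa0 : 0 ≤ x - a := by linarith [hx.1]
      have h1 := hstab K hK hK1 x hx
      have h2 := hY K hK hK1 x hx
      have h3 := B.hM x hx
      have hpos : 0 < |K - K0| := abs_pos.2 (sub_ne_zero.2 hne)
      have h4 : |Y K x + v x| ≤ (M1 + M) * (b - a) := by
        calc _ ≤ |Y K x| + |v x| := abs_add_le _ _
          _ ≤ M1 * (x - a) + M * (x - a) := add_le_add h2 h3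
          _ = (M1 + M) * (x - a) := by ring
          _ ≤ _ := by gcongr
      have h5 : |(Y K x - v x) / (K - K0)| ≤
          (M1 * (M / m ^ 2 * (b - a) * (b - a)) * M) * (b - a) := by
        rw [abs_div, div_le_iff₀ hpos]
        calc _ ≤ _ := h1
          _ ≤ |K - K0| * (M1 * (M / m ^ 2 * (b - a) * (b - a)) * M) * (b - a) := by gcongr
          _ = _ := by ring
      have e : p x * ((Y K x ^ 2 - v x ^ 2) / (K - K0)) =
        p x * ((Y K x - v x) / (K - K0) * (Y K x + v x)) := by ring
      rw [e, abs_mul, abs_mul]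
      gcongr
      exact hP x hx
    · intro x hx
      have := (Kderiv B hM1 hK0 hv hq hs hY x hx).pow 2
      rw [hasDerivWithinAt_iff_tendsto_slope] at this
      have h2 := this.const_mul (p x)
      have e : p x * (2 * v x ^ 2 * HH a v v x) =
        p x * (((2 : ℕ) : ℝ) * Y K0 x ^ (2 - 1) * (v x * HH a v v x)) := by
        rw [← hv]; push_cast; ring
      rw [e]
      refine h2.congr fun K => ?_
      rw [slope_def_field, hv]
      simp
  refine main.congr' ?_
  filter_upwards [hnear] with K ⟨hK, hne, hK1⟩
  rw [slope_def_field, ← hv]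
  have h5 : IntervalIntegrable (fun x => p x * Y K x ^ 2) volume a b :=
    ii_of_cont (hp.mul ((hs K hK).cont.pow 2)) ha hb
  have h6 : IntervalIntegrable (fun x => p x * v x ^ 2) volume a b :=
    ii_of_cont (hp.mul (B.cont.pow 2)) ha hb
  rw [← intervalIntegral.integral_sub h5 h6, ← intervalIntegral.integral_div]
  congr 1
  funext x
  ring

/-- sign of the mixed derivative -/
theorem HH_lt {a b M m : ℝ} {v : ℝ → ℝ} (B : Base a b M m v) :
    ∀ x ∈ Ico a b, HH a v v x < HH a v v b := by
  intro x hx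
  have ha : a ∈ Icc a b := ⟨le_rfl, B.hab.le⟩
  have hb : b ∈ Icc a b := ⟨B.hab.le, le_rfl⟩
  have hc := B.gg_cont B.cont B.hM
  have h1 := intervalIntegral.integral_add_adjacent_intervals
    (ii_of_cont hc ha (Ico_subset_Icc_self hx)) (ii_of_cont hc (Ico_subset_Icc_self hx) hb)
  have h2 : 0 < ∫ s in x..b, gg a v v s := by
    apply intervalIntegral.intervalIntegral_pos_of_pos_on
      (ii_of_cont hc (Ico_subset_Icc_self hx) hb) _ hx.2
    intro s hs
    have hsI : s ∈ Ioc a b := ⟨hx.1.trans_lt hs.1, hs.2.le⟩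
    have hvs := B.ne s hsI
    apply div_pos _ (by positivity)
    apply intervalIntegral.intervalIntegral_pos_of_pos_on _ _ hsI.1
    · exact ii_of_cont (B.cont.mul B.cont) ha (Ioc_subset_Icc_self hsI)
    · intro t ht
      exact mul_self_pos.2 (B.ne t ⟨ht.1, ht.2.le.trans hsI.2⟩)
  unfold HH
  linarith

theorem HH_cont {a b M m : ℝ} {v : ℝ → ℝ} (B : Base a b M m v) :
    ContinuousOn (HH a v v) (Icc a b) := by
  have := intervalIntegral.continuousOn_primitive_interval (μ := volume) (a := a) (b := b)
    (f := gg a v v)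
    (by rw [uIcc_of_le B.hab.le]; exact (B.gg_cont B.cont B.hM).integrableOn_Icc)
  rwa [uIcc_of_le B.hab.le] at this

theorem Kfinal {a b M m M1 K0 : ℝ} {S : Set ℝ} {q v p : ℝ → ℝ} {Y Y' : ℝ → ℝ → ℝ}
    (B : Base a b M m v) (hM1 : 0 ≤ M1) (hK0 : K0 ∈ S) (hv : v = Y K0)
    (hq : ContinuousOn q (Icc a b)) (hp : ContinuousOn p (Icc a b))
    (hs : ∀ K ∈ S, Sol a b (fun x => K + q x) (Y K) (Y' K))
    (hY : ∀ K ∈ S, |K - K0| ≤ 1 → ∀ x ∈ Icc a b, |Y K x| ≤ M1 * (x - a)) :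
    HasDerivWithinAt (fun K => (∫ x in a..b, p x * Y K x ^ 2) / Y K b ^ 2)
      ((∫ x in a..b, p x * (2 * v x ^ 2 * (HH a v v x - HH a v v b))) / v b ^ 2) S K0 := by
  have ha : a ∈ Icc a b := ⟨le_rfl, B.hab.le⟩
  have hb : b ∈ Icc a b := ⟨B.hab.le, le_rfl⟩
  have hvb : v b ≠ 0 := B.ne b ⟨B.hab, le_rfl⟩
  have h1 := Kint B hM1 hK0 hv hq hp hs hY
  have h2 : HasDerivWithinAt (fun K => Y K b ^ 2) (2 * v b * (v b * HH a v v b)) S K0 := by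
    refine ((Kderiv B hM1 hK0 hv hq hs hY b hb).pow 2).congr_deriv ?_
    rw [← hv]; simp
  have hvb2 : Y K0 b ^ 2 ≠ 0 := by rw [← hv]; positivity
  refine (h1.div h2 hvb2).congr_deriv ?_
  have h5 : IntervalIntegrable (fun x => p x * (2 * v x ^ 2 * HH a v v x)) volume a b :=
    ii_of_cont (hp.mul ((continuousOn_const.mul (B.cont.pow 2)).mul (HH_cont B))) ha hb
  have h6 : IntervalIntegrable (fun x => p x * v x ^ 2) volume a b :=
    ii_of_cont (hp.mul (B.cont.pow 2)) ha hb
  have e : (∫ x in a..b, p x * (2 * v x ^ 2 * (HH a v v x - HH a v v b))) =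
    (∫ x in a..b, p x * (2 * v x ^ 2 * HH a v v x)) -
      (2 * HH a v v b) * ∫ x in a..b, p x * v x ^ 2 := by
    rw [← intervalIntegral.integral_const_mul, ← intervalIntegral.integral_sub h5
      (h6.const_mul _)]
    congr 1
    funext x
    ring
  rw [e, ← hv]
  generalize (∫ x in a..b, p x * (2 * v x ^ 2 * HH a v v x)) = I1
  generalize (∫ x in a..b, p x * v x ^ 2) = I2
  field_simp

theorem mixed_sign_pos {a b M m : ℝ} {v p : ℝ → ℝ} (B : Base a b M m v)
    (hp : ContinuousOn p (Icc a b)) (hp0 : ∀ x ∈ Icc a b, p x < 0) :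
    0 < (∫ x in a..b, p x * (2 * v x ^ 2 * (HH a v v x - HH a v v b))) / v b ^ 2 := by
  have ha : a ∈ Icc a b := ⟨le_rfl, B.hab.le⟩
  have hb : b ∈ Icc a b := ⟨B.hab.le, le_rfl⟩
  have hvb : v b ≠ 0 := B.ne b ⟨B.hab, le_rfl⟩
  apply div_pos _ (by positivity)
  apply intervalIntegral.intervalIntegral_pos_of_pos_on _ _ B.hab
  · exact ii_of_cont (hp.mul ((continuousOn_const.mul (B.cont.pow 2)).mul
      ((HH_cont B).sub continuousOn_const))) ha hb
  · intro x hx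
    have h1 := hp0 x (Ioo_subset_Icc_self hx)
    have h2 := HH_lt B x (Ioo_subset_Ico_self hx)
    have h3 := B.ne x (Ioo_subset_Ioc_self hx)
    exact mul_pos_of_neg_of_neg h1 (mul_neg_of_pos_of_neg (by positivity) (by linarith))

theorem cderiv {a b M m M1 R c : ℝ} {q v v' p : ℝ → ℝ} {Q Z Z' r : ℝ → ℝ → ℝ}
    (B : Base a b M m v) (hM1 : 0 ≤ M1) (hR : 0 ≤ R) (hS : Sol a b q v v')
    (hq : ContinuousOn q (Icc a b)) (hZc : Z c = v) (hZc' : Z' c = v')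
    (hev : ∀ᶠ c' in 𝓝 c, Sol a b (Q c') (Z c') (Z' c') ∧ ContinuousOn (Q c') (Icc a b) ∧
      ContinuousOn (r c') (Icc a b) ∧
      ∀ x ∈ Icc a b, |Z c' x| ≤ M1 * (x - a) ∧ Q c' x - q x = (c' - c) * r c' x ∧ |r c' x| ≤ R)
    (hr : ∀ x ∈ Icc a b, Tendsto (fun c' => r c' x) (𝓝 c) (𝓝 (p x))) :
    HasDerivAt (fun c' => Z' c' b / Z c' b) ((∫ x in a..b, p x * v x ^ 2) / v b ^ 2) c := by
  have ha : a ∈ Icc a b := ⟨le_rfl, B.hab.le⟩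
  have hb : b ∈ Icc a b := ⟨B.hab.le, le_rfl⟩
  have hvb : v b ≠ 0 := B.ne b ⟨B.hab, le_rfl⟩
  have hba : 0 < b - a := sub_pos.2 B.hab
  have hM0 := B.hM0
  have hZ : ∀ x ∈ Icc a b, Tendsto (fun c' => Z c' x) (𝓝 c) (𝓝 (v x)) := by
    intro x hx
    apply tendsto_of_lin (c := c)
      (C := R * (M1 * (M / m ^ 2 * (b - a) * (b - a)) * M) * (x - a)) le_rfl
    filter_upwards [hev] with c' ⟨h1, h2, _, h3⟩
    refine (hS.stab (D := |c' - c| * R) B h1 hq h2 (by positivity) hM1 (fun x hx => ?_)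
      (fun x hx => (h3 x hx).1) x hx).trans (le_of_eq (by ring))
    rw [(h3 x hx).2.1, abs_mul]
    exact mul_le_mul_of_nonneg_left (h3 x hx).2.2 (abs_nonneg _)
  have hint : Tendsto (fun c' => ∫ x in a..b, r c' x * Z c' x * v x) (𝓝 c)
      (𝓝 (∫ x in a..b, p x * v x ^ 2)) := by
    apply domconv B.hab.le (C := R * (M1 * (b - a)) * (M * (b - a)))
    · filter_upwards [hev] with c' ⟨h1, h2, h4, h3⟩
      refine ⟨(h4.mul h1.cont).mul B.cont, fun x hx => ?_⟩
      obtain ⟨h5, -, h6⟩ := h3 x hx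
      have hxa : x - a ≤ b - a := by linarith [hx.2]
      rw [abs_mul, abs_mul]
      have h7 := B.hM x hx
      have h8 : |Z c' x| ≤ M1 * (b - a) := h5.trans (by gcongr)
      have h9 : |v x| ≤ M * (b - a) := h7.trans (by gcongr)
      gcongr
    · intro x hx
      have := ((hr x hx).mul (hZ x hx)).mul_const (v x)
      have e : p x * v x ^ 2 = p x * v x * v x := by ring
      rw [e]; exact this
  rw [hasDerivAt_iff_tendsto_slope]
  have hne : ∀ᶠ c' in 𝓝 c, Z c' b ≠ 0 := (hZ b hb).eventually_ne hvb
  have hlim := (hint.div ((hZ b hb).mul_const (v b)) (mul_self_ne_zero.2 hvb)).mono_left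
    (nhdsWithin_le_nhds (s := {c}ᶜ))
  rw [← pow_two] at hlim
  refine hlim.congr' ?_
  filter_upwards [nhdsWithin_le_nhds hev, nhdsWithin_le_nhds hne, self_mem_nhdsWithin]
    with c' ⟨h1, h2, h4, h3⟩ hn hcc
  have hcc' : c' - c ≠ 0 := sub_ne_zero.2 hcc
  have hw := hS.wronskian h1 hq h2 b hb
  have e : (∫ t in a..b, ((Q c' t - q t) * Z c' t) * v t) =
      (c' - c) * ∫ x in a..b, r c' x * Z c' x * v x := by
    rw [← intervalIntegral.integral_const_mul]
    apply intervalIntegral.integral_congr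
    intro x hx
    rw [uIcc_of_le B.hab.le] at hx
    simp only [(h3 x hx).2.1]
    ring
  rw [e] at hw
  rw [slope_def_field, hZc, hZc', div_sub_div _ _ hn hvb, hw]
  show (∫ x in a..b, r c' x * Z c' x * v x) / (Z c' b * v b) = _
  field_simp

theorem mixed_sign_neg {a b M m : ℝ} {v p : ℝ → ℝ} (B : Base a b M m v)
    (hp : ContinuousOn p (Icc a b)) (hp0 : ∀ x ∈ Icc a b, 0 < p x) :
    (∫ x in a..b, p x * (2 * v x ^ 2 * (HH a v v x - HH a v v b))) / v b ^ 2 < 0 := by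
  have := mixed_sign_pos (p := fun x => - p x) B hp.neg (fun x hx => neg_neg_of_pos (hp0 x hx))
  simp only [neg_mul, intervalIntegral.integral_neg, neg_div] at this
  linarith





/-- Sign of the mixed derivative `∂_K ∂_c Y⁻`: it is negative when `(U⁻)'' > 0`
and positive when `(U⁻)'' < 0`. -/
theorem mixed_deriv_sign_Y_minus
    (hm : ℝ) (hhm : 0 < hm)
    (Um Um' Um'' : ℝ → ℝ)
    (hUm : ∀ x ∈ Icc (-hm) (0:ℝ), HasDerivAt Um (Um' x) x)
    (hUm' : ∀ x ∈ Icc (-hm) (0:ℝ), HasDerivAt Um' (Um'' x) x)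
    (hUmc : ContinuousOn Um'' (Icc (-hm) (0:ℝ)))
    (y y' y'' : ℝ → ℝ → ℝ → ℝ)
    (hsol : ∀ c : ℝ, (∀ x ∈ Icc (-hm) (0:ℝ), Um x ≠ c) → ∀ K ∈ Ici (0:ℝ),
      (∀ x ∈ Icc (-hm) (0:ℝ),
        HasDerivAt (y c K) (y' c K x) x ∧ HasDerivAt (y' c K) (y'' c K x) x ∧
        -y'' c K x + (K + Um'' x / (Um x - c)) * y c K x = 0) ∧
      y c K (-hm) = 0 ∧ y' c K (-hm) = 1) :
    ∀ c : ℝ, (∀ x ∈ Icc (-hm) (0:ℝ), Um x ≠ c) → ∀ K ∈ Ici (0:ℝ),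
      ∃ Dc : ℝ → ℝ,
        (∀ K' ∈ Ici (0:ℝ),
          HasDerivAt (fun c' => y' c' K' 0 / y c' K' 0) (Dc K') c) ∧
        ∃ m : ℝ, HasDerivWithinAt Dc m (Ici 0) K ∧
          ((∀ x ∈ Icc (-hm) (0:ℝ), 0 < Um'' x) → m < 0) ∧
          ((∀ x ∈ Icc (-hm) (0:ℝ), Um'' x < 0) → 0 < m) := by
  intro c hc K hK
  have hab : -hm < (0:ℝ) := by linarith
  have ha : -hm ∈ Icc (-hm) (0:ℝ) := ⟨le_rfl, hab.le⟩
  have hUc : ContinuousOn Um (Icc (-hm) (0:ℝ)) :=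
    fun x hx => (hUm x hx).continuousAt.continuousWithinAt
  obtain ⟨x0, hx0, hmin⟩ := isCompact_Icc.exists_isMinOn (nonempty_Icc.2 hab.le)
    (hUc.sub (continuousOn_const (c := c))).abs
  obtain ⟨d, hd⟩ : ∃ d, d = |Um x0 - c| := ⟨_, rfl⟩
  have hd0 : 0 < d := hd ▸ abs_pos.2 (sub_ne_zero.2 (hc x0 hx0))
  have hdl : ∀ x ∈ Icc (-hm) (0:ℝ), d ≤ |Um x - c| := fun x hx => hd ▸ hmin hx
  obtain ⟨A, hA⟩ := isCompact_Icc.exists_bound_of_continuousOn hUmc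
  have hA0 : 0 ≤ A := (norm_nonneg _).trans (hA _ ha)
  have hdl' : ∀ c', |c' - c| < d / 2 → ∀ x ∈ Icc (-hm) (0:ℝ), d / 2 ≤ |Um x - c'| := by
    intro c' hc' x hx
    have h1 := hdl x hx
    have h2 : |Um x - c| ≤ |Um x - c'| + |c' - c| := by
      have := abs_add_le (Um x - c') (c' - c)
      simpa using this
    linarith
  have hcc' : ∀ c', |c' - c| < d / 2 → ∀ x ∈ Icc (-hm) (0:ℝ), Um x ≠ c' := by
    intro c' hc' x hx h0
    have := hdl' c' hc' x hx
    rw [h0, sub_self, abs_zero] at this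
    linarith
  have hS : ∀ c : ℝ, (∀ x ∈ Icc (-hm) (0:ℝ), Um x ≠ c) → ∀ K ∈ Ici (0:ℝ),
      Sol (-hm) 0 (fun x => K + Um'' x / (Um x - c)) (y c K) (y' c K) := by
    intro c hc K hK
    obtain ⟨h1, h2, h3⟩ := hsol c hc K hK
    refine ⟨fun x hx => (h1 x hx).1, fun x hx => (h1 x hx).2.1.congr_deriv ?_, h2, h3⟩
    linarith [(h1 x hx).2.2]
  have hqc : ∀ c : ℝ, (∀ x ∈ Icc (-hm) (0:ℝ), Um x ≠ c) →
      ContinuousOn (fun x => Um'' x / (Um x - c)) (Icc (-hm) (0:ℝ)) := fun c hc =>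
    hUmc.div (hUc.sub continuousOn_const) (fun x hx => sub_ne_zero.2 (hc x hx))
  have hqb : ∀ c' e : ℝ, 0 < e → (∀ x ∈ Icc (-hm) (0:ℝ), e ≤ |Um x - c'|) →
      ∀ K L : ℝ, 0 ≤ K → K ≤ L → ∀ x ∈ Icc (-hm) (0:ℝ), |K + Um'' x / (Um x - c')| ≤ L + A / e := by
    intro c' e he h K L hK hL x hx
    have h1 : |Um'' x / (Um x - c')| ≤ A / e := by
      rw [abs_div]
      have h2 := hA x hx
      have h3 := h x hx
      rw [Real.norm_eq_abs] at h2
      gcongr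
    calc _ ≤ |K| + |Um'' x / (Um x - c')| := abs_add_le _ _
      _ ≤ _ := by rw [abs_of_nonneg hK]; gcongr
  have hBase : ∀ K ∈ Ici (0:ℝ), ∃ M m, Base (-hm) 0 M m (y c K) := by
    intro K hK
    have hK' : 0 ≤ K := hK
    have hs := hS c hc K hK
    obtain ⟨m, hm0, hml⟩ := hs.lower hab (hs.ne (W := fun x => Um x - c) hK
      (fun x hx => (hUm x hx).sub_const c) hUm' (fun x hx => sub_ne_zero.2 (hc x hx))
      (fun x hx => rfl))
    exact ⟨_, m, hab, hm0, (Real.exp_pos _).le, hs.cont,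
      hs.bound (B := K + A / d) (by positivity) (hqb c d hd0 hdl K K hK le_rfl), hml⟩
  have hpc : ContinuousOn (fun x => Um'' x / (Um x - c) ^ 2) (Icc (-hm) (0:ℝ)) :=
    hUmc.div ((hUc.sub continuousOn_const).pow 2)
      (fun x hx => pow_ne_zero 2 (sub_ne_zero.2 (hc x hx)))
  refine ⟨fun K => (∫ x in (-hm)..0, Um'' x / (Um x - c) ^ 2 * y c K x ^ 2) / y c K 0 ^ 2, ?_, ?_⟩
  · intro K hK
    have hK' : 0 ≤ K := hK
    obtain ⟨M, m, B⟩ := hBase K hK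
    apply cderiv (Q := fun c' x => K + Um'' x / (Um x - c')) (Z := fun c' => y c' K)
      (Z' := fun c' => y' c' K) (r := fun c' x => Um'' x / ((Um x - c') * (Um x - c)))
      (R := A / (d / 2 * d)) (p := fun x => Um'' x / (Um x - c) ^ 2)
      (M1 := Real.exp ((K + A / (d / 2) + 1) * (0 - -hm))) B (Real.exp_pos _).le (by positivity)
      (hS c hc K hK) (continuousOn_const.add (hqc c hc)) rfl rfl
    · have hball : ∀ᶠ c' in 𝓝 c, c' ∈ Metric.ball c (d / 2) := Metric.ball_mem_nhds c (by positivity)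
      filter_upwards [hball] with c' hc'
      rw [Metric.mem_ball, Real.dist_eq] at hc'
      have hne := hcc' c' hc'
      refine ⟨hS c' hne K hK, continuousOn_const.add (hqc c' hne), ?_, fun x hx => ⟨?_, ?_, ?_⟩⟩
      · exact hUmc.div ((hUc.sub continuousOn_const).mul (hUc.sub continuousOn_const))
          (fun x hx => mul_ne_zero (sub_ne_zero.2 (hne x hx)) (sub_ne_zero.2 (hc x hx)))
      · exact (hS c' hne K hK).bound (by positivity)
          (hqb c' (d / 2) (by positivity) (hdl' c' hc') K K hK le_rfl) x hx
      · have h1 := sub_ne_zero.2 (hne x hx)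
        have h2 := sub_ne_zero.2 (hc x hx)
        field_simp
        ring
      · have h2 := hA x hx
        have h3 := hdl x hx
        have h4 := hdl' c' hc' x hx
        rw [Real.norm_eq_abs] at h2
        rw [abs_div, abs_mul]
        gcongr
    · intro x hx
      have h2 := sub_ne_zero.2 (hc x hx)
      have : ContinuousAt (fun c' => Um'' x / ((Um x - c') * (Um x - c))) c :=
        ContinuousAt.div (by fun_prop) (by fun_prop) (mul_ne_zero h2 h2)
      have h3 := this.tendsto
      rwa [← pow_two] at h3
  · have hK' : 0 ≤ K := hK
    obtain ⟨M, m, B⟩ := hBase K hK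
    refine ⟨_, Kfinal (S := Ici 0) (q := fun x => Um'' x / (Um x - c))
      (p := fun x => Um'' x / (Um x - c) ^ 2) (Y := y c) (Y' := y' c)
      (M1 := Real.exp ((K + 1 + A / d + 1) * (0 - -hm))) B (Real.exp_pos _).le hK rfl (hqc c hc) hpc
      (fun K hK => hS c hc K hK) ?_, ?_, ?_⟩
    · intro K1 hK1 hKK
      have := (abs_le.1 hKK).2
      exact (hS c hc K1 hK1).bound (by positivity)
        (hqb c d hd0 hdl K1 (K + 1) hK1 (by linarith))
    · intro hpos
      refine mixed_sign_neg B hpc fun x hx => ?_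
      have h2 := sub_ne_zero.2 (hc x hx)
      exact div_pos (hpos x hx) (by positivity)
    · intro hneg
      refine mixed_sign_pos B hpc fun x hx => ?_
      have h2 := sub_ne_zero.2 (hc x hx)
      exact div_neg_of_neg_of_pos (hneg x hx) (by positivity)
end

section
/- Exactly two non-singular modes for large wave numbers: Let h₊, h₋ > 0, g > 0, σ > 0, 0 < ρ⁺ < ρ⁻, and set ε := ρ⁺/ρ⁻. Let U⁺ ∈ C³([0, h₊]; ℝ) and U⁻ ∈ C³([−h₋, 0]; ℝ) with (U⁺)'(x) ≠ 0 on [0, h₊] and (U⁻)'(x) ≠ 0 on [−h₋, 0], and set a := min(U⁻([−h₋, 0]) ∪ U⁺([0, h₊])), b := max(U⁻([−h₋, 0]) ∪ U⁺([0, h₊])). For k ∈ ℝ and c ∈ ℂ \ (U⁻([−h₋, 0]) ∪ U⁺([0, h₊])), call (c, k) a non-singular mode if there exist twice continuously differentiable v₂⁺ : [0, h₊] → ℂ and v₂⁻ : [−h₋, 0] → ℂ satisfying −(v₂^±)'' + (k² + (U^±)''/(U^± − c)) v₂^± = 0, v₂⁺(h₊) = 0, v₂⁻(−h₋) = 0,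 v₂^±(0) = U^±(0) − c, and g(ρ⁺ − ρ⁻) − σk² = ρ⁻(U⁻)'(0)v₂⁻(0) − ρ⁺(U⁺)'(0)v₂⁺(0) + ρ⁺(v₂⁺)'(0)(U⁺(0) − c) − ρ⁻(v₂⁻)'(0)(U⁻(0) − c). Then there exist k₀ > 0 and C > 0 such that for every k with |k| > k₀: the set of c ∈ ℂ \ (U⁻([−h₋, 0]) ∪ U⁺([0, h₊])) for which (c, k) is a non-singular mode contains exactly two elements c⁺(k) and c⁻(k); both are real, with c⁺(k) > b and c⁻(k) < a; and | c^±(k) − (U⁺(0)ε + U⁻(0))/(1+ε) ∓ √( −ε(U⁺(0) − U⁻(0))²/(1+ε)² + σ|k|/(ρ⁻(1+ε)) ) | ≤ C. -/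
open Set MeasureTheory intervalIntegral

/-- `(c, k)` is a non-singular mode of the two-phase interface problem linearized at the
shear flows `(U^±, 0)`: `c` lies outside the ranges of `U⁻` and `U⁺` and the eigenvalue
problem (Rayleigh equations, boundary, normalization, and interface conditions) has a
solution. -/
def IsNonSingularMode (hp hm ρp ρm g σ : ℝ)
    (Up Um Up' Um' Up'' Um'' : ℝ → ℝ) (k : ℝ) (c : ℂ) : Prop :=
  (∀ x ∈ Set.Icc (-hm) (0:ℝ), (Um x : ℂ) ≠ c) ∧
  (∀ x ∈ Set.Icc (0:ℝ) hp, (Up x : ℂ) ≠ c) ∧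
  ∃ vp vp' vp'' vm vm' vm'' : ℝ → ℂ,
    (∀ x ∈ Set.Icc (0:ℝ) hp,
      HasDerivAt vp (vp' x) x ∧ HasDerivAt vp' (vp'' x) x ∧
      -vp'' x + ((k : ℂ) ^ 2 + (Up'' x : ℂ) / ((Up x : ℂ) - c)) * vp x = 0) ∧
    (∀ x ∈ Set.Icc (-hm) (0:ℝ),
      HasDerivAt vm (vm' x) x ∧ HasDerivAt vm' (vm'' x) x ∧
      -vm'' x + ((k : ℂ) ^ 2 + (Um'' x : ℂ) / ((Um x : ℂ) - c)) * vm x = 0) ∧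
    vp hp = 0 ∧ vm (-hm) = 0 ∧
    vp 0 = (Up 0 : ℂ) - c ∧ vm 0 = (Um 0 : ℂ) - c ∧
    ((g * (ρp - ρm) - σ * k ^ 2 : ℝ) : ℂ)
      = (ρm : ℂ) * (Um' 0 : ℂ) * vm 0 - (ρp : ℂ) * (Up' 0 : ℂ) * vp 0
        + (ρp : ℂ) * vp' 0 * ((Up 0 : ℂ) - c)
        - (ρm : ℂ) * vm' 0 * ((Um 0 : ℂ) - c)


/-- Weighted real boundary value problem in divergence form, with its boundary flux. -/
def RSol (h : ℝ) (p : ℝ → ℝ) (k s : ℝ) : Prop :=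
  ∃ w w' P : ℝ → ℝ, (∀ x ∈ Icc (0:ℝ) h, HasDerivAt w (w' x) x ∧ P x = p x * w' x ∧
    HasDerivAt P (k ^ 2 * p x * w x) x) ∧ ContinuousOn w' (Icc 0 h) ∧
    w 0 = 1 ∧ w h = 0 ∧ s = -P 0

theorem ftc_icc {E : Type*} [NormedAddCommGroup E] [NormedSpace ℝ E] [CompleteSpace E]
    {h : ℝ} (hh : 0 ≤ h) {f f' : ℝ → E}
    (hf : ∀ x ∈ Icc (0:ℝ) h, HasDerivAt f (f' x) x) (hc : ContinuousOn f' (Icc 0 h)) :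
    ∫ x in (0:ℝ)..h, f' x = f h - f 0 := by
  apply integral_eq_sub_of_hasDerivAt
  · intro x hx; rw [uIcc_of_le hh] at hx; exact hf x hx
  · apply ContinuousOn.intervalIntegrable; rwa [uIcc_of_le hh]

theorem int_mono {h : ℝ} (hh : 0 ≤ h) {f g : ℝ → ℝ}
    (hf : ContinuousOn f (Icc 0 h)) (hg : ContinuousOn g (Icc 0 h))
    (hle : ∀ x ∈ Icc (0:ℝ) h, f x ≤ g x) :
    ∫ x in (0:ℝ)..h, f x ≤ ∫ x in (0:ℝ)..h, g x := by
  apply integral_mono_on hh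
  · apply ContinuousOn.intervalIntegrable; rwa [uIcc_of_le hh]
  · apply ContinuousOn.intervalIntegrable; rwa [uIcc_of_le hh]
  · exact hle

theorem cont_of_deriv {E : Type*} [NormedAddCommGroup E] [NormedSpace ℝ E]
    {s : Set ℝ} {f f' : ℝ → E}
    (hf : ∀ x ∈ s, HasDerivAt f (f' x) x) : ContinuousOn f s :=
  fun x hx => (hf x hx).continuousAt.continuousWithinAt

theorem RSol.min {h k s : ℝ} {p : ℝ → ℝ} (hh : 0 ≤ h) (hp : ContinuousOn p (Icc 0 h))
    (hp0 : ∀ x ∈ Icc (0:ℝ) h, 0 ≤ p x) (H : RSol h p k s) {f f' : ℝ → ℝ}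
    (hf : ∀ x ∈ Icc (0:ℝ) h, HasDerivAt f (f' x) x) (hf' : ContinuousOn f' (Icc 0 h))
    (f0 : f 0 = 1) (fh : f h = 0) :
    s ≤ ∫ x in (0:ℝ)..h, p x * (f' x ^ 2 + k ^ 2 * f x ^ 2) := by
  obtain ⟨w, w', P, hw, hwc, w0, wh, rfl⟩ := H
  have c1 := cont_of_deriv (fun x hx => (hw x hx).1)
  have c2 := cont_of_deriv (fun x hx => (hw x hx).2.2)
  have c3 := cont_of_deriv hf
  have key := ftc_icc hh (f := fun x => P x * (2 * f x - w x))
    (f' := fun x => k ^ 2 * p x * w x * (2 * f x - w x) + P x * (2 * f' x - w' x))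
    (fun x hx => (hw x hx).2.2.mul (((hf x hx).const_mul 2).sub (hw x hx).1))
    (by fun_prop)
  have := int_mono hh
    (f := fun x => k ^ 2 * p x * w x * (2 * f x - w x) + P x * (2 * f' x - w' x))
    (g := fun x => p x * (f' x ^ 2 + k ^ 2 * f x ^ 2)) (by fun_prop) (by fun_prop)
    (by
      intro x hx
      have e := (hw x hx).2.1
      have := mul_nonneg (hp0 x hx) (sq_nonneg (f' x - w' x))
      have := mul_nonneg (hp0 x hx) (sq_nonneg (k * (f x - w x)))
      simp only [e]; nlinarith)
  simp only [key, f0, fh, w0, wh] at this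
  linarith

theorem RSol.eq {h k s : ℝ} {p : ℝ → ℝ} (hh : 0 ≤ h) (hp : ContinuousOn p (Icc 0 h))
    (H : RSol h p k s) : ∃ w w' : ℝ → ℝ, (∀ x ∈ Icc (0:ℝ) h, HasDerivAt w (w' x) x) ∧
      ContinuousOn w' (Icc 0 h) ∧ w 0 = 1 ∧ w h = 0 ∧
      s = ∫ x in (0:ℝ)..h, p x * (w' x ^ 2 + k ^ 2 * w x ^ 2) := by
  obtain ⟨w, w', P, hw, hwc, w0, wh, rfl⟩ := H
  refine ⟨w, w', fun x hx => (hw x hx).1, hwc, w0, wh, ?_⟩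
  have c1 := cont_of_deriv (fun x hx => (hw x hx).1)
  have key := ftc_icc hh (f := fun x => P x * w x)
    (f' := fun x => p x * (w' x ^ 2 + k ^ 2 * w x ^ 2))
    (fun x hx => by
      refine ((hw x hx).2.2.mul (hw x hx).1).congr_deriv ?_
      rw [(hw x hx).2.1]; ring)
    (by fun_prop)
  rw [key, wh, w0]; ring

theorem RSol.compare {h k s s₂ r : ℝ} {p p₂ : ℝ → ℝ} (hh : 0 ≤ h)
    (hp : ContinuousOn p (Icc 0 h)) (hp0 : ∀ x ∈ Icc (0:ℝ) h, 0 ≤ p x)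
    (hp₂ : ContinuousOn p₂ (Icc 0 h))
    (H : RSol h p k s) (H₂ : RSol h p₂ k s₂)
    (hle : ∀ x ∈ Icc (0:ℝ) h, p x ≤ r * p₂ x) : s ≤ r * s₂ := by
  obtain ⟨w, w', hw, hwc, w0, wh, hs⟩ := H₂.eq hh hp₂
  have c1 := cont_of_deriv hw
  refine (H.min hh hp hp0 hw hwc w0 wh).trans ?_
  rw [hs, ← intervalIntegral.integral_const_mul]
  apply int_mono hh (by fun_prop) (by fun_prop)
  intro x hx
  rw [← mul_assoc]
  exact mul_le_mul_of_nonneg_right (hle x hx) (by positivity)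

theorem exp_int_le {h m : ℝ} (hh : 0 ≤ h) (hm : 0 < m) :
    ∫ x in (0:ℝ)..h, Real.exp (-m * x) ≤ 1 / m := by
  have := ftc_icc hh (f := fun x => -(1 / m) * Real.exp (-m * x))
    (f' := fun x => Real.exp (-m * x))
    (fun x _ => by
      have h1 : HasDerivAt (fun x : ℝ => -m * x) (-m) x := by
        simpa using (hasDerivAt_id x).const_mul (-m)
      refine (h1.exp.const_mul (-(1 / m))).congr_deriv ?_
      field_simp) (by fun_prop)
  rw [this]
  have : 0 ≤ 1 / m * Real.exp (-m * h) := by positivity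
  simp; simp at this; linarith

theorem test_deriv (h k x : ℝ) : HasDerivAt (fun x : ℝ => (1 - x / h) * Real.exp (-k * x))
    ((-(1 / h) - k * (1 - x / h)) * Real.exp (-k * x)) x := by
  have h1 : HasDerivAt (fun x : ℝ => -k * x) (-k) x := by
    simpa using (hasDerivAt_id x).const_mul (-k)
  have h2 : HasDerivAt (fun x : ℝ => 1 - x / h) (-(1 / h)) x := by
    simpa using ((hasDerivAt_id x).div_const h).const_sub 1
  refine (h2.mul h1.exp).congr_deriv ?_
  ring

theorem test_bound {h k x : ℝ} (hh : 0 < h) (hk : 0 < k) (hx : x ∈ Icc 0 h) :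
    ((-(1 / h) - k * (1 - x / h)) * Real.exp (-k * x)) ^ 2 +
      k ^ 2 * ((1 - x / h) * Real.exp (-k * x)) ^ 2 ≤
    (2 * k ^ 2 + 2 * k / h + 1 / h ^ 2) * Real.exp (-(2 * k) * x) := by
  have e : Real.exp (-(2 * k) * x) = Real.exp (-k * x) ^ 2 := by
    rw [← Real.exp_nat_mul]; congr 1; push_cast; ring
  rw [e]
  have t1 : 0 ≤ 1 - x / h := by
    rw [sub_nonneg, div_le_one hh]; exact hx.2
  have t2 : 1 - x / h ≤ 1 := by
    have : 0 ≤ x / h := div_nonneg hx.1 hh.le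
    linarith
  generalize 1 - x / h = t at *
  have hi : 0 < 1 / h := by positivity
  have e1 : 2 * k / h = 2 * k * (1 / h) := by ring
  have e2 : 1 / h ^ 2 = (1 / h) ^ 2 := by ring
  rw [e1, e2]
  generalize 1 / h = i at *
  have ht : t ^ 2 ≤ 1 := by nlinarith
  have : (-i - k * t) ^ 2 + k ^ 2 * t ^ 2 ≤ 2 * k ^ 2 + 2 * k * i + i ^ 2 := by
    have := mul_le_mul_of_nonneg_left ht (sq_nonneg k)
    have := mul_le_mul_of_nonneg_left t2 (mul_pos hk hi).le
    nlinarith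
  have := mul_le_mul_of_nonneg_right this (sq_nonneg (Real.exp (-k * x)))
  nlinarith

theorem RSol.upper {h k s D B : ℝ} {p : ℝ → ℝ} (hh : 0 < h) (hp : ContinuousOn p (Icc 0 h))
    (hp0 : ∀ x ∈ Icc (0:ℝ) h, 0 ≤ p x) (H : RSol h p k s) (hB : 0 ≤ B) (hk : B < k)
    (hD : 0 ≤ D) (hle : ∀ x ∈ Icc (0:ℝ) h, p x ≤ D * Real.exp (2 * B * x)) :
    s * (k - B) ≤ D * (k ^ 2 + k / h + 1 / (2 * h ^ 2)) := by
  have hk0 : 0 < k := by linarith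
  set A := (2 * k ^ 2 + 2 * k / h + 1 / h ^ 2) with hA
  have hA0 : 0 ≤ A := by positivity
  have h1 : s ≤ ∫ x in (0:ℝ)..h, (D * A) * Real.exp (-(2 * (k - B)) * x) := by
    refine (H.min hh.le hp hp0 (fun x _ => test_deriv h k x) (by fun_prop) (by simp)
      (by simp [hh.ne'])).trans ?_
    apply int_mono hh.le (by fun_prop) (by fun_prop)
    intro x hx
    have e : Real.exp (-(2 * (k - B)) * x)
      = Real.exp (2 * B * x) * Real.exp (-(2 * k) * x) := by
      rw [← Real.exp_add]; congr 1; ring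
    rw [e]
    calc _ ≤ (D * Real.exp (2 * B * x)) * (A * Real.exp (-(2 * k) * x)) := by
          apply mul_le_mul (hle x hx) (test_bound hh hk0 hx) (by positivity) (by positivity)
      _ = _ := by ring
  rw [intervalIntegral.integral_const_mul] at h1
  have h2 := exp_int_le hh.le (m := 2 * (k - B)) (by linarith)
  have h3 : s ≤ D * A * (1 / (2 * (k - B))) :=
    h1.trans (mul_le_mul_of_nonneg_left h2 (by positivity))
  have hkB : 0 < k - B := by linarith
  calc s * (k - B) ≤ D * A * (1 / (2 * (k - B))) * (k - B) :=
        mul_le_mul_of_nonneg_right h3 hkB.le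
    _ = _ := by rw [hA]; field_simp

theorem RSol.lower {h k s B : ℝ} {p p' : ℝ → ℝ} (hh : 0 < h)
    (hp : ∀ x ∈ Icc (0:ℝ) h, HasDerivAt p (p' x) x) (hp' : ContinuousOn p' (Icc 0 h))
    (hp0 : ∀ x ∈ Icc (0:ℝ) h, 0 ≤ p x) (H : RSol h p k s) (hB : 0 ≤ B) (hk : 0 < k)
    (hle : ∀ x ∈ Icc (0:ℝ) h, |p' x| ≤ 2 * B * p x) :
    k * p 0 ≤ s * (1 + 2 * B / k) := by
  have cp := cont_of_deriv hp
  obtain ⟨w, w', hw, hwc, w0, wh, hs⟩ := H.eq hh.le cp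
  have c1 := cont_of_deriv hw
  have key := ftc_icc hh.le (f := fun x => -k * (p x * w x ^ 2))
    (f' := fun x => -k * (p' x * w x ^ 2 + p x * (2 * w x * w' x)))
    (fun x hx => by
      have := ((hp x hx).mul ((hw x hx).pow 2)).const_mul (-k)
      refine this.congr_deriv ?_
      simp) (by fun_prop)
  have := int_mono hh.le
    (f := fun x => -k * (p' x * w x ^ 2 + p x * (2 * w x * w' x)))
    (g := fun x => (1 + 2 * B / k) * (p x * (w' x ^ 2 + k ^ 2 * w x ^ 2)))
    (by fun_prop) (by fun_prop)
    (by
      intro x hx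
      have h1 := mul_nonneg (hp0 x hx) (sq_nonneg (w' x + k * w x))
      have h2 : -(p' x) ≤ 2 * B * p x := (neg_le_abs _).trans (hle x hx)
      have h3 := mul_le_mul_of_nonneg_right h2 (mul_nonneg hk.le (sq_nonneg (w x)))
      have h4 : 2 * B / k * (p x * (w' x ^ 2 + k ^ 2 * w x ^ 2)) =
         2 * B / k * (p x * w' x ^ 2) + 2 * B * p x * (k * w x ^ 2) := by
        field_simp
      have h5 : 0 ≤ 2 * B / k * (p x * w' x ^ 2) := by
        have := hp0 x hx
        positivity
      simp only [add_mul _ _ (p x * _), h4]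
      nlinarith)
  rw [key, intervalIntegral.integral_const_mul, ← hs] at this
  simp only [w0, wh] at this
  linarith


theorem clamp_lip (R a b : ℝ) : |max (-R) (min R a) - max (-R) (min R b)| ≤ |a - b| := by
  refine (abs_max_sub_max_le_max _ _ _ _).trans ?_
  simp only [sub_self, abs_zero]
  refine max_le (abs_nonneg _) ?_
  refine (abs_min_sub_min_le_max _ _ _ _).trans ?_
  simp

theorem clamp_abs {R : ℝ} (hR : 0 ≤ R) (a : ℝ) :
    |max (-R) (min R a)| ≤ |a| ∧ |max (-R) (min R a)| ≤ R := by
  constructor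
  · simpa [hR] using clamp_lip R a 0
  · rw [abs_le]; exact ⟨le_max_left _ _, max_le (by linarith) (min_le_left _ _)⟩

theorem ivp_aux (T : ℝ) (hT : 0 < T) (q : ℝ → ℝ) (hq : Continuous q) (M : ℝ) (hM1 : 1 ≤ M)
    (hM : ∀ x, |q x| ≤ M) :
    ∃ y z : ℝ → ℝ, (∀ x ∈ Icc 0 T, HasDerivAt y (z x) x ∧ HasDerivAt z (q x * y x) x) ∧
      y 0 = 0 ∧ z 0 = 1 := by
  set R := Real.exp (M * (T + 1)) with hR
  have hR0 : 0 < R := Real.exp_pos _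
  set cl : ℝ → ℝ := fun a => max (-R) (min R a) with hcl
  set f : ℝ → ℝ × ℝ → ℝ × ℝ := fun t u => (cl u.2, q t * cl u.1) with hf
  have bound1 : ∀ t u, ‖f t u‖ ≤ M * R := by
    intro t u
    rw [Prod.norm_def]
    refine max_le ?_ ?_
    · exact (clamp_abs hR0.le u.2).2.trans (by nlinarith)
    · simp only [hf, norm_mul]
      exact mul_le_mul (hM t) (clamp_abs hR0.le u.1).2 (norm_nonneg _) (by linarith)
  have bound2 : ∀ t u, ‖f t u‖ ≤ M * ‖u‖ := by
    intro t u
    rw [Prod.norm_def]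
    refine max_le ?_ ?_
    · refine (clamp_abs hR0.le u.2).1.trans ?_
      have := norm_snd_le u
      have h0 := norm_nonneg u
      rw [Real.norm_eq_abs] at this
      nlinarith
    · simp only [hf, norm_mul]
      exact mul_le_mul (hM t) ((clamp_abs hR0.le u.1).1.trans (norm_fst_le u))
        (norm_nonneg _) (by linarith)
  have ht0 : (0:ℝ) ∈ Icc (-1 : ℝ) (T + 1) := ⟨by norm_num, by linarith⟩
  have pl : IsPicardLindelof f (tmin := -1) (tmax := T + 1) ⟨0, ht0⟩ ((0:ℝ), (1:ℝ))
      (M * R * (T + 1)).toNNReal 0 (M * R).toNNReal M.toNNReal := by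
    constructor
    · intro t _
      apply LipschitzWith.lipschitzOnWith
      apply LipschitzWith.of_dist_le_mul
      intro u v
      rw [Real.coe_toNNReal _ (by linarith), Prod.dist_eq, Prod.dist_eq]
      have m0 : 0 ≤ max (dist u.1 v.1) (dist u.2 v.2) := le_max_of_le_left dist_nonneg
      refine max_le ?_ ?_
      · refine (clamp_lip R u.2 v.2).trans ?_
        refine (le_max_right (dist u.1 v.1) (dist u.2 v.2)).trans ?_
        nlinarith
      · simp only [hf, Real.dist_eq, ← mul_sub, abs_mul]
        refine mul_le_mul (hM t) ((clamp_lip R u.1 v.1).trans ?_) (abs_nonneg _) (by linarith)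
        exact (le_max_left (dist u.1 v.1) (dist u.2 v.2))
    · intro u _
      simp only [hf]
      fun_prop
    · intro t _ u _
      rw [Real.coe_toNNReal _ (by positivity)]
      exact bound1 t u
    · rw [Real.coe_toNNReal _ (by positivity), Real.coe_toNNReal _ (by positivity)]
      simp only [sub_zero, NNReal.coe_zero, zero_sub, neg_neg]
      rw [max_eq_left (by linarith)]
  obtain ⟨α, h0, hα⟩ := pl.exists_eq_forall_mem_Icc_hasDerivWithinAt₀
  simp only at h0
  have hα' : ∀ x ∈ Icc 0 T, HasDerivAt α (f x (α x)) x := fun x hx =>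
    (hα x ⟨by linarith [hx.1], by linarith [hx.2]⟩).hasDerivAt
      (Icc_mem_nhds (by linarith [hx.1]) (by linarith [hx.2]))
  have gr : ∀ x ∈ Icc 0 T, ‖α x‖ ≤ R := by
    intro x hx
    have := norm_le_gronwallBound_of_norm_deriv_right_le (f := α) (f' := fun x => f x (α x))
      (δ := 1) (K := M) (ε := 0) (a := 0) (b := T) (cont_of_deriv hα')
      (fun x hx => (hα' x ⟨hx.1, hx.2.le⟩).hasDerivWithinAt)
      (by rw [h0, Prod.norm_def]; simp) (fun x _ => by simpa using bound2 x (α x)) x hx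
    refine this.trans ?_
    rw [gronwallBound_ε0, one_mul, hR, Real.exp_le_exp]
    have := hx.2
    nlinarith
  have cleq : ∀ a, |a| ≤ R → cl a = a := by
    intro a ha
    rw [abs_le] at ha
    simp only [hcl]
    rw [min_eq_right ha.2, max_eq_right ha.1]
  refine ⟨fun x => (α x).1, fun x => (α x).2, fun x hx => ?_, by simp [h0], by simp [h0]⟩
  have h1 := hα' x hx
  have e : f x (α x) = ((α x).2, q x * (α x).1) := by
    simp only [hf]
    rw [cleq _ ((norm_snd_le (α x)).trans (gr x hx)), cleq _ ((norm_fst_le (α x)).trans (gr x hx))]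
  rw [e] at h1
  exact ⟨h1.fst, h1.snd⟩

theorem ivp {h : ℝ} (hh : 0 < h) {q : ℝ → ℝ} (hq : ContinuousOn q (Icc 0 h)) :
    ∃ y y' : ℝ → ℝ, (∀ x ∈ Icc 0 h, HasDerivAt y (y' x) x ∧ HasDerivAt y' (q x * y x) x) ∧
      y h = 0 ∧ y' h = -1 := by
  obtain ⟨M, hM⟩ := isCompact_Icc.exists_bound_of_continuousOn hq
  set q₁ : ℝ → ℝ := IccExtend hh.le ((Icc 0 h).domRestrict q) with hq₁
  have cq₁ : Continuous q₁ := (continuousOn_iff_continuous_domRestrict.mp hq).Icc_extend'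
  have bq : ∀ x, |q₁ x| ≤ max 1 M := by
    intro x
    simp only [hq₁, IccExtend, Function.comp]
    exact (hM _ (Subtype.coe_prop _)).trans (le_max_right _ _)
  obtain ⟨y, z, hyz, y0, z0⟩ := ivp_aux h hh (fun t => q₁ (h - t)) (by fun_prop) (max 1 M)
    (le_max_left _ _) (fun x => bq _)
  refine ⟨fun x => y (h - x), fun x => - z (h - x), fun x hx => ?_, by simp [y0], by simp [z0]⟩
  have hx' : h - x ∈ Icc 0 h := ⟨by linarith [hx.2], by linarith [hx.1]⟩
  obtain ⟨h1, h2⟩ := hyz _ hx'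
  have hi : HasDerivAt (fun x : ℝ => h - x) (-1) x := by
    simpa using (hasDerivAt_id x).const_sub h
  have eq : q₁ x = q x := by
    simp only [hq₁]; rw [IccExtend_of_mem _ _ hx]; rfl
  constructor
  · refine (h1.comp x hi).congr_deriv ?_
    ring
  · refine (h2.comp x hi).neg.congr_deriv ?_
    simp [eq]


/-- A monotone `C³` shear flow on `[0,h]`. -/
structure ShearFlow (h : ℝ) (U U' U'' U''' : ℝ → ℝ) : Prop where
  pos : 0 < h
  d1 : ∀ x ∈ Icc (0:ℝ) h, HasDerivAt U (U' x) x
  d2 : ∀ x ∈ Icc (0:ℝ) h, HasDerivAt U' (U'' x) x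
  d3 : ∀ x ∈ Icc (0:ℝ) h, HasDerivAt U'' (U''' x) x
  c3 : ContinuousOn U''' (Icc 0 h)
  ne : ∀ x ∈ Icc (0:ℝ) h, U' x ≠ 0

/-- One-sided Rayleigh boundary value problem. -/
def CSol (h k : ℝ) (U U' U'' : ℝ → ℝ) (c s : ℂ) : Prop :=
  ∃ v v' v'' : ℝ → ℂ, (∀ x ∈ Icc (0:ℝ) h, HasDerivAt v (v' x) x ∧ HasDerivAt v' (v'' x) x ∧
      -v'' x + ((k : ℂ) ^ 2 + (U'' x : ℂ) / ((U x : ℂ) - c)) * v x = 0) ∧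
    v h = 0 ∧ v 0 = (U 0 : ℂ) - c ∧ s = (U' 0 : ℂ) * v 0 - v' 0 * ((U 0 : ℂ) - c)

section
variable {h k : ℝ} {U U' U'' U''' : ℝ → ℝ}

theorem ShearFlow.cU (F : ShearFlow h U U' U'' U''') : ContinuousOn U (Icc 0 h) := cont_of_deriv F.d1
theorem ShearFlow.cU' (F : ShearFlow h U U' U'' U''') : ContinuousOn U' (Icc 0 h) := cont_of_deriv F.d2
theorem ShearFlow.cU'' (F : ShearFlow h U U' U'' U''') : ContinuousOn U'' (Icc 0 h) := cont_of_deriv F.d3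
theorem ShearFlow.mem0 (F : ShearFlow h U U' U'' U''') : (0:ℝ) ∈ Icc 0 h := ⟨le_rfl, F.pos.le⟩
theorem ShearFlow.memh (F : ShearFlow h U U' U'' U''') : h ∈ Icc 0 h := ⟨F.pos.le, le_rfl⟩

theorem wder (F : ShearFlow h U U' U'' U''') {r : ℝ} {u u' : ℝ → ℝ} {x : ℝ} (hx : x ∈ Icc 0 h)
    (hr : U x ≠ r) (hu : HasDerivAt u (u' x) x) :
    HasDerivAt (fun x => u x / (U x - r)) (((U x - r) * u' x - U' x * u x) / (U x - r) ^ 2) x := by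
  refine (hu.div ((F.d1 x hx).sub_const r) (sub_ne_zero.mpr hr)).congr_deriv ?_
  ring

theorem Pder (F : ShearFlow h U U' U'' U''') {r : ℝ} {u u' : ℝ → ℝ} {x : ℝ} (hx : x ∈ Icc 0 h)
    (hr : U x ≠ r) (hu : HasDerivAt u (u' x) x)
    (hu' : HasDerivAt u' ((k ^ 2 + U'' x / (U x - r)) * u x) x) :
    HasDerivAt (fun x => (U x - r) * u' x - U' x * u x)
      (k ^ 2 * (U x - r) ^ 2 * (u x / (U x - r))) x := by
  have := sub_ne_zero.mpr hr
  refine ((((F.d1 x hx).sub_const r).mul hu').sub ((F.d2 x hx).mul hu)).congr_deriv ?_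
  field_simp
  ring

theorem RSol_of_real (F : ShearFlow h U U' U'' U''') {r : ℝ} (hr : ∀ x ∈ Icc 0 h, U x ≠ r)
    {u u' : ℝ → ℝ} (hu : ∀ x ∈ Icc 0 h, HasDerivAt u (u' x) x)
    (hu' : ∀ x ∈ Icc 0 h, HasDerivAt u' ((k ^ 2 + U'' x / (U x - r)) * u x) x)
    (uh : u h = 0) (u0 : u 0 = U 0 - r) :
    RSol h (fun x => (U x - r) ^ 2) k (U' 0 * u 0 - u' 0 * (U 0 - r)) := by
  have hne : ∀ x ∈ Icc 0 h, U x - r ≠ 0 := fun x hx => sub_ne_zero.mpr (hr x hx)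
  refine ⟨fun x => u x / (U x - r), fun x => ((U x - r) * u' x - U' x * u x) / (U x - r) ^ 2,
    fun x => (U x - r) * u' x - U' x * u x, fun x hx => ⟨wder F hx (hr x hx) (hu x hx), ?_,
      Pder F hx (hr x hx) (hu x hx) (hu' x hx)⟩, ?_, ?_, ?_, ?_⟩
  · have := hne x hx
    field_simp
  · have := F.cU
    have := F.cU'
    have := cont_of_deriv hu
    have := cont_of_deriv hu'
    apply ContinuousOn.div (by fun_prop) (by fun_prop)
    intro x hx; exact pow_ne_zero _ (hne x hx)
  · have := hne 0 F.mem0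
    simp only [u0]; field_simp
  · simp [uh]
  · ring

theorem hasDerivAt_re {v : ℝ → ℂ} {v' : ℂ} {x : ℝ} (hv : HasDerivAt v v' x) :
    HasDerivAt (fun x => (v x).re) v'.re x :=
  (Complex.reCLM.hasFDerivAt.comp_hasDerivAt x hv)

theorem CSol.real (F : ShearFlow h U U' U'' U''') {r : ℝ} (hr : ∀ x ∈ Icc 0 h, U x ≠ r) {s : ℂ}
    (H : CSol h k U U' U'' r s) : RSol h (fun x => (U x - r) ^ 2) k s.re := by
  obtain ⟨v, v', v'', hv, vh, v0, rfl⟩ := H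
  have := RSol_of_real (k := k) F hr (u := fun x => (v x).re) (u' := fun x => (v' x).re)
    (fun x hx => hasDerivAt_re (hv x hx).1)
    (fun x hx => by
      refine (hasDerivAt_re (hv x hx).2.1).congr_deriv ?_
      have e : v'' x = ((k ^ 2 + U'' x / (U x - r) : ℝ) : ℂ) * v x := by
        have := (hv x hx).2.2
        push_cast
        linear_combination -this
      rw [e, Complex.re_ofReal_mul])
    (by simp [vh]) (by simp [v0])
  convert this using 1
  simp [← Complex.ofReal_sub]

theorem CSol.exists (F : ShearFlow h U U' U'' U''') (hk : 0 < k) {r : ℝ}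
    (hr : ∀ x ∈ Icc 0 h, U x ≠ r) : ∃ s : ℝ, CSol h k U U' U'' r s := by
  have hne : ∀ x ∈ Icc 0 h, U x - r ≠ 0 := fun x hx => sub_ne_zero.mpr (hr x hx)
  have cU := F.cU
  have cU' := F.cU'
  have cU'' := F.cU''
  obtain ⟨y, y', hy, yh, yh'⟩ := ivp F.pos (q := fun x => k ^ 2 + U'' x / (U x - r)) (by
    apply ContinuousOn.add (by fun_prop)
    exact cU''.div (by fun_prop) hne)
  have y0 : y 0 ≠ 0 := by
    intro y0
    have cy := cont_of_deriv (fun x hx => (hy x hx).1)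
    have cy' := cont_of_deriv (fun x hx => (hy x hx).2)
    have cc : ContinuousOn (fun x => (U x - r) ^ 2 *
        ((((U x - r) * y' x - U' x * y x) / (U x - r) ^ 2) ^ 2
          + k ^ 2 * (y x / (U x - r)) ^ 2)) (Icc 0 h) := by
      have h1 : ContinuousOn (fun x => y x / (U x - r)) (Icc 0 h) := cy.div (by fun_prop) hne
      have h2 : ContinuousOn (fun x => ((U x - r) * y' x - U' x * y x) / (U x - r) ^ 2)
        (Icc 0 h) := ContinuousOn.div (by fun_prop) (by fun_prop)
          (fun x hx => pow_ne_zero _ (hne x hx))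
      fun_prop
    have key := ftc_icc F.pos.le
      (f := fun x => ((U x - r) * y' x - U' x * y x) * (y x / (U x - r)))
      (f' := fun x => (U x - r) ^ 2 * ((((U x - r) * y' x - U' x * y x) / (U x - r) ^ 2) ^ 2
          + k ^ 2 * (y x / (U x - r)) ^ 2))
      (fun x hx => by
        refine ((Pder (k := k) F hx (hr x hx) (hy x hx).1 (hy x hx).2).mul
          (wder F hx (hr x hx) (hy x hx).1)).congr_deriv ?_
        have := hne x hx
        field_simp
        ring) cc
    simp only [yh, y0] at key
    have pos := intervalIntegral.integral_pos F.pos cc (fun x _ => by positivity)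
      ⟨h, F.memh, by
        have := hne h F.memh
        simp only [yh, yh']
        have : 0 < (((U h - r) * -1 - U' h * 0) / (U h - r) ^ 2) ^ 2 := by
          apply sq_pos_of_ne_zero
          apply div_ne_zero _ (pow_ne_zero _ this)
          intro h0; apply this; linarith
        positivity⟩
    rw [key] at pos
    simp at pos
  refine ⟨U' 0 * (U 0 - r) - (U 0 - r) / y 0 * y' 0 * (U 0 - r),
    fun x => (((U 0 - r) / y 0 * y x : ℝ) : ℂ), fun x => (((U 0 - r) / y 0 * y' x : ℝ) : ℂ),
    fun x => (((U 0 - r) / y 0 * ((k ^ 2 + U'' x / (U x - r)) * y x) : ℝ) : ℂ), fun x hx =>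
    ⟨((hy x hx).1.const_mul _).ofReal_comp, ((hy x hx).2.const_mul _).ofReal_comp, ?_⟩, ?_, ?_, ?_⟩
  · push_cast; ring
  · simp [yh]
  · push_cast; rw [div_mul_cancel₀]; exact_mod_cast y0
  · push_cast
    rw [div_mul_cancel₀]; exact_mod_cast y0

theorem CSol.energy (F : ShearFlow h U U' U'' U''') {c s : ℂ}
    (hr : ∀ x ∈ Icc 0 h, (U x : ℂ) ≠ c) (H : CSol h k U U' U'' c s) :
    ∃ e : ℝ → ℝ, ContinuousOn e (Icc 0 h) ∧ (∀ x, 0 ≤ e x) ∧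
      s.re = (∫ x in (0:ℝ)..h, ((U x - c.re) ^ 2 - c.im ^ 2) * e x) ∧
      s.im = (∫ x in (0:ℝ)..h, -2 * c.im * (U x - c.re) * e x) := by
  obtain ⟨v, v', v'', hv, vh, v0, rfl⟩ := H
  have hne : ∀ x ∈ Icc 0 h, (U x : ℂ) - c ≠ 0 := fun x hx => sub_ne_zero.mpr (hr x hx)
  have cU := F.cU
  have cU' := F.cU'
  have cv := cont_of_deriv (fun x hx => (hv x hx).1)
  have cv' := cont_of_deriv (fun x hx => (hv x hx).2.1)
  have cUc : ContinuousOn (fun x => (U x : ℂ)) (Icc 0 h) :=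
    Complex.continuous_ofReal.comp_continuousOn cU
  have cUc' : ContinuousOn (fun x => (U' x : ℂ)) (Icc 0 h) :=
    Complex.continuous_ofReal.comp_continuousOn cU'
  set w : ℝ → ℂ := fun x => v x / ((U x : ℂ) - c) with hw
  set P : ℝ → ℂ := fun x => ((U x : ℂ) - c) * v' x - U' x * v x with hP
  set w' : ℝ → ℂ := fun x => P x / ((U x : ℂ) - c) ^ 2 with hw'
  have cw : ContinuousOn w (Icc 0 h) := cv.div (by fun_prop) hne
  have cw' : ContinuousOn w' (Icc 0 h) := ContinuousOn.div (by fun_prop) (by fun_prop)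
          (fun x hx => pow_ne_zero _ (hne x hx))
  set e : ℝ → ℝ := fun x => ‖w' x‖ ^ 2 + k ^ 2 * ‖w x‖ ^ 2 with he
  have ce : ContinuousOn e (Icc 0 h) := by fun_prop
  have cec : ContinuousOn (fun x => (e x : ℂ)) (Icc 0 h) :=
    Complex.continuous_ofReal.comp_continuousOn ce
  have key := ftc_icc F.pos.le (f := fun x => P x * star (w x))
    (f' := fun x => ((U x : ℂ) - c) ^ 2 * e x)
    (fun x hx => by
      have n := hne x hx
      have dU := (F.d1 x hx).ofReal_comp
      have dU' := (F.d2 x hx).ofReal_comp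
      have d1 := ((dU.sub_const c).mul (hv x hx).2.1).sub (dU'.mul (hv x hx).1)
      have d2 := ((hv x hx).1.div (dU.sub_const c) n).star
      refine (d1.mul d2).congr_deriv ?_
      have q : v'' x = ((k : ℂ) ^ 2 + (U'' x : ℂ) / ((U x : ℂ) - c)) * v x := by
        linear_combination -(hv x hx).2.2
      have a1 : (v' x * ((U x : ℂ) - c) - v x * (U' x : ℂ)) / ((U x : ℂ) - c) ^ 2 = w' x := by
        simp only [hw', hP]; ring
      have a2 : (((U x : ℂ) - c) * v' x - U' x * v x) = ((U x : ℂ) - c) ^ 2 * w' x := by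
        simp only [hw', hP]; field_simp
      have a3 : v x = ((U x : ℂ) - c) * w x := by simp only [hw]; field_simp
      have a4 : (U' x : ℂ) * v' x + ((U x : ℂ) - c) * v'' x - (U'' x * v x + U' x * v' x)
          = k ^ 2 * ((U x : ℂ) - c) ^ 2 * w x := by
        rw [q]; nth_rw 1 [a3]; rw [a3]; field_simp; ring
      have b1 : (‖w' x‖ : ℂ) ^ 2 = w' x * star (w' x) := (Complex.mul_conj' _).symm
      have b2 : (‖w x‖ : ℂ) ^ 2 = w x * star (w x) := (Complex.mul_conj' _).symm
      simp only [Pi.mul_apply, Pi.sub_apply, Pi.div_apply]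
      rw [a1, a4]
      simp only [he]
      push_cast
      rw [b1, b2, a2]
      simp only [hw]
      ring) (by fun_prop)
  have hs : ∫ x in (0:ℝ)..h, ((U x : ℂ) - c) ^ 2 * e x
      = (U' 0 : ℂ) * v 0 - v' 0 * ((U 0 : ℂ) - c) := by
    rw [key]
    have := hne 0 F.mem0
    have w0 : w 0 = 1 := by simp only [hw, v0]; field_simp
    have wh : w h = 0 := by simp [hw, vh]
    rw [w0, wh]; simp [hP, v0]; ring
  have hi : IntervalIntegrable (fun x => ((U x : ℂ) - c) ^ 2 * e x) volume 0 h := by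
    apply ContinuousOn.intervalIntegrable; rw [uIcc_of_le F.pos.le]; fun_prop
  refine ⟨e, ce, fun x => by positivity, ?_, ?_⟩
  · rw [← hs]
    refine (Complex.reCLM.intervalIntegral_comp_comm hi).symm.trans ?_
    congr 1; ext x
    simp [pow_two]
  · rw [← hs]
    refine (Complex.imCLM.intervalIntegral_comp_comm hi).symm.trans ?_
    congr 1; ext x
    simp [pow_two]
    ring

theorem CSol.howard (F : ShearFlow h U U' U'' U''') {c s : ℂ} {lo hi : ℝ}
    (hlo : ∀ x ∈ Icc 0 h, lo ≤ U x) (hhi : ∀ x ∈ Icc 0 h, U x ≤ hi)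
    (hr : ∀ x ∈ Icc 0 h, (U x : ℂ) ≠ c) (H : CSol h k U U' U'' c s) :
    ∃ M I : ℝ, 0 ≤ M ∧ (lo - c.re) * M ≤ I ∧ I ≤ (hi - c.re) * M ∧ s.im = -2 * c.im * I ∧
      ∀ B, (∀ x ∈ Icc 0 h, |U x - c.re| ≤ B) → s.re ≤ (B ^ 2 - c.im ^ 2) * M := by
  obtain ⟨e, ce, e0, hre, him⟩ := H.energy F hr
  have cU := F.cU
  refine ⟨∫ x in (0:ℝ)..h, e x, ∫ x in (0:ℝ)..h, (U x - c.re) * e x,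
    integral_nonneg F.pos.le (fun x _ => e0 x), ?_, ?_, ?_, ?_⟩
  · rw [← intervalIntegral.integral_const_mul]
    apply int_mono F.pos.le (by fun_prop) (by fun_prop)
    intro x hx; exact mul_le_mul_of_nonneg_right (by linarith [hlo x hx]) (e0 x)
  · rw [← intervalIntegral.integral_const_mul]
    apply int_mono F.pos.le (by fun_prop) (by fun_prop)
    intro x hx; exact mul_le_mul_of_nonneg_right (by linarith [hhi x hx]) (e0 x)
  · rw [him, ← intervalIntegral.integral_const_mul]
    congr 1; ext x; ring
  · intro B hB
    rw [hre, ← intervalIntegral.integral_const_mul]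
    apply int_mono F.pos.le (by fun_prop) (by fun_prop)
    intro x hx
    refine mul_le_mul_of_nonneg_right ?_ (e0 x)
    have := sq_le_sq' (abs_le.mp (hB x hx)).1 (abs_le.mp (hB x hx)).2
    linarith
end


theorem clog_bound (R : ℝ) (hR : 0 ≤ R) : ∃ K > 0, ∀ z : ℂ, z ≠ 0 → ‖z‖ ≤ R →
    ‖Complex.log z‖ * √(√‖z‖) ≤ K := by
  refine ⟨4 * (√R + 1) + 4 * √(√R), by positivity, fun z hz hzR => ?_⟩
  have hr : 0 < ‖z‖ := norm_pos_iff.mpr hz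
  set t := √(√‖z‖) with ht
  have t0 : 0 < t := by positivity
  have ht2 : t ^ 2 = √‖z‖ := by rw [ht, Real.sq_sqrt (by positivity)]
  have ht4 : ‖z‖ = t ^ 4 := by
    have : t ^ 4 = (t ^ 2) ^ 2 := by ring
    rw [this, ht2, Real.sq_sqrt hr.le]
  have h1 : ‖Complex.log z‖ ≤ |Real.log ‖z‖| + Real.pi := by
    refine (Complex.norm_le_abs_re_add_abs_im _).trans ?_
    rw [Complex.log_re, Complex.log_im]
    linarith [Complex.abs_arg_le_pi z]
  have h2 : |Real.log t| ≤ t + 1 / t := by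
    have a := Real.log_le_sub_one_of_pos t0
    have b := Real.log_le_sub_one_of_pos (inv_pos.mpr t0)
    rw [Real.log_inv] at b
    have : 0 < t⁻¹ := inv_pos.mpr t0
    rw [one_div, abs_le]; constructor <;> linarith
  have h3 : |Real.log ‖z‖| = 4 * |Real.log t| := by
    rw [ht4, Real.log_pow, abs_mul]; norm_num
  have h4 : t ≤ √(√R) := Real.sqrt_le_sqrt (Real.sqrt_le_sqrt hzR)
  have h5 : t ^ 2 ≤ √R := by rw [ht2]; exact Real.sqrt_le_sqrt hzR
  have h6 : ‖Complex.log z‖ ≤ 4 * (t + 1 / t) + Real.pi := by linarith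
  calc _ ≤ (4 * (t + 1 / t) + Real.pi) * t := mul_le_mul_of_nonneg_right h6 t0.le
    _ = 4 * (t ^ 2 + 1) + Real.pi * t := by field_simp
    _ ≤ _ := by
      have := Real.pi_le_four
      nlinarith

section
variable {h k : ℝ} {U U' U'' U''' : ℝ → ℝ}

theorem ShearFlow.sign (F : ShearFlow h U U' U'' U''') : ∃ τ m : ℝ, |τ| = 1 ∧ 0 < m ∧
    ∀ x ∈ Icc 0 h, m ≤ τ * U' x := by
  have cU' := F.cU'
  have main : ∀ τ : ℝ, |τ| = 1 → 0 < τ * U' 0 → ∃ m : ℝ, 0 < m ∧ ∀ x ∈ Icc 0 h, m ≤ τ * U' x := by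
    intro τ hτ h0
    have cc : ContinuousOn (fun x => τ * U' x) (Icc 0 h) := by fun_prop
    have pos : ∀ x ∈ Icc 0 h, 0 < τ * U' x := by
      intro x hx
      by_contra hneg
      push Not at hneg
      have := intermediate_value_Icc' hx.1 (cc.mono (Icc_subset_Icc_right hx.2)) ⟨hneg, h0.le⟩
      obtain ⟨y, hy, e⟩ := this
      have hy' := F.ne y ⟨hy.1, hy.2.trans hx.2⟩
      have : τ ≠ 0 := by intro h; simp [h] at hτ
      exact (mul_ne_zero this hy') e
    obtain ⟨x₀, hx₀, hm⟩ := isCompact_Icc.exists_isMinOn ⟨0, F.mem0⟩ cc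
    exact ⟨τ * U' x₀, pos x₀ hx₀, fun x hx => hm hx⟩
  rcases lt_or_gt_of_ne (F.ne 0 F.mem0) with hlt | hgt
  · obtain ⟨m, h1, h2⟩ := main (-1) (by simp) (by linarith)
    exact ⟨-1, m, by simp, h1, h2⟩
  · obtain ⟨m, h1, h2⟩ := main 1 (by simp) (by linarith)
    exact ⟨1, m, by simp, h1, h2⟩

theorem norm_sub_eq (u : ℝ) (c : ℂ) : ‖(u : ℂ) - c‖ = √((u - c.re) ^ 2 + c.im ^ 2) := by
  rw [Complex.norm_def, Complex.normSq_apply]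
  simp [pow_two]

theorem int_inv_sqrt (F : ShearFlow h U U' U'' U''') (R : ℝ) : ∃ K > 0, ∀ c : ℂ, c.im ≠ 0 →
    (∀ x ∈ Icc 0 h, ‖(U x : ℂ) - c‖ ≤ R) → ∫ x in (0:ℝ)..h, 1 / √‖(U x : ℂ) - c‖ ≤ K := by
  obtain ⟨τ, m, hτ, hm, hU⟩ := F.sign
  refine ⟨2 / m * (2 * √R) + 1, by positivity, fun c hc hR => ?_⟩
  have cU := F.cU
  have cU' := F.cU'
  set N : ℝ → ℝ := fun x => (U x - c.re) ^ 2 + c.im ^ 2 with hN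
  have N0 : ∀ x, 0 < N x := fun x => by
    have : 0 < c.im ^ 2 := by positivity
    simp only [hN]; positivity
  set r : ℝ → ℝ := fun x => √(N x) with hrdef
  have r0 : ∀ x, 0 < r x := fun x => Real.sqrt_pos.mpr (N0 x)
  have hr : ∀ x, ‖(U x : ℂ) - c‖ = r x := fun x => norm_sub_eq _ _
  have r2 : ∀ x, r x ^ 2 = N x := fun x => Real.sq_sqrt (N0 x).le
  set t : ℝ → ℝ := fun x => √(r x) with htdef
  have t0 : ∀ x, 0 < t x := fun x => Real.sqrt_pos.mpr (r0 x)
  have t2 : ∀ x, t x ^ 2 = r x := fun x => Real.sq_sqrt (r0 x).le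
  have ct : ContinuousOn t (Icc 0 h) := by fun_prop
  have cr : ContinuousOn r (Icc 0 h) := by fun_prop
  simp only [hr]
  have key := ftc_icc F.pos.le (f := fun x => τ * ((U x - c.re) / t x))
    (f' := fun x => τ * U' x * (1 - (U x - c.re) ^ 2 / (2 * r x ^ 2)) / t x)
    (fun x hx => by
      have dN : HasDerivAt N (2 * (U x - c.re) * U' x) x := by
        refine ((((F.d1 x hx).sub_const c.re).pow 2).add_const (c.im ^ 2)).congr_deriv ?_
        simp
      have dr := dN.sqrt (N0 x).ne'
      have dt := HasDerivAt.sqrt dr (r0 x).ne'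
      have d := (((F.d1 x hx).sub_const c.re).div dt (t0 x).ne').const_mul τ
      refine d.congr_deriv ?_
      change τ * ((U' x * t x - (U x - c.re) * (2 * (U x - c.re) * U' x / (2 * r x) / (2 * t x)))
        / t x ^ 2) = _
      have := (r0 x).ne'
      have := (t0 x).ne'
      have e := t2 x
      have : r x = t x ^ 2 := e.symm
      rw [this]
      field_simp)
    (by
      apply ContinuousOn.div _ ct (fun x _ => (t0 x).ne')
      apply ContinuousOn.mul (by fun_prop)
      apply ContinuousOn.sub (by fun_prop)
      apply ContinuousOn.div (by fun_prop) (by fun_prop)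
      intro x _
      have := r0 x
      positivity)
  have mono := int_mono F.pos.le (f := fun x => 1 / √(r x))
    (g := fun x => 2 / m * (τ * U' x * (1 - (U x - c.re) ^ 2 / (2 * r x ^ 2)) / t x))
    (ContinuousOn.div (by fun_prop) ct (fun x _ => (t0 x).ne'))
    (by
      apply ContinuousOn.mul (by fun_prop)
      apply ContinuousOn.div _ ct (fun x _ => (t0 x).ne')
      apply ContinuousOn.mul (by fun_prop)
      apply ContinuousOn.sub (by fun_prop)
      apply ContinuousOn.div (by fun_prop) (by fun_prop)
      intro x _
      have := r0 x
      positivity)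
    (fun x hx => by
      change 1 / t x ≤ _
      have a1 : (U x - c.re) ^ 2 / (2 * r x ^ 2) ≤ 1 / 2 := by
        rw [div_le_iff₀ (by have := r0 x; positivity), r2]
        simp only [hN]; nlinarith [sq_nonneg c.im]
      have a2 := hU x hx
      have a3 : m * (1 / 2) ≤ τ * U' x * (1 - (U x - c.re) ^ 2 / (2 * r x ^ 2)) :=
        mul_le_mul a2 (by linarith) (by norm_num) (by linarith)
      rw [← mul_div_assoc]
      apply div_le_div_of_nonneg_right _ (t0 x).le
      calc (1:ℝ) = 2 / m * (m * (1 / 2)) := by field_simp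
        _ ≤ _ := mul_le_mul_of_nonneg_left a3 (by positivity))
  refine mono.trans ?_
  rw [intervalIntegral.integral_const_mul, key]
  have bd : ∀ x ∈ Icc 0 h, |τ * ((U x - c.re) / t x)| ≤ √R := by
    intro x hx
    rw [abs_mul, hτ, one_mul, abs_div, abs_of_pos (t0 x), div_le_iff₀ (t0 x)]
    have a1 : |U x - c.re| ≤ r x := Real.abs_le_sqrt (by simp only [hN]; nlinarith [sq_nonneg c.im])
    have a2 : t x ≤ √R := Real.sqrt_le_sqrt (by rw [← hr]; exact hR x hx)
    have := t2 x
    have := t0 x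
    nlinarith
  have b1 := (abs_le.mp (bd h F.memh)).2
  have b2 := (abs_le.mp (bd 0 F.mem0)).1
  have : 2 / m * (τ * ((U h - c.re) / t h) - τ * ((U 0 - c.re) / t 0)) ≤ 2 / m * (2 * √R) :=
    mul_le_mul_of_nonneg_left (by linarith) (by positivity)
  linarith

theorem sub_ne_of_im {c : ℂ} (hc : c.im ≠ 0) (u : ℝ) : (u : ℂ) - c ≠ 0 := by
  intro h0
  apply hc
  have := congrArg Complex.im h0
  simpa using this

theorem sub_slit_of_im {c : ℂ} (hc : c.im ≠ 0) (u : ℝ) : (u : ℂ) - c ∈ Complex.slitPlane := by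
  rw [Complex.mem_slitPlane_iff]; right
  simpa using hc

theorem log_L2 (F : ShearFlow h U U' U'' U''') (R : ℝ) (hR0 : 0 ≤ R) : ∃ K > 0, ∀ c : ℂ,
    c.im ≠ 0 → (∀ x ∈ Icc 0 h, ‖(U x : ℂ) - c‖ ≤ R) →
    ContinuousOn (fun x => Complex.log ((U x : ℂ) - c)) (Icc 0 h) ∧
    ∫ x in (0:ℝ)..h, ‖Complex.log ((U x : ℂ) - c)‖ ^ 2 ≤ K ∧
    ‖Complex.log ((U 0 : ℂ) - c)‖ * ‖(U 0 : ℂ) - c‖ ^ 2 ≤ K := by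
  obtain ⟨K₁, hK₁, H₁⟩ := clog_bound R hR0
  obtain ⟨K₂, hK₂, H₂⟩ := int_inv_sqrt F R
  refine ⟨K₁ ^ 2 * K₂ + K₁ * (√(√R)) ^ 7, by positivity, fun c hc hR => ?_⟩
  have cU : ContinuousOn (fun x => (U x : ℂ) - c) (Icc 0 h) :=
    (Complex.continuous_ofReal.comp_continuousOn F.cU).sub continuousOn_const
  have cL : ContinuousOn (fun x => Complex.log ((U x : ℂ) - c)) (Icc 0 h) :=
    cU.clog (fun x _ => sub_slit_of_im hc _)
  have np : ∀ x, 0 < ‖(U x : ℂ) - c‖ := fun x => norm_pos_iff.mpr (sub_ne_of_im hc _)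
  refine ⟨cL, ?_, ?_⟩
  · have h1 : ∫ x in (0:ℝ)..h, ‖Complex.log ((U x : ℂ) - c)‖ ^ 2 ≤
        ∫ x in (0:ℝ)..h, K₁ ^ 2 * (1 / √‖(U x : ℂ) - c‖) := by
      apply int_mono F.pos.le (by fun_prop)
      · apply ContinuousOn.mul (by fun_prop)
        apply ContinuousOn.div (by fun_prop) (by fun_prop)
        intro x _
        exact (Real.sqrt_pos.mpr (np x)).ne'
      · intro x hx
        have a := H₁ _ (sub_ne_of_im hc (U x)) (hR x hx)
        have n := Real.sqrt_pos.mpr (np x)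
        rw [mul_one_div, le_div_iff₀ n]
        have : √‖(U x : ℂ) - c‖ = √(√‖(U x : ℂ) - c‖) ^ 2 := by rw [Real.sq_sqrt n.le]
        rw [this, ← mul_pow]
        exact pow_le_pow_left₀ (by positivity) a 2
    rw [intervalIntegral.integral_const_mul] at h1
    have := mul_le_mul_of_nonneg_left (H₂ c hc hR) (sq_nonneg K₁)
    have : 0 ≤ K₁ * (√(√R)) ^ 7 := by positivity
    linarith
  · have a := H₁ _ (sub_ne_of_im hc (U 0)) (hR 0 F.mem0)
    set n := ‖(U 0 : ℂ) - c‖ with hn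
    set t := √(√n) with ht
    have n0 : 0 < n := np 0
    have e : n = t ^ 4 := by
      have : t ^ 4 = (t ^ 2) ^ 2 := by ring
      rw [this, ht, Real.sq_sqrt (by positivity), Real.sq_sqrt n0.le]
    have ht' : t ≤ √(√R) := Real.sqrt_le_sqrt (Real.sqrt_le_sqrt (hR 0 F.mem0))
    have t0 : 0 ≤ t := Real.sqrt_nonneg _
    have b : t ^ 7 ≤ (√(√R)) ^ 7 := pow_le_pow_left₀ t0 ht' 7
    calc _ = (‖Complex.log ((U 0 : ℂ) - c)‖ * t) * t ^ 7 := by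
            have : n ^ 2 = t * t ^ 7 := by rw [e]; ring
            rw [this]; ring
      _ ≤ K₁ * (√(√R)) ^ 7 := mul_le_mul a b (by positivity) hK₁.le
      _ ≤ _ := by have : 0 ≤ K₁ ^ 2 * K₂ := by positivity
                  linarith
end


section
variable {h k : ℝ} {U U' U'' U''' : ℝ → ℝ}

theorem sup_bound (hh : 0 ≤ h) (hk : 0 < k) {v v' : ℝ → ℂ}
    (hv : ∀ x ∈ Icc (0:ℝ) h, HasDerivAt v (v' x) x) (cv' : ContinuousOn v' (Icc 0 h))
    (vh : v h = 0) {y : ℝ} (hy : y ∈ Icc 0 h) :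
    ‖v y‖ ^ 2 ≤ (∫ x in (0:ℝ)..h, (‖v' x‖ ^ 2 + k ^ 2 * ‖v x‖ ^ 2)) / k := by
  have cv := cont_of_deriv hv
  have ce : ContinuousOn (fun x => ‖v' x‖ ^ 2 + k ^ 2 * ‖v x‖ ^ 2) (Icc 0 h) := by fun_prop
  have sub : Icc y h ⊆ Icc 0 h := Icc_subset_Icc_left hy.1
  have key : ∫ x in y..h, -(1 / k) * (‖v' x‖ ^ 2 + k ^ 2 * ‖v x‖ ^ 2) ≤
      ∫ x in y..h, 2 * inner ℝ (v x) (v' x) := by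
    apply integral_mono_on hy.2
    · apply ContinuousOn.intervalIntegrable; rw [uIcc_of_le hy.2]
      exact (continuousOn_const.mul ce).mono sub
    · apply ContinuousOn.intervalIntegrable; rw [uIcc_of_le hy.2]
      exact (continuousOn_const.mul (ContinuousOn.inner (𝕜 := ℝ) cv cv')).mono sub
    · intro x _
      have a1 := (abs_le.mp (abs_real_inner_le_norm (v x) (v' x))).1
      have a2 : 0 ≤ 1 / k * (‖v' x‖ - k * ‖v x‖) ^ 2 := by positivity
      have a3 : 1 / k * (‖v' x‖ - k * ‖v x‖) ^ 2 =
        1 / k * (‖v' x‖ ^ 2 + k ^ 2 * ‖v x‖ ^ 2) - 2 * (‖v x‖ * ‖v' x‖) := by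
        field_simp
        ring
      linarith
  have ftc : ∫ x in y..h, 2 * inner ℝ (v x) (v' x) = ‖v h‖ ^ 2 - ‖v y‖ ^ 2 := by
    apply integral_eq_sub_of_hasDerivAt
    · intro x hx; rw [uIcc_of_le hy.2] at hx
      exact (hv x (sub hx)).norm_sq
    · apply ContinuousOn.intervalIntegrable; rw [uIcc_of_le hy.2]
      exact (continuousOn_const.mul (ContinuousOn.inner (𝕜 := ℝ) cv cv')).mono sub
  have split : ∫ x in y..h, (‖v' x‖ ^ 2 + k ^ 2 * ‖v x‖ ^ 2) ≤
      ∫ x in (0:ℝ)..h, (‖v' x‖ ^ 2 + k ^ 2 * ‖v x‖ ^ 2) := by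
    apply integral_mono_interval hy.1 hy.2 le_rfl
    · exact Filter.Eventually.of_forall (fun x => by simp only [Pi.zero_apply]; positivity)
    · apply ContinuousOn.intervalIntegrable; rwa [uIcc_of_le hh]
  rw [ftc, vh, intervalIntegral.integral_const_mul] at key
  have := mul_le_mul_of_nonneg_left split (by positivity : 0 ≤ 1 / k)
  rw [div_eq_inv_mul, ← one_div]
  simp only [norm_zero] at key
  nlinarith

/-- Integrated identity with the logarithm. -/
theorem log_ident (hh : 0 < h) {c : ℂ} (hc : c.im ≠ 0) {L : ℝ → ℂ}
    (dL : ∀ x ∈ Icc (0:ℝ) h, HasDerivAt L ((U' x : ℂ) / ((U x : ℂ) - c)) x)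
    {v v' v'' : ℝ → ℂ} (hv : ∀ x ∈ Icc (0:ℝ) h, HasDerivAt v (v' x) x ∧ HasDerivAt v' (v'' x) x ∧
      -v'' x + ((k : ℂ) ^ 2 + (U'' x : ℂ) / ((U x : ℂ) - c)) * v x = 0)
    {q q' : ℝ → ℝ} (hq : ∀ x ∈ Icc (0:ℝ) h, HasDerivAt q (q' x) x) (cq' : ContinuousOn q' (Icc 0 h))
    (hqU : ∀ x ∈ Icc (0:ℝ) h, U'' x = q x * U' x)
    {g g' : ℝ → ℂ} (hg : ∀ x ∈ Icc (0:ℝ) h, HasDerivAt g (g' x) x)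
    (cg' : ContinuousOn g' (Icc 0 h)) (gh : g h = 0)
    (cL : ContinuousOn L (Icc 0 h)) :
    -(v' 0 * g 0) + q 0 * L 0 * v 0 * g 0 =
    ∫ x in (0:ℝ)..h, ((k : ℂ) ^ 2 * (v x * g x) + v' x * g' x - L x *
      (q' x * (v x * g x) + q x * (v' x * g x + v x * g' x))) := by
  have cv := cont_of_deriv (fun x hx => (hv x hx).1)
  have cv' := cont_of_deriv (fun x hx => (hv x hx).2.1)
  have cg := cont_of_deriv hg
  have cq : ContinuousOn (fun x => (q x : ℂ)) (Icc 0 h) :=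
    Complex.continuous_ofReal.comp_continuousOn (cont_of_deriv hq)
  have cqq : ContinuousOn (fun x => (q' x : ℂ)) (Icc 0 h) :=
    Complex.continuous_ofReal.comp_continuousOn cq'
  rw [ftc_icc hh.le (f := fun x => v' x * g x -
    (q x : ℂ) * L x * (v x * g x)) _ (by fun_prop)]
  · simp only [gh]; ring
  · intro x hx
    have n := sub_ne_of_im hc (U x)
    have d := ((hv x hx).2.1.mul (hg x hx)).sub
      (((hq x hx).ofReal_comp.mul (dL x hx)).mul ((hv x hx).1.mul (hg x hx)))
    refine d.congr_deriv ?_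
    have e : v'' x = ((k : ℂ) ^ 2 + (q x * U' x : ℂ) / ((U x : ℂ) - c)) * v x := by
      have := (hv x hx).2.2
      rw [hqU x hx] at this
      push_cast at this
      linear_combination -this
    rw [e]
    simp only [Pi.mul_apply]
    field_simp
    ring

theorem ShearFlow.q_exists (F : ShearFlow h U U' U'' U''') : ∃ q q' : ℝ → ℝ, ∃ Q > 0,
    (∀ x ∈ Icc (0:ℝ) h, HasDerivAt q (q' x) x) ∧ ContinuousOn q' (Icc 0 h) ∧
    (∀ x ∈ Icc (0:ℝ) h, U'' x = q x * U' x) ∧ (∀ x ∈ Icc (0:ℝ) h, |q x| ≤ Q) ∧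
    (∀ x ∈ Icc (0:ℝ) h, |q' x| ≤ Q) := by
  have hq : ∀ x ∈ Icc (0:ℝ) h, HasDerivAt (fun x => U'' x / U' x)
      ((U''' x * U' x - U'' x * U'' x) / U' x ^ 2) x := fun x hx =>
    (F.d3 x hx).div (F.d2 x hx) (F.ne x hx)
  have cq' : ContinuousOn (fun x => (U''' x * U' x - U'' x * U'' x) / U' x ^ 2) (Icc 0 h) := by
    have := F.cU'
    have := F.cU''
    have := F.c3
    apply ContinuousOn.div (by fun_prop) (by fun_prop)
    intro x hx; exact pow_ne_zero _ (F.ne x hx)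
  obtain ⟨Q₁, h₁⟩ := isCompact_Icc.exists_bound_of_continuousOn (cont_of_deriv hq)
  obtain ⟨Q₂, h₂⟩ := isCompact_Icc.exists_bound_of_continuousOn cq'
  refine ⟨_, _, max 1 (max Q₁ Q₂), by positivity, hq, cq', fun x hx => ?_, fun x hx => ?_,
    fun x hx => ?_⟩
  · have := F.ne x hx
    field_simp
  · exact (h₁ x hx).trans ((le_max_left _ _).trans (le_max_right _ _))
  · exact (h₂ x hx).trans ((le_max_right _ _).trans (le_max_right _ _))

theorem young1 {k Q L V V' : ℝ} (hk : 1 ≤ k) :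
    Q * L * (V * V + 2 * (V * V')) ≤ 1 / 8 * (V' ^ 2 + k ^ 2 * V ^ 2) + 10 * Q ^ 2 * (L ^ 2 * V ^ 2) := by
  have : V ^ 2 ≤ k ^ 2 * V ^ 2 := le_mul_of_one_le_left (sq_nonneg V) (one_le_pow₀ hk)
  nlinarith [sq_nonneg (V' - 8 * (Q * L * V)), sq_nonneg (V - 4 * (Q * L * V))]

theorem young2 {k Q L V V' G G' : ℝ} (hk : 1 ≤ k) :
    k ^ 2 * (V * G) + V' * G' + Q * L * (V * G + (V' * G + V * G')) ≤
    1 / 4 * (V' ^ 2 + k ^ 2 * V ^ 2) + Q ^ 2 * (L ^ 2 * V ^ 2) + 2 * Q ^ 2 * (L ^ 2 * G ^ 2)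
      + 5 / 2 * (G' ^ 2 + k ^ 2 * G ^ 2) := by
  have a : G ^ 2 ≤ k ^ 2 * G ^ 2 := le_mul_of_one_le_left (sq_nonneg G) (one_le_pow₀ hk)
  have b : 0 ≤ k ^ 2 * V ^ 2 := by positivity
  nlinarith [sq_nonneg (k * V - 4 * (k * G)), sq_nonneg (V' - 4 * G'),
    sq_nonneg (V' - 4 * (Q * L * G)), sq_nonneg (Q * L * V - G'), sq_nonneg (Q * L * V - G)]

theorem step_one (hh : 0 < h) (hk1 : 1 ≤ k)
    {c : ℂ} (hc : c.im ≠ 0) {L : ℝ → ℂ}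
    (dL : ∀ x ∈ Icc (0:ℝ) h, HasDerivAt L ((U' x : ℂ) / ((U x : ℂ) - c)) x)
    (cL : ContinuousOn L (Icc 0 h))
    {v v' v'' : ℝ → ℂ} (hv : ∀ x ∈ Icc (0:ℝ) h, HasDerivAt v (v' x) x ∧ HasDerivAt v' (v'' x) x ∧
      -v'' x + ((k : ℂ) ^ 2 + (U'' x : ℂ) / ((U x : ℂ) - c)) * v x = 0) (vh : v h = 0)
    {q q' : ℝ → ℝ} {Q : ℝ} (hQ : 0 < Q)
    (hq : ∀ x ∈ Icc (0:ℝ) h, HasDerivAt q (q' x) x) (cq' : ContinuousOn q' (Icc 0 h))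
    (hqU : ∀ x ∈ Icc (0:ℝ) h, U'' x = q x * U' x) (bq : ∀ x ∈ Icc (0:ℝ) h, |q x| ≤ Q)
    (bq' : ∀ x ∈ Icc (0:ℝ) h, |q' x| ≤ Q) {ζ : ℂ} (v0 : v 0 = ζ) :
    (∫ x in (0:ℝ)..h, (‖v' x‖ ^ 2 + k ^ 2 * ‖v x‖ ^ 2)) ≤ ‖-(v' 0 * star ζ) + q 0 * L 0 * v 0 * star ζ‖ +
      1 / 8 * (∫ x in (0:ℝ)..h, (‖v' x‖ ^ 2 + k ^ 2 * ‖v x‖ ^ 2)) + 10 * Q ^ 2 * (∫ x in (0:ℝ)..h, ‖L x‖ ^ 2 * ‖v x‖ ^ 2) := by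
  have dv := fun x hx => (hv x hx).1
  have cv := cont_of_deriv (fun x hx => (hv x hx).1)
  have cv' := cont_of_deriv (fun x hx => (hv x hx).2.1)
  have cqc : ContinuousOn (fun x => (q x : ℂ)) (Icc 0 h) :=
    Complex.continuous_ofReal.comp_continuousOn (cont_of_deriv hq)
  have cqq : ContinuousOn (fun x => (q' x : ℂ)) (Icc 0 h) :=
    Complex.continuous_ofReal.comp_continuousOn cq'
  have ii : ∀ {f : ℝ → ℝ}, ContinuousOn f (Icc 0 h) → IntervalIntegrable f volume 0 h := by
    intro f hf
    apply ContinuousOn.intervalIntegrable; rwa [uIcc_of_le hh.le]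
  have hk0 : 0 < k := by linarith
  obtain ⟨X, hX⟩ : ∃ X, X = -(v' 0 * star ζ) + q 0 * L 0 * v 0 * star ζ := ⟨_, rfl⟩
  rw [← hX]
  obtain ⟨E, hE⟩ : ∃ E, E = ∫ x in (0:ℝ)..h, (‖v' x‖ ^ 2 + k ^ 2 * ‖v x‖ ^ 2) := ⟨_, rfl⟩
  rw [← hE]
  have E0 : 0 ≤ E := by rw [hE]; exact integral_nonneg hh.le (fun x _ => by positivity)
  have id1 := log_ident hh hc dL hv hq cq' hqU (g := fun x => star (v x)) (g' := fun x => star (v' x))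
    (fun x hx => (dv x hx).star) (by fun_prop) (by simp [vh]) cL
  have v0s : star (v 0) = star ζ := by rw [v0]
  simp only [v0s] at id1
  have hEc : (E : ℂ) = ∫ x in (0:ℝ)..h, ((‖v' x‖ ^ 2 + k ^ 2 * ‖v x‖ ^ 2 : ℝ) : ℂ) := by
    rw [hE, intervalIntegral.integral_ofReal]
  have cec : ContinuousOn (fun x => ((‖v' x‖ ^ 2 + k ^ 2 * ‖v x‖ ^ 2 : ℝ) : ℂ)) (Icc 0 h) :=
    Complex.continuous_ofReal.comp_continuousOn (by fun_prop)
  have diff : (E : ℂ) - X = ∫ x in (0:ℝ)..h, L x * (q' x * (v x * star (v x)) +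
      q x * (v' x * star (v x) + v x * star (v' x))) := by
    rw [hX, id1, hEc, ← intervalIntegral.integral_sub]
    · congr 1; ext x
      have b1 : (‖v' x‖ : ℂ) ^ 2 = v' x * star (v' x) := (Complex.mul_conj' _).symm
      have b2 : (‖v x‖ : ℂ) ^ 2 = v x * star (v x) := (Complex.mul_conj' _).symm
      push_cast
      rw [b1, b2]; ring
    · apply ContinuousOn.intervalIntegrable; rw [uIcc_of_le hh.le]; exact cec
    · apply ContinuousOn.intervalIntegrable; rw [uIcc_of_le hh.le]; fun_prop
  have nb : ‖(E : ℂ) - X‖ ≤ ∫ x in (0:ℝ)..h, (1 / 8 * (‖v' x‖ ^ 2 + k ^ 2 * ‖v x‖ ^ 2) +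
      10 * Q ^ 2 * (‖L x‖ ^ 2 * ‖v x‖ ^ 2)) := by
    rw [diff]
    refine (intervalIntegral.norm_integral_le_integral_norm hh.le).trans ?_
    apply int_mono hh.le (by fun_prop) (by fun_prop)
    intro x hx
    refine le_trans ?_ (young1 (Q := Q) (L := ‖L x‖) (V := ‖v x‖) (V' := ‖v' x‖) hk1)
    rw [norm_mul]
    have a1 : ‖(q' x : ℂ) * (v x * star (v x)) + q x * (v' x * star (v x) + v x * star (v' x))‖ ≤
      Q * (‖v x‖ * ‖v x‖ + 2 * (‖v x‖ * ‖v' x‖)) := by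
      refine (norm_add_le _ _).trans ?_
      rw [norm_mul, norm_mul, norm_mul, Complex.norm_real, Complex.norm_real, norm_star]
      have e1 := norm_add_le (v' x * star (v x)) (v x * star (v' x))
      rw [norm_mul, norm_mul, norm_star, norm_star] at e1
      have e2 : ‖v' x * star (v x) + v x * star (v' x)‖ ≤ 2 * (‖v x‖ * ‖v' x‖) := by linarith
      have e3 : ‖q' x‖ * (‖v x‖ * ‖v x‖) ≤ Q * (‖v x‖ * ‖v x‖) :=
        mul_le_mul_of_nonneg_right (bq' x hx) (by positivity)
      have e4 := mul_le_mul (bq x hx) e2 (norm_nonneg _) hQ.le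
      rw [← Real.norm_eq_abs] at e4
      linarith
    have := mul_le_mul_of_nonneg_left a1 (norm_nonneg (L x))
    linarith
  rw [intervalIntegral.integral_add (ii (by fun_prop)) (ii (by fun_prop)),
    intervalIntegral.integral_const_mul, intervalIntegral.integral_const_mul, ← hE] at nb
  have : ‖(E : ℂ)‖ ≤ ‖(E : ℂ) - X‖ + ‖X‖ := by
    simpa using norm_add_le ((E : ℂ) - X) X
  rw [Complex.norm_real, Real.norm_of_nonneg E0] at this
  linarith

theorem step_two (hh : 0 < h) (hk1 : 1 ≤ k)
    {c : ℂ} (hc : c.im ≠ 0) {L : ℝ → ℂ}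
    (dL : ∀ x ∈ Icc (0:ℝ) h, HasDerivAt L ((U' x : ℂ) / ((U x : ℂ) - c)) x)
    (cL : ContinuousOn L (Icc 0 h))
    {v v' v'' : ℝ → ℂ} (hv : ∀ x ∈ Icc (0:ℝ) h, HasDerivAt v (v' x) x ∧ HasDerivAt v' (v'' x) x ∧
      -v'' x + ((k : ℂ) ^ 2 + (U'' x : ℂ) / ((U x : ℂ) - c)) * v x = 0) (vh : v h = 0)
    {q q' : ℝ → ℝ} {Q : ℝ} (hQ : 0 < Q)
    (hq : ∀ x ∈ Icc (0:ℝ) h, HasDerivAt q (q' x) x) (cq' : ContinuousOn q' (Icc 0 h))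
    (hqU : ∀ x ∈ Icc (0:ℝ) h, U'' x = q x * U' x) (bq : ∀ x ∈ Icc (0:ℝ) h, |q x| ≤ Q)
    (bq' : ∀ x ∈ Icc (0:ℝ) h, |q' x| ≤ Q) {ζ : ℂ} (v0 : v 0 = ζ)
    (hkh : 1 / h ≤ k) {Z : ℝ} (ζZ : ‖ζ‖ ≤ Z) (Z0 : 0 ≤ Z) :
    ‖-(v' 0 * star ζ) + q 0 * L 0 * v 0 * star ζ‖ ≤
      1 / 4 * (∫ x in (0:ℝ)..h, (‖v' x‖ ^ 2 + k ^ 2 * ‖v x‖ ^ 2)) + Q ^ 2 * (∫ x in (0:ℝ)..h, ‖L x‖ ^ 2 * ‖v x‖ ^ 2) + 2 * Q ^ 2 * Z ^ 2 * (∫ x in (0:ℝ)..h, ‖L x‖ ^ 2)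
      + 25 / 4 * Z ^ 2 * k := by
  have i0 : 0 < 1 / h := by positivity
  have dv := fun x hx => (hv x hx).1
  have cv := cont_of_deriv (fun x hx => (hv x hx).1)
  have cv' := cont_of_deriv (fun x hx => (hv x hx).2.1)
  have cqc : ContinuousOn (fun x => (q x : ℂ)) (Icc 0 h) :=
    Complex.continuous_ofReal.comp_continuousOn (cont_of_deriv hq)
  have cqq : ContinuousOn (fun x => (q' x : ℂ)) (Icc 0 h) :=
    Complex.continuous_ofReal.comp_continuousOn cq'
  have ii : ∀ {f : ℝ → ℝ}, ContinuousOn f (Icc 0 h) → IntervalIntegrable f volume 0 h := by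
    intro f hf
    apply ContinuousOn.intervalIntegrable; rwa [uIcc_of_le hh.le]
  have hk0 : 0 < k := by linarith
  obtain ⟨X, hX⟩ : ∃ X, X = -(v' 0 * star ζ) + q 0 * L 0 * v 0 * star ζ := ⟨_, rfl⟩
  rw [← hX]
  obtain ⟨E, hE⟩ : ∃ E, E = ∫ x in (0:ℝ)..h, (‖v' x‖ ^ 2 + k ^ 2 * ‖v x‖ ^ 2) := ⟨_, rfl⟩
  rw [← hE]
  obtain ⟨χ, hχ⟩ : ∃ χ : ℝ → ℝ, χ = fun x => (1 - x / h) * Real.exp (-k * x) := ⟨_, rfl⟩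
  obtain ⟨χ', hχ'⟩ : ∃ χ' : ℝ → ℝ, χ' = fun x => (-(1 / h) - k * (1 - x / h)) * Real.exp (-k * x) :=
    ⟨_, rfl⟩
  have cχ : Continuous χ := by
    rw [hχ]; simp only [div_eq_mul_inv]; fun_prop
  have cχ' : Continuous χ' := by
    rw [hχ']; simp only [div_eq_mul_inv]; fun_prop
  have cχc : Continuous (fun x => (χ x : ℂ)) := Complex.continuous_ofReal.comp cχ
  have cχc' : Continuous (fun x => (χ' x : ℂ)) := Complex.continuous_ofReal.comp cχ'
  have dχ : ∀ x, HasDerivAt χ (χ' x) x := by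
    intro x; rw [hχ, hχ']; exact test_deriv h k x
  have id2 := log_ident hh hc dL hv hq cq' hqU (g := fun x => star ζ * (χ x : ℂ))
    (g' := fun x => star ζ * (χ' x : ℂ))
    (fun x hx => (dχ x).ofReal_comp.const_mul _)
    (by fun_prop) (by simp [hχ, hh.ne']) cL
  have χ0 : χ 0 = 1 := by simp [hχ]
  simp only [χ0, Complex.ofReal_one, mul_one] at id2
  have nb : ‖X‖ ≤ ∫ x in (0:ℝ)..h, (1 / 4 * (‖v' x‖ ^ 2 + k ^ 2 * ‖v x‖ ^ 2) +
      Q ^ 2 * (‖L x‖ ^ 2 * ‖v x‖ ^ 2) + 2 * Q ^ 2 * Z ^ 2 * (‖L x‖ ^ 2) +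
      5 / 2 * (Z ^ 2 * (5 * k ^ 2)) * Real.exp (-(2 * k) * x)) := by
    rw [hX, id2]
    refine (intervalIntegral.norm_integral_le_integral_norm hh.le).trans ?_
    apply int_mono hh.le (by fun_prop) (by fun_prop)
    intro x hx
    have y2 := young2 (Q := Q) (L := ‖L x‖) (V := ‖v x‖) (V' := ‖v' x‖)
      (G := ‖star ζ * (χ x : ℂ)‖) (G' := ‖star ζ * (χ' x : ℂ)‖) hk1
    have t1 : 0 ≤ 1 - x / h := by
      rw [sub_nonneg, div_le_one hh]; exact hx.2
    have t2 : 1 - x / h ≤ 1 := by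
      have : 0 ≤ x / h := div_nonneg hx.1 hh.le
      linarith
    have cz : |χ x| ≤ 1 := by
      simp only [hχ, abs_mul, abs_of_nonneg t1, Real.abs_exp]
      have : Real.exp (-k * x) ≤ 1 := Real.exp_le_one_iff.mpr (by nlinarith [hx.1])
      nlinarith [Real.exp_pos (-k * x)]
    have g1 : ‖star ζ * (χ x : ℂ)‖ ≤ Z := by
      rw [norm_mul, norm_star, Complex.norm_real, Real.norm_eq_abs]
      calc _ ≤ Z * 1 := mul_le_mul ζZ cz (abs_nonneg _) Z0
        _ = Z := mul_one Z
    have g2 : ‖star ζ * (χ' x : ℂ)‖ ^ 2 + k ^ 2 * ‖star ζ * (χ x : ℂ)‖ ^ 2 ≤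
        Z ^ 2 * (5 * k ^ 2) * Real.exp (-(2 * k) * x) := by
      rw [norm_mul, norm_mul, norm_star, Complex.norm_real, Complex.norm_real, mul_pow, mul_pow,
        Real.norm_eq_abs, Real.norm_eq_abs, sq_abs, sq_abs]
      have tb : χ' x ^ 2 + k ^ 2 * χ x ^ 2 ≤
          (2 * k ^ 2 + 2 * k / h + 1 / h ^ 2) * Real.exp (-(2 * k) * x) := by
        rw [hχ, hχ']; exact test_bound hh hk0 hx
      have kb : 2 * k ^ 2 + 2 * k / h + 1 / h ^ 2 ≤ 5 * k ^ 2 := by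
        have e1 : 2 * k / h = 2 * k * (1 / h) := by ring
        have e2 : 1 / h ^ 2 = (1 / h) ^ 2 := by ring
        rw [e1, e2]
        nlinarith
      have tb2 := tb.trans (mul_le_mul_of_nonneg_right kb (Real.exp_pos _).le)
      have z2 : ‖ζ‖ ^ 2 ≤ Z ^ 2 := pow_le_pow_left₀ (norm_nonneg _) ζZ 2
      have := mul_le_mul z2 tb2 (by positivity) (by positivity)
      calc _ = ‖ζ‖ ^ 2 * (χ' x ^ 2 + k ^ 2 * χ x ^ 2) := by ring
        _ ≤ _ := this
        _ = _ := by ring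
    have g3 : ‖L x‖ ^ 2 * ‖star ζ * (χ x : ℂ)‖ ^ 2 ≤ ‖L x‖ ^ 2 * Z ^ 2 :=
      mul_le_mul_of_nonneg_left (pow_le_pow_left₀ (norm_nonneg _) g1 2) (by positivity)
    generalize star ζ * (χ x : ℂ) = g at *
    generalize star ζ * (χ' x : ℂ) = g' at *
    have n1 : ‖(k : ℂ) ^ 2 * (v x * g) + v' x * g' - L x *
        (q' x * (v x * g) + q x * (v' x * g + v x * g'))‖ ≤
        k ^ 2 * (‖v x‖ * ‖g‖) + ‖v' x‖ * ‖g'‖ +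
          Q * ‖L x‖ * (‖v x‖ * ‖g‖ + (‖v' x‖ * ‖g‖ + ‖v x‖ * ‖g'‖)) := by
      refine (norm_sub_le _ _).trans ?_
      have m1 : ‖(k : ℂ) ^ 2 * (v x * g) + v' x * g'‖ ≤
          k ^ 2 * (‖v x‖ * ‖g‖) + ‖v' x‖ * ‖g'‖ := by
        refine (norm_add_le _ _).trans ?_
        simp only [norm_mul, norm_pow, Complex.norm_real, Real.norm_of_nonneg hk0.le]
        rfl
      have m2 : ‖(q' x : ℂ) * (v x * g) + q x * (v' x * g + v x * g')‖ ≤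
          Q * (‖v x‖ * ‖g‖ + (‖v' x‖ * ‖g‖ + ‖v x‖ * ‖g'‖)) := by
        refine (norm_add_le _ _).trans ?_
        rw [norm_mul, norm_mul (q x : ℂ), Complex.norm_real, Complex.norm_real, mul_add]
        have e1 := norm_add_le (v' x * g) (v x * g')
        rw [norm_mul, norm_mul] at e1
        have := mul_le_mul (bq x hx) e1 (norm_nonneg _) hQ.le
        have := mul_le_mul_of_nonneg_right (bq' x hx) (norm_nonneg (v x * g))
        rw [norm_mul] at this
        rw [norm_mul]
        simp only [Real.norm_eq_abs]
        linarith
      rw [norm_mul (L x)]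
      have := mul_le_mul_of_nonneg_left m2 (norm_nonneg (L x))
      linarith
    refine n1.trans (y2.trans ?_)
    have := mul_le_mul_of_nonneg_left g3 (by positivity : 0 ≤ 2 * Q ^ 2)
    linarith
  rw [intervalIntegral.integral_add (ii (by fun_prop)) (ii (by fun_prop)),
    intervalIntegral.integral_add (ii (by fun_prop)) (ii (by fun_prop)),
    intervalIntegral.integral_add (ii (by fun_prop)) (ii (by fun_prop)),
    intervalIntegral.integral_const_mul, intervalIntegral.integral_const_mul,
    intervalIntegral.integral_const_mul, intervalIntegral.integral_const_mul, ← hE] at nb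
  have x1 := exp_int_le hh.le (m := 2 * k) (by linarith)
  have x2 := mul_le_mul_of_nonneg_left x1 (by positivity : 0 ≤ 5 / 2 * (Z ^ 2 * (5 * k ^ 2)))
  have x3 : 5 / 2 * (Z ^ 2 * (5 * k ^ 2)) * (1 / (2 * k)) = 25 / 4 * Z ^ 2 * k := by
    field_simp; norm_num; ring
  linarith

theorem CSol.bound (F : ShearFlow h U U' U'' U''') (R : ℝ) : ∃ K > 0, ∃ k₁ > 0, ∀ k > k₁,
    ∀ c s : ℂ, c.im ≠ 0 → ‖c‖ ≤ R → CSol h k U U' U'' c s → ‖s‖ ≤ K * k := by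
  obtain ⟨q, q', Q, hQ, hq, cq', hqU, bq, bq'⟩ := F.q_exists
  obtain ⟨B, hB⟩ := isCompact_Icc.exists_bound_of_continuousOn F.cU
  set Z := |B| + |R| with hZ
  have Z0 : 0 ≤ Z := by positivity
  obtain ⟨K₃, hK₃, HL⟩ := log_L2 F Z Z0
  have hh := F.pos
  refine ⟨|U' 0| * Z + 2 * (2 * Q ^ 2 * K₃ * Z ^ 2 + 25 / 4 * Z ^ 2) + Q * K₃ + 1, by positivity,
    1 + 1 / h + 80 * Q ^ 2 * K₃, by positivity, ?_⟩
  intro k hk c s hc hcR H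
  have i0 : 0 < 1 / h := by positivity
  have j0 : 0 < 80 * Q ^ 2 * K₃ := by positivity
  have hk1 : 1 ≤ k := by linarith
  have hkh : 1 / h ≤ k := by linarith
  have hkQ : 80 * Q ^ 2 * K₃ ≤ k := by linarith
  have hk0 : 0 < k := by linarith
  have hUc : ∀ x ∈ Icc 0 h, ‖(U x : ℂ) - c‖ ≤ Z := fun x hx => by
    refine (norm_sub_le _ _).trans ?_
    rw [Complex.norm_real]
    exact add_le_add ((hB x hx).trans (le_abs_self _)) (hcR.trans (le_abs_self _))
  obtain ⟨cL, hL2, hL0⟩ := HL c hc hUc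
  have dL : ∀ x ∈ Icc (0:ℝ) h, HasDerivAt (fun x => Complex.log ((U x : ℂ) - c))
      ((U' x : ℂ) / ((U x : ℂ) - c)) x := fun x hx =>
    HasDerivAt.clog_real ((F.d1 x hx).ofReal_comp.sub_const c) (sub_slit_of_im hc (U x))
  obtain ⟨L, hLdef⟩ : ∃ L : ℝ → ℂ, L = fun x => Complex.log ((U x : ℂ) - c) := ⟨_, rfl⟩
  have hL0' : ‖L 0‖ * ‖(U 0 : ℂ) - c‖ ^ 2 ≤ K₃ := by rw [hLdef]; exact hL0
  have hL2' : ∫ x in (0:ℝ)..h, ‖L x‖ ^ 2 ≤ K₃ := by rw [hLdef]; exact hL2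
  rw [← hLdef] at dL cL
  obtain ⟨v, v', v'', hv, vh, v0, rfl⟩ := H
  have dv := fun x hx => (hv x hx).1
  have cv := cont_of_deriv (fun x hx => (hv x hx).1)
  have cv' := cont_of_deriv (fun x hx => (hv x hx).2.1)
  have ζZ := hUc 0 F.mem0
  obtain ⟨ζ, hζ⟩ : ∃ ζ : ℂ, ζ = (U 0 : ℂ) - c := ⟨_, rfl⟩
  rw [← hζ] at ζZ hL0' v0 ⊢
  have s1 := step_one hh hk1 hc dL cL hv vh hQ hq cq' hqU bq bq' v0
  have s2 := step_two hh hk1 hc dL cL hv vh hQ hq cq' hqU bq bq' v0 hkh ζZ Z0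
  have sup := fun y hy => sup_bound (y := y) hh.le hk0 dv cv' vh hy
  have E0 : 0 ≤ ∫ x in (0:ℝ)..h, (‖v' x‖ ^ 2 + k ^ 2 * ‖v x‖ ^ 2) :=
    integral_nonneg hh.le (fun x _ => by positivity)
  generalize hE : ∫ x in (0:ℝ)..h, (‖v' x‖ ^ 2 + k ^ 2 * ‖v x‖ ^ 2) = E at s1 s2 sup E0
  generalize hX : -(v' 0 * star ζ) + q 0 * L 0 * v 0 * star ζ = X at s1 s2
  -- `∫ |L|² |v|²`
  have hLv : ∫ x in (0:ℝ)..h, ‖L x‖ ^ 2 * ‖v x‖ ^ 2 ≤ K₃ * (E / k) := by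
    have : ∫ x in (0:ℝ)..h, ‖L x‖ ^ 2 * ‖v x‖ ^ 2 ≤ ∫ x in (0:ℝ)..h, ‖L x‖ ^ 2 * (E / k) :=
      int_mono hh.le (by fun_prop) (by fun_prop)
        (fun x hx => mul_le_mul_of_nonneg_left (sup x hx) (by positivity))
    rw [intervalIntegral.integral_mul_const] at this
    exact this.trans (mul_le_mul_of_nonneg_right hL2' (by positivity))
  have hLv' : Q ^ 2 * ∫ x in (0:ℝ)..h, ‖L x‖ ^ 2 * ‖v x‖ ^ 2 ≤ E / 80 := by
    calc _ ≤ Q ^ 2 * (K₃ * (E / k)) := mul_le_mul_of_nonneg_left hLv (by positivity)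
      _ = (80 * Q ^ 2 * K₃) * E / (80 * k) := by field_simp
      _ ≤ k * E / (80 * k) := by gcongr
      _ = _ := by field_simp
  have x4 := mul_le_mul_of_nonneg_left hL2' (by positivity : 0 ≤ 2 * Q ^ 2 * Z ^ 2)
  have st1 : 3 / 4 * E ≤ ‖X‖ := by linarith
  have st2 : ‖X‖ ≤ 1 / 4 * E + E / 80 + 2 * Q ^ 2 * K₃ * Z ^ 2 + 25 / 4 * Z ^ 2 * k := by linarith
  have fin : ‖X‖ ≤ 2 * (2 * Q ^ 2 * K₃ * Z ^ 2 + 25 / 4 * Z ^ 2 * k) := by linarith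
  have e1 : v' 0 * star ζ = -X + q 0 * L 0 * v 0 * star ζ := by rw [← hX]; ring
  have e2 : ‖v' 0 * ζ‖ ≤ ‖X‖ + Q * K₃ := by
    have : ‖v' 0 * ζ‖ = ‖v' 0 * star ζ‖ := by rw [norm_mul, norm_mul, norm_star]
    rw [this, e1]
    refine (norm_add_le _ _).trans ?_
    rw [norm_neg, v0, norm_mul, norm_mul, norm_mul, norm_star, Complex.norm_real]
    have := mul_le_mul (bq 0 F.mem0) hL0' (by positivity) hQ.le
    rw [← Real.norm_eq_abs] at this
    have e : ‖q 0‖ * ‖L 0‖ * ‖ζ‖ * ‖ζ‖ = ‖q 0‖ * (‖L 0‖ * ‖ζ‖ ^ 2) := by ring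
    rw [e]
    linarith
  rw [v0]
  refine (norm_sub_le _ _).trans ?_
  rw [norm_mul, Complex.norm_real, Real.norm_eq_abs]
  have f1 : |U' 0| * ‖ζ‖ ≤ |U' 0| * Z := mul_le_mul_of_nonneg_left ζZ (abs_nonneg _)
  have f2 : 0 ≤ |U' 0| * Z := by positivity
  have f3 : 0 ≤ 2 * Q ^ 2 * K₃ * Z ^ 2 := by positivity
  have f4 : 0 ≤ Q * K₃ := by positivity
  nlinarith
end


section
variable {h k : ℝ} {U U' U'' U''' : ℝ → ℝ}

theorem CSol.up0 (F : ShearFlow h U U' U'' U''') {c D : ℝ} {s : ℂ}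
    (hr : ∀ x ∈ Icc 0 h, U x ≠ c) (hk : 1 / h ≤ k) (hD : ∀ x ∈ Icc 0 h, |U x - c| ≤ D)
    (H : CSol h k U U' U'' c s) : s.re ≤ 5 / 2 * D ^ 2 * k := by
  have hh := F.pos
  have i0 : 0 < 1 / h := by positivity
  have hk0 : 0 < k := by linarith
  have cU := F.cU
  have R := (H.real F hr).upper hh (by fun_prop) (fun x _ => by positivity) le_rfl hk0
    (D := D ^ 2) (by positivity) (fun x hx => by
      simp only [mul_zero, zero_mul, Real.exp_zero, mul_one]
      rw [← sq_abs]
      exact pow_le_pow_left₀ (abs_nonneg _) (hD x hx) 2)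
  rw [sub_zero] at R
  have kb : k ^ 2 + k / h + 1 / (2 * h ^ 2) ≤ 5 / 2 * k ^ 2 := by
    have e1 : k / h = k * (1 / h) := by ring
    have e2 : 1 / (2 * h ^ 2) = (1 / h) ^ 2 / 2 := by field_simp
    rw [e1, e2]
    nlinarith
  have R2 := R.trans (mul_le_mul_of_nonneg_left kb (by positivity))
  have : s.re * k ≤ (5 / 2 * D ^ 2 * k) * k := by linarith
  exact le_of_mul_le_mul_right this hk0

theorem CSol.asym (F : ShearFlow h U U' U'' U''') {b : ℝ} (hb : ∀ x ∈ Icc 0 h, U x ≤ b) :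
    ∃ A > 0, ∃ k₁ > 0, ∀ k > k₁, ∀ c : ℝ, b + 1 ≤ c → ∀ s : ℂ, CSol h k U U' U'' c s →
      |s.re - k * (U 0 - c) ^ 2| ≤ A * (U 0 - c) ^ 2 := by
  obtain ⟨B₀, hB₀⟩ := isCompact_Icc.exists_bound_of_continuousOn F.cU'
  obtain ⟨B, hB0, hB⟩ : ∃ B : ℝ, 0 ≤ B ∧ ∀ x ∈ Icc 0 h, |U' x| ≤ B :=
    ⟨|B₀|, abs_nonneg _, fun x hx => (hB₀ x hx).trans (le_abs_self _)⟩
  have hh := F.pos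
  have i0 : 0 < 1 / h := by positivity
  have cU := F.cU
  have cU' := F.cU'
  refine ⟨2 * B + 4 * (1 / h), by positivity, 4 * B + 1 / h, by positivity, ?_⟩
  intro k hk c hc s H
  have hk0 : 0 < k := by linarith
  have hr : ∀ x ∈ Icc 0 h, U x ≠ c := fun x hx e => by have := hb x hx; linarith
  have R := H.real F hr
  have d1 : 1 ≤ c - U 0 := by have := hb 0 F.mem0; linarith
  have mv : ∀ x ∈ Icc 0 h, |U x - U 0| ≤ B * x := by
    intro x hx
    have := Convex.norm_image_sub_le_of_norm_hasDerivWithin_le (f := U) (f' := U') (C := B)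
      (fun y hy => (F.d1 y hy).hasDerivWithinAt) (fun y hy => hB y hy) (convex_Icc 0 h) F.mem0 hx
    simpa [abs_of_nonneg hx.1] using this
  have up := R.upper hh (by fun_prop) (fun x _ => by positivity) hB0 (by linarith)
    (D := (U 0 - c) ^ 2) (by positivity) (fun x hx => by
      have e : Real.exp (2 * B * x) = Real.exp (B * x) ^ 2 := by
        rw [← Real.exp_nat_mul]; congr 1; push_cast; ring
      rw [e, ← mul_pow, ← sq_abs, ← sq_abs ((U 0 - c) * _)]
      apply pow_le_pow_left₀ (abs_nonneg _)
      rw [abs_mul, Real.abs_exp, abs_sub_comm, abs_sub_comm (U 0)]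
      have m := (abs_le.mp (mv x hx)).1
      have := hb x hx
      rw [abs_of_nonneg (by linarith), abs_of_nonneg (by linarith)]
      have e1 := Real.add_one_le_exp (B * x)
      have e2 : 0 ≤ B * x := mul_nonneg hB0 hx.1
      nlinarith)
  have lo := R.lower hh (p' := fun x => 2 * (U x - c) * U' x) (fun x hx => by
      refine (((F.d1 x hx).sub_const c).pow 2).congr_deriv ?_
      simp) (by fun_prop) (fun x _ => by positivity) hB0 hk0 (fun x hx => by
      have := hb x hx
      have a1 : 1 ≤ |U x - c| := by rw [abs_sub_comm, abs_of_nonneg] <;> linarith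
      rw [abs_mul, abs_mul, ← sq_abs (U x - c), abs_two]
      have := hB x hx
      have := mul_le_mul_of_nonneg_left this (by linarith : 0 ≤ |U x - c|)
      have := mul_nonneg hB0 (mul_nonneg (abs_nonneg (U x - c)) (sub_nonneg.mpr a1))
      nlinarith)
  obtain ⟨S, hS⟩ : ∃ S, S = (U 0 - c) ^ 2 := ⟨_, rfl⟩
  have S0 : 0 ≤ S := by rw [hS]; positivity
  simp only [← hS] at *
  have e1 : k / h = k * (1 / h) := by ring
  have e2 : 1 / (2 * h ^ 2) = (1 / h) ^ 2 / 2 := by field_simp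
  rw [e1, e2] at up
  generalize 1 / h = i at *
  have kB : 0 < k - B := by linarith
  rw [abs_le]
  constructor
  · have l2 : k ^ 2 * S ≤ s.re * (k + 2 * B) := by
      have := mul_le_mul_of_nonneg_left lo hk0.le
      have e : k * (s.re * (1 + 2 * B / k)) = s.re * (k + 2 * B) := by field_simp
      rw [e] at this; linarith
    have l3 : ((k - 2 * B) * S) * (k + 2 * B) ≤ s.re * (k + 2 * B) := by
      nlinarith [mul_nonneg S0 (sq_nonneg B)]
    have l4 := le_of_mul_le_mul_right l3 (by linarith)
    nlinarith [mul_nonneg S0 i0.le]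
  · have q : k ^ 2 + k * i + i ^ 2 / 2 ≤ (k + (2 * B + 4 * i)) * (k - B) := by
      have q1 : 0 ≤ i * (k - 4 * B - i) := mul_nonneg i0.le (by linarith)
      have q2 : 0 ≤ B * (k - 4 * B - i) := mul_nonneg hB0 (by linarith)
      have q3 : 0 ≤ B * i := mul_nonneg hB0 i0.le
      have q4 : 0 ≤ i * k := by positivity
      nlinarith [sq_nonneg B]
    have u2 : s.re * (k - B) ≤ (S * (k + (2 * B + 4 * i))) * (k - B) := by
      have := mul_le_mul_of_nonneg_left q S0
      linarith
    have := le_of_mul_le_mul_right u2 kB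
    linarith

theorem CSol.nonneg (F : ShearFlow h U U' U'' U''') {c : ℝ} {s : ℂ}
    (hr : ∀ x ∈ Icc 0 h, U x ≠ c) (H : CSol h k U U' U'' c s) : 0 ≤ s.re := by
  have cU := F.cU
  obtain ⟨w, w', -, -, -, -, e⟩ := (H.real F hr).eq F.pos.le (by fun_prop)
  rw [e]
  exact integral_nonneg F.pos.le (fun x _ => by positivity)

theorem CSol.mono1 (F : ShearFlow h U U' U'' U''') {lo b c c' : ℝ} {s s' : ℂ}
    (hlo : ∀ x ∈ Icc 0 h, lo ≤ U x) (hb : ∀ x ∈ Icc 0 h, U x ≤ b) (hc : b < c) (hcc : c ≤ c')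
    (H : CSol h k U U' U'' c s) (H' : CSol h k U U' U'' c' s') :
    s.re ≤ ((c - lo) / (c' - lo)) ^ 2 * s'.re := by
  have cU := F.cU
  have l0 := (hlo 0 F.mem0).trans (hb 0 F.mem0)
  refine RSol.compare F.pos.le (by fun_prop) (fun x _ => by positivity) (by fun_prop)
    (H.real F fun x hx e => by have := hb x hx; linarith)
    (H'.real F fun x hx e => by have := hb x hx; linarith) (fun x hx => ?_)
  have h1 := hlo x hx
  have h2 := hb x hx
  have p : 0 < c' - lo := by linarith
  rw [← mul_pow, ← sq_abs, ← sq_abs (_ * _)]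
  apply pow_le_pow_left₀ (abs_nonneg _)
  rw [abs_mul, abs_sub_comm, abs_sub_comm _ c', abs_of_nonneg (by linarith : 0 ≤ c - U x),
    abs_of_nonneg (by linarith : 0 ≤ c' - U x), abs_of_nonneg (div_nonneg (by linarith) p.le),
    div_mul_eq_mul_div, le_div_iff₀ p]
  nlinarith

theorem CSol.mono2 (F : ShearFlow h U U' U'' U''') {b c c' : ℝ} {s s' : ℂ}
    (hb : ∀ x ∈ Icc 0 h, U x ≤ b) (hc : b < c) (hcc : c ≤ c')
    (H : CSol h k U U' U'' c s) (H' : CSol h k U U' U'' c' s') :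
    s'.re ≤ ((c' - b) / (c - b)) ^ 2 * s.re := by
  have cU := F.cU
  refine RSol.compare F.pos.le (by fun_prop) (fun x _ => by positivity) (by fun_prop)
    (H'.real F fun x hx e => by have := hb x hx; linarith)
    (H.real F fun x hx e => by have := hb x hx; linarith) (fun x hx => ?_)
  have h2 := hb x hx
  have p : 0 < c - b := by linarith
  rw [← mul_pow, ← sq_abs, ← sq_abs (_ * _)]
  apply pow_le_pow_left₀ (abs_nonneg _)
  rw [abs_mul, abs_sub_comm, abs_sub_comm _ c, abs_of_nonneg (by linarith : 0 ≤ c - U x),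
    abs_of_nonneg (by linarith : 0 ≤ c' - U x), abs_of_nonneg (div_nonneg (by linarith) p.le),
    div_mul_eq_mul_div, le_div_iff₀ p]
  nlinarith
end

theorem root_unique {f₁ f₂ lo c c' G : ℝ} (hlo : lo < c) (hcc : c < c') (G0 : 0 < G)
    (h1 : f₁ ≤ ((c - lo) / (c' - lo)) ^ 2 * f₂) (e1 : f₁ = G) (e2 : f₂ = G) : False := by
  subst e1
  rw [e2] at h1
  have : ((c - lo) / (c' - lo)) ^ 2 < 1 := by
    apply pow_lt_one₀ (div_nonneg (by linarith) (by linarith)) _ two_ne_zero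
    rw [div_lt_one (by linarith)]; linarith
  nlinarith

theorem root_exists {f : ℝ → ℝ} {b G c₁ : ℝ} (f0 : ∀ c > b, 0 ≤ f c)
    (m1 : ∀ c c', b < c → c ≤ c' → f c ≤ f c')
    (m2 : ∀ c c', b < c → c ≤ c' → f c' ≤ ((c' - b) / (c - b)) ^ 2 * f c)
    (hb1 : f (b + 1) ≤ G) (hc₁ : b + 1 ≤ c₁) (hG : G ≤ f c₁) : ∃ c, b + 1 ≤ c ∧ f c = G := by
  have key : ∀ c ∈ Icc (b + 1) c₁, ∀ c' ∈ Icc (b + 1) c₁, c ≤ c' →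
      |f c' - f c| ≤ (2 * (c₁ - b) * f c₁) * |c' - c| := by
    intro c hc c' hc' hcc
    have a1 := m1 c c' (by linarith [hc.1]) hcc
    have a2 := m2 c c' (by linarith [hc.1]) hcc
    have a3 := m1 c c₁ (by linarith [hc.1]) hc.2
    have a4 := f0 c (by linarith [hc.1])
    rw [abs_of_nonneg (by linarith), abs_of_nonneg (by linarith)]
    have p : 1 ≤ c - b := by linarith [hc.1]
    have q : ((c' - b) / (c - b)) ^ 2 - 1 ≤ 2 * (c₁ - b) * (c' - c) := by
      have e : ((c' - b) / (c - b)) ^ 2 - 1 = ((c' - c) * (c' + c - 2 * b)) / (c - b) ^ 2 := by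
        field_simp; ring
      rw [e]
      refine (div_le_self (mul_nonneg (by linarith) (by linarith)) (one_le_pow₀ p)).trans ?_
      rw [mul_comm]
      exact mul_le_mul_of_nonneg_right (by linarith [hc.2, hc'.2]) (by linarith)
    have q0 : 0 ≤ 2 * (c₁ - b) * (c' - c) := mul_nonneg (by linarith) (by linarith)
    have r1 := mul_le_mul_of_nonneg_right q a4
    have r2 := mul_le_mul_of_nonneg_left a3 q0
    linarith
  have L0 : 0 ≤ 2 * (c₁ - b) * f c₁ := mul_nonneg (by linarith) (f0 c₁ (by linarith))
  have cont : ContinuousOn f (Icc (b + 1) c₁) := by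
    apply LipschitzOnWith.continuousOn (K := Real.toNNReal (2 * (c₁ - b) * f c₁))
    apply LipschitzOnWith.of_dist_le_mul
    intro x hx y hy
    rw [Real.coe_toNNReal _ L0, Real.dist_eq, Real.dist_eq]
    rcases le_total x y with hxy | hxy
    · rw [abs_sub_comm, abs_sub_comm x]; exact key x hx y hy hxy
    · exact key y hy x hx hxy
  obtain ⟨c, hc, e⟩ := intermediate_value_Icc hc₁ cont ⟨hb1, hG⟩
  exact ⟨c, hc.1, e⟩

theorem asym_real {ρ₁ ρ₂ σ γ A b u₁ u₂ : ℝ} (r1 : 0 < ρ₁) (r2 : 0 < ρ₂) (hσ : 0 < σ) (hγ : 0 < γ)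
    (hA : 0 < A) (h1 : u₁ ≤ b) (h2 : u₂ ≤ b) : ∃ C > 0, ∀ k c : ℝ, 1 ≤ k → 2 * A ≤ k → b + 1 ≤ c →
    |σ * k ^ 2 + γ - k * (ρ₁ * (u₁ - c) ^ 2 + ρ₂ * (u₂ - c) ^ 2)| ≤
      A * (ρ₁ * (u₁ - c) ^ 2 + ρ₂ * (u₂ - c) ^ 2) →
    |c - (u₁ * (ρ₁ / ρ₂) + u₂) / (1 + ρ₁ / ρ₂) -
      Real.sqrt (-(ρ₁ / ρ₂) * (u₁ - u₂) ^ 2 / (1 + ρ₁ / ρ₂) ^ 2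
                + σ * k / (ρ₂ * (1 + ρ₁ / ρ₂)))| ≤ C := by
  refine ⟨(2 * A * (σ + γ) + γ) / (ρ₁ + ρ₂), by positivity, fun k c hk hkA hc H => ?_⟩
  obtain ⟨S, hS⟩ : ∃ S, S = ρ₁ * (u₁ - c) ^ 2 + ρ₂ * (u₂ - c) ^ 2 := ⟨_, rfl⟩
  have S0 : 0 ≤ S := by rw [hS]; positivity
  rw [← hS] at H
  obtain ⟨H1, H2⟩ := abs_le.mp H
  have k0 : 0 < k := by linarith
  have hSk : S ≤ 2 * (σ + γ) * k := by
    have g1 := mul_nonneg S0 (by linarith : 0 ≤ k - 2 * A)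
    have g2 : γ ≤ γ * k ^ 2 := le_mul_of_one_le_right hγ.le (one_le_pow₀ hk)
    have : S * k ≤ (2 * (σ + γ) * k) * k := by linarith
    exact le_of_mul_le_mul_right this k0
  have hAS : A * S ≤ 2 * A * (σ + γ) * k := by nlinarith
  have B1 : S - σ * k ≤ 2 * A * (σ + γ) + γ := by
    have : (S - σ * k) * k ≤ (2 * A * (σ + γ) + γ) * k := by nlinarith
    exact le_of_mul_le_mul_right this k0
  have B2 : σ * k - S ≤ 2 * A * (σ + γ) + γ := by
    have : (σ * k - S) * k ≤ (2 * A * (σ + γ) + γ) * k := by nlinarith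
    exact le_of_mul_le_mul_right this k0
  obtain ⟨m, hm⟩ : ∃ m, m = (u₁ * (ρ₁ / ρ₂) + u₂) / (1 + ρ₁ / ρ₂) := ⟨_, rfl⟩
  obtain ⟨T, hT⟩ : ∃ T, T = -(ρ₁ / ρ₂) * (u₁ - u₂) ^ 2 / (1 + ρ₁ / ρ₂) ^ 2
                + σ * k / (ρ₂ * (1 + ρ₁ / ρ₂)) := ⟨_, rfl⟩
  rw [← hm, ← hT]
  have hm' : m = (ρ₁ * u₁ + ρ₂ * u₂) / (ρ₁ + ρ₂) := by
    have p : ρ₂ + ρ₁ ≠ 0 := by positivity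
    rw [hm]; field_simp; ring
  have hmb : m ≤ b := by
    rw [hm', div_le_iff₀ (by positivity)]
    nlinarith
  have id : (c - m) ^ 2 - T = (S - σ * k) / (ρ₁ + ρ₂) := by
    have p : ρ₂ + ρ₁ ≠ 0 := by positivity
    have p' : ρ₁ + ρ₂ ≠ 0 := by positivity
    rw [hm', hT, hS]; field_simp; ring
  have d1 : (c - m) ^ 2 - T ≤ (2 * A * (σ + γ) + γ) / (ρ₁ + ρ₂) := by
    rw [id]; gcongr
  have d2 : T - (c - m) ^ 2 ≤ (2 * A * (σ + γ) + γ) / (ρ₁ + ρ₂) := by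
    have : T - (c - m) ^ 2 = (σ * k - S) / (ρ₁ + ρ₂) := by
      rw [← neg_sub, id]; ring
    rw [this]; gcongr
  generalize (2 * A * (σ + γ) + γ) / (ρ₁ + ρ₂) = C at *
  have w1 : 1 ≤ c - m := by linarith
  rcases le_or_gt 0 T with hT0 | hT0
  · have q := Real.sq_sqrt hT0
    have q0 := Real.sqrt_nonneg T
    have C0 : 0 ≤ C := by linarith
    generalize √T = y at *
    generalize c - m = w at *
    rcases le_total y w with hy | hy
    · rw [abs_of_nonneg (by linarith)]
      have := mul_nonneg (sub_nonneg.mpr hy) (by linarith : 0 ≤ w + y - 1)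
      linarith
    · rw [abs_of_nonpos (by linarith)]
      have := mul_nonneg (sub_nonneg.mpr hy) (by linarith : 0 ≤ w + y - 1)
      linarith
  · rw [Real.sqrt_eq_zero_of_nonpos hT0.le, sub_zero, abs_of_nonneg (by linarith)]
    nlinarith


/-- Two-sided problem, written on `[0,h₁]` and `[0,h₂]`. -/
def PMode (h₁ h₂ : ℝ) (U₁ U₁' U₁'' U₂ U₂' U₂'' : ℝ → ℝ) (ρ₁ ρ₂ G k : ℝ) (c : ℂ) : Prop :=
  (∀ x ∈ Icc (0:ℝ) h₁, (U₁ x : ℂ) ≠ c) ∧ (∀ x ∈ Icc (0:ℝ) h₂, (U₂ x : ℂ) ≠ c) ∧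
  ∃ s₁ s₂ : ℂ, CSol h₁ k U₁ U₁' U₁'' c s₁ ∧ CSol h₂ k U₂ U₂' U₂'' c s₂ ∧
    (G : ℂ) = ρ₁ * s₁ + ρ₂ * s₂

section
variable {h₁ h₂ : ℝ} {U₁ U₁' U₁'' U₁''' U₂ U₂' U₂'' U₂''' : ℝ → ℝ} {ρ₁ ρ₂ σ γ a b : ℝ}

theorem PMode.re {G k : ℝ} {c : ℂ} (H : PMode h₁ h₂ U₁ U₁' U₁'' U₂ U₂' U₂'' ρ₁ ρ₂ G k c) :
    ∃ s₁ s₂ : ℂ, CSol h₁ k U₁ U₁' U₁'' c s₁ ∧ CSol h₂ k U₂ U₂' U₂'' c s₂ ∧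
    (G : ℂ) = ρ₁ * s₁ + ρ₂ * s₂ ∧ G = ρ₁ * s₁.re + ρ₂ * s₂.re ∧ 0 = ρ₁ * s₁.im + ρ₂ * s₂.im := by
  obtain ⟨-, -, s₁, s₂, H₁, H₂, e⟩ := H
  refine ⟨s₁, s₂, H₁, H₂, e, ?_, ?_⟩
  · simpa using congrArg Complex.re e
  · simpa using congrArg Complex.im e

theorem exclusion (F₁ : ShearFlow h₁ U₁ U₁' U₁'' U₁''') (F₂ : ShearFlow h₂ U₂ U₂' U₂'' U₂''')
    (r1 : 0 < ρ₁) (r2 : 0 < ρ₂) (hσ : 0 < σ) (hγ : 0 < γ)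
    (a1 : ∀ x ∈ Icc 0 h₁, a ≤ U₁ x) (a2 : ∀ x ∈ Icc 0 h₂, a ≤ U₂ x)
    (b1 : ∀ x ∈ Icc 0 h₁, U₁ x ≤ b) (b2 : ∀ x ∈ Icc 0 h₂, U₂ x ≤ b) :
    ∃ k₀ > 0, ∀ k > k₀, ∀ c : ℂ,
      PMode h₁ h₂ U₁ U₁' U₁'' U₂ U₂' U₂'' ρ₁ ρ₂ (σ * k ^ 2 + γ) k c →
      c.im = 0 ∧ (c.re < a ∨ b < c.re) := by
  have hab : a ≤ b := (a1 0 F₁.mem0).trans (b1 0 F₁.mem0)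
  obtain ⟨K₁, hK₁, l₁, hl₁, B₁⟩ := CSol.bound F₁ (|a| + |b| + (b - a))
  obtain ⟨K₂, hK₂, l₂, hl₂, B₂⟩ := CSol.bound F₂ (|a| + |b| + (b - a))
  have i1 : 0 < 1 / h₁ := one_div_pos.mpr F₁.pos
  have i2 : 0 < 1 / h₂ := one_div_pos.mpr F₂.pos
  obtain ⟨P, hP⟩ : ∃ P, P = (ρ₁ * K₁ + ρ₂ * K₂) / σ := ⟨_, rfl⟩
  obtain ⟨P', hP'⟩ : ∃ P, P = (ρ₁ + ρ₂) * (5 / 2 * (b - a) ^ 2) / σ := ⟨_, rfl⟩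
  have P0 : 0 < P := by rw [hP]; positivity
  have P0' : 0 ≤ P' := by rw [hP']; positivity
  have eP : ρ₁ * K₁ + ρ₂ * K₂ = σ * P := by rw [hP]; field_simp
  have eP' : (ρ₁ + ρ₂) * (5 / 2 * (b - a) ^ 2) = σ * P' := by rw [hP']; field_simp
  refine ⟨l₁ + l₂ + 1 / h₁ + 1 / h₂ + P + P', by positivity, fun k hk c H => ?_⟩
  have hk0 : 0 < k := by linarith
  have n1 := H.1
  have n2 := H.2.1
  obtain ⟨s₁, s₂, H₁, H₂, e, hre, him⟩ := H.re
  have hσk : 0 < σ * k := by positivity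
  have G0 : 0 < σ * k ^ 2 + γ := by positivity
  have real : c.im = 0 := by
    by_contra hc
    obtain ⟨M₁, I₁, M₁0, lo₁, hi₁, im₁, re₁⟩ := H₁.howard F₁ a1 b1 n1
    obtain ⟨M₂, I₂, M₂0, lo₂, hi₂, im₂, re₂⟩ := H₂.howard F₂ a2 b2 n2
    have I0 : ρ₁ * I₁ + ρ₂ * I₂ = 0 := by
      rw [im₁, im₂] at him
      have : c.im * (ρ₁ * I₁ + ρ₂ * I₂) = 0 := by linarith
      exact (mul_eq_zero.mp this).resolve_left hc
    obtain ⟨N, hN⟩ : ∃ N, N = ρ₁ * M₁ + ρ₂ * M₂ := ⟨_, rfl⟩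
    have N0 : 0 ≤ N := by rw [hN]; positivity
    have lo : (a - c.re) * N ≤ 0 := by
      have q1 := mul_le_mul_of_nonneg_left lo₁ r1.le
      have q2 := mul_le_mul_of_nonneg_left lo₂ r2.le
      rw [hN]; linarith
    have hi : 0 ≤ (b - c.re) * N := by
      have q1 := mul_le_mul_of_nonneg_left hi₁ r1.le
      have q2 := mul_le_mul_of_nonneg_left hi₂ r2.le
      rw [hN]; linarith
    have tot : ∀ B : ℝ, |a - c.re| ≤ B → |b - c.re| ≤ B →
        σ * k ^ 2 + γ ≤ (B ^ 2 - c.im ^ 2) * N := by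
      intro B h1 h2
      have g : ∀ u, a ≤ u → u ≤ b → |u - c.re| ≤ B := by
        intro u hu hu'
        rw [abs_le] at *
        constructor <;> linarith
      have q1 := mul_le_mul_of_nonneg_left
        (re₁ B (fun x hx => g _ (a1 x hx) (b1 x hx))) r1.le
      have q2 := mul_le_mul_of_nonneg_left
        (re₂ B (fun x hx => g _ (a2 x hx) (b2 x hx))) r2.le
      rw [hN, hre]; linarith
    have Npos : 0 < N := by
      rcases N0.lt_or_eq with h | h
      · exact h
      · have := tot (|a - c.re| + |b - c.re|) (by linarith [abs_nonneg (b - c.re)])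
          (by linarith [abs_nonneg (a - c.re)])
        rw [← h, mul_zero] at this
        linarith
    have ca : a ≤ c.re := by
      by_contra hh
      have := mul_pos (by linarith : 0 < a - c.re) Npos
      linarith
    have cb : c.re ≤ b := by
      by_contra hh
      have := mul_pos (by linarith : 0 < c.re - b) Npos
      linarith
    have t := tot (b - a) (by rw [abs_le]; constructor <;> linarith)
      (by rw [abs_le]; constructor <;> linarith)
    have im2 : c.im ^ 2 ≤ (b - a) ^ 2 := by
      by_contra hh
      have := mul_pos (by linarith : 0 < c.im ^ 2 - (b - a) ^ 2) Npos
      linarith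
    have im3 : |c.im| ≤ b - a := abs_le_of_sq_le_sq im2 (by linarith)
    have re3 : |c.re| ≤ |a| + |b| := by
      rw [abs_le]
      constructor
      · linarith [neg_abs_le a, abs_nonneg b]
      · linarith [le_abs_self b, abs_nonneg a]
    have cR : ‖c‖ ≤ |a| + |b| + (b - a) := (Complex.norm_le_abs_re_add_abs_im c).trans (by linarith)
    have q1 := mul_le_mul_of_nonneg_left (B₁ k (by linarith) c s₁ hc cR H₁) r1.le
    have q2 := mul_le_mul_of_nonneg_left (B₂ k (by linarith) c s₂ hc cR H₂) r2.le
    have q3 := mul_le_mul_of_nonneg_left (Complex.re_le_norm s₁) r1.le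
    have q4 := mul_le_mul_of_nonneg_left (Complex.re_le_norm s₂) r2.le
    have fin : σ * k * (k - P) < 0 := by
      have : (ρ₁ * K₁ + ρ₂ * K₂) * k = σ * P * k := by rw [eP]
      linarith
    have := mul_pos hσk (by linarith : 0 < k - P)
    linarith
  refine ⟨real, ?_⟩
  by_contra hcon
  rw [not_or, not_lt, not_lt] at hcon
  obtain ⟨ca, cb⟩ := hcon
  have ec : c = (c.re : ℂ) := by apply Complex.ext <;> simp [real]
  generalize c.re = r at *
  subst ec
  have g : ∀ u, a ≤ u → u ≤ b → |u - r| ≤ b - a := by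
    intro u hu hu'
    rw [abs_le]
    constructor <;> linarith
  have q1 := mul_le_mul_of_nonneg_left (H₁.up0 F₁ (fun x hx e => n1 x hx (by rw [e])) (by linarith)
    (fun x hx => g _ (a1 x hx) (b1 x hx))) r1.le
  have q2 := mul_le_mul_of_nonneg_left (H₂.up0 F₂ (fun x hx e => n2 x hx (by rw [e])) (by linarith)
    (fun x hx => g _ (a2 x hx) (b2 x hx))) r2.le
  have fin : σ * k * (k - P') < 0 := by
    have : (ρ₁ + ρ₂) * (5 / 2 * (b - a) ^ 2) * k = σ * P' * k := by rw [eP']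
    linarith
  have := mul_pos hσk (by linarith : 0 < k - P')
  linarith

theorem upper_half (F₁ : ShearFlow h₁ U₁ U₁' U₁'' U₁''') (F₂ : ShearFlow h₂ U₂ U₂' U₂'' U₂''')
    (r1 : 0 < ρ₁) (r2 : 0 < ρ₂) (hσ : 0 < σ) (hγ : 0 < γ)
    (a1 : ∀ x ∈ Icc 0 h₁, a ≤ U₁ x) (a2 : ∀ x ∈ Icc 0 h₂, a ≤ U₂ x)
    (b1 : ∀ x ∈ Icc 0 h₁, U₁ x ≤ b) (b2 : ∀ x ∈ Icc 0 h₂, U₂ x ≤ b) :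
    ∃ k₀ > 0, ∃ C > 0, ∀ k > k₀, ∃ c : ℝ, b < c ∧
      PMode h₁ h₂ U₁ U₁' U₁'' U₂ U₂' U₂'' ρ₁ ρ₂ (σ * k ^ 2 + γ) k c ∧
      (∀ c' : ℝ, b < c' → PMode h₁ h₂ U₁ U₁' U₁'' U₂ U₂' U₂'' ρ₁ ρ₂ (σ * k ^ 2 + γ) k c' → c' = c) ∧
      |c - (U₁ 0 * (ρ₁ / ρ₂) + U₂ 0) / (1 + ρ₁ / ρ₂) -
        Real.sqrt (-(ρ₁ / ρ₂) * (U₁ 0 - U₂ 0) ^ 2 / (1 + ρ₁ / ρ₂) ^ 2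
                + σ * k / (ρ₂ * (1 + ρ₁ / ρ₂)))| ≤ C := by
  have hab : a ≤ b := (a1 0 F₁.mem0).trans (b1 0 F₁.mem0)
  obtain ⟨A₁, hA₁, l₁, hl₁, B₁⟩ := CSol.asym F₁ b1
  obtain ⟨A₂, hA₂, l₂, hl₂, B₂⟩ := CSol.asym F₂ b2
  obtain ⟨C, hC, AS⟩ := asym_real (A := A₁ + A₂) r1 r2 hσ hγ (by positivity) (b1 0 F₁.mem0)
    (b2 0 F₂.mem0)
  have i1 : 0 < 1 / h₁ := one_div_pos.mpr F₁.pos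
  have i2 : 0 < 1 / h₂ := one_div_pos.mpr F₂.pos
  obtain ⟨P', hP'⟩ : ∃ P, P = (ρ₁ + ρ₂) * (5 / 2 * (b + 1 - a) ^ 2) / σ := ⟨_, rfl⟩
  have P0' : 0 ≤ P' := by rw [hP']; positivity
  have eP' : (ρ₁ + ρ₂) * (5 / 2 * (b + 1 - a) ^ 2) = σ * P' := by rw [hP']; field_simp
  refine ⟨l₁ + l₂ + 1 / h₁ + 1 / h₂ + P' + 1 + 2 * (A₁ + A₂), by positivity, C, hC,
    fun k hk => ?_⟩
  have hk0 : 0 < k := by linarith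
  have hσk : 0 < σ * k := by positivity
  have G0 : 0 < σ * k ^ 2 + γ := by positivity
  have n1 : ∀ c : ℝ, b < c → ∀ x ∈ Icc 0 h₁, U₁ x ≠ c := fun c hc x hx e => by
    have := b1 x hx; linarith
  have n2 : ∀ c : ℝ, b < c → ∀ x ∈ Icc 0 h₂, U₂ x ≠ c := fun c hc x hx e => by
    have := b2 x hx; linarith
  have ex1 : ∀ c : ℝ, ∃ s : ℝ, b < c → CSol h₁ k U₁ U₁' U₁'' c s := fun c => by
    by_cases hc : b < c
    · obtain ⟨s, hs⟩ := CSol.exists F₁ hk0 (n1 c hc)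
      exact ⟨s, fun _ => hs⟩
    · exact ⟨0, fun h => absurd h hc⟩
  have ex2 : ∀ c : ℝ, ∃ s : ℝ, b < c → CSol h₂ k U₂ U₂' U₂'' c s := fun c => by
    by_cases hc : b < c
    · obtain ⟨s, hs⟩ := CSol.exists F₂ hk0 (n2 c hc)
      exact ⟨s, fun _ => hs⟩
    · exact ⟨0, fun h => absurd h hc⟩
  choose f₁ hf₁ using ex1
  choose f₂ hf₂ using ex2
  have f0 : ∀ c > b, 0 ≤ ρ₁ * f₁ c + ρ₂ * f₂ c := by
    intro c hc
    have p1 := (hf₁ c hc).nonneg F₁ (n1 c hc)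
    have p2 := (hf₂ c hc).nonneg F₂ (n2 c hc)
    rw [Complex.ofReal_re] at p1 p2
    positivity
  have m1 : ∀ c c', b < c → c ≤ c' → ρ₁ * f₁ c + ρ₂ * f₂ c ≤
      ((c - a) / (c' - a)) ^ 2 * (ρ₁ * f₁ c' + ρ₂ * f₂ c') := by
    intro c c' hc hcc
    have q1 := mul_le_mul_of_nonneg_left ((hf₁ c hc).mono1 F₁ a1 b1 hc hcc (hf₁ c' (by linarith))) r1.le
    have q2 := mul_le_mul_of_nonneg_left ((hf₂ c hc).mono1 F₂ a2 b2 hc hcc (hf₂ c' (by linarith))) r2.le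
    simp only [Complex.ofReal_re] at q1 q2
    linarith
  have m1' : ∀ c c', b < c → c ≤ c' → ρ₁ * f₁ c + ρ₂ * f₂ c ≤ ρ₁ * f₁ c' + ρ₂ * f₂ c' := by
    intro c c' hc hcc
    refine (m1 c c' hc hcc).trans ?_
    apply mul_le_of_le_one_left (f0 c' (by linarith))
    apply pow_le_one₀ (div_nonneg (by linarith) (by linarith))
    rw [div_le_one (by linarith)]; linarith
  have m2 : ∀ c c', b < c → c ≤ c' → ρ₁ * f₁ c' + ρ₂ * f₂ c' ≤
      ((c' - b) / (c - b)) ^ 2 * (ρ₁ * f₁ c + ρ₂ * f₂ c) := by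
    intro c c' hc hcc
    have q1 := mul_le_mul_of_nonneg_left ((hf₁ c hc).mono2 F₁ b1 hc hcc (hf₁ c' (by linarith))) r1.le
    have q2 := mul_le_mul_of_nonneg_left ((hf₂ c hc).mono2 F₂ b2 hc hcc (hf₂ c' (by linarith))) r2.le
    simp only [Complex.ofReal_re] at q1 q2
    linarith
  have as : ∀ c : ℝ, b + 1 ≤ c →
      |ρ₁ * f₁ c + ρ₂ * f₂ c - k * (ρ₁ * (U₁ 0 - c) ^ 2 + ρ₂ * (U₂ 0 - c) ^ 2)| ≤
      (A₁ + A₂) * (ρ₁ * (U₁ 0 - c) ^ 2 + ρ₂ * (U₂ 0 - c) ^ 2) := by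
    intro c hc
    have p1 := B₁ k (by linarith) c hc _ (hf₁ c (by linarith))
    have p2 := B₂ k (by linarith) c hc _ (hf₂ c (by linarith))
    rw [Complex.ofReal_re, abs_le] at p1 p2
    have z1 : 0 ≤ ρ₁ * (U₁ 0 - c) ^ 2 := by positivity
    have z2 : 0 ≤ ρ₂ * (U₂ 0 - c) ^ 2 := by positivity
    have y1 := mul_nonneg hA₂.le z1
    have y2 := mul_nonneg hA₁.le z2
    have x1 := mul_le_mul_of_nonneg_left p1.1 r1.le
    have x2 := mul_le_mul_of_nonneg_left p1.2 r1.le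
    have x3 := mul_le_mul_of_nonneg_left p2.1 r2.le
    have x4 := mul_le_mul_of_nonneg_left p2.2 r2.le
    rw [abs_le]
    constructor <;> linarith
  have hb1 : ρ₁ * f₁ (b + 1) + ρ₂ * f₂ (b + 1) ≤ σ * k ^ 2 + γ := by
    have g : ∀ u, a ≤ u → u ≤ b → |u - (b + 1)| ≤ b + 1 - a := by
      intro u hu hu'
      rw [abs_le]
      constructor <;> linarith
    have q1 := mul_le_mul_of_nonneg_left ((hf₁ (b + 1) (by linarith)).up0 F₁ (n1 _ (by linarith))
      (by linarith) (fun x hx => g _ (a1 x hx) (b1 x hx))) r1.le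
    have q2 := mul_le_mul_of_nonneg_left ((hf₂ (b + 1) (by linarith)).up0 F₂ (n2 _ (by linarith))
      (by linarith) (fun x hx => g _ (a2 x hx) (b2 x hx))) r2.le
    rw [Complex.ofReal_re] at q1 q2
    have e : (ρ₁ + ρ₂) * (5 / 2 * (b + 1 - a) ^ 2) * k = σ * P' * k := by rw [eP']
    have := mul_pos hσk (by linarith : 0 < k - P')
    linarith
  have hbig : ∃ c₁, b + 1 ≤ c₁ ∧ σ * k ^ 2 + γ ≤ ρ₁ * f₁ c₁ + ρ₂ * f₂ c₁ := by
    have d : 0 < (k - (A₁ + A₂)) * ρ₂ := mul_pos (by linarith) r2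
    obtain ⟨t, ht⟩ : ∃ t, t = (σ * k ^ 2 + γ) / ((k - (A₁ + A₂)) * ρ₂) := ⟨_, rfl⟩
    have t0 : 0 < t := by rw [ht]; positivity
    have et : (k - (A₁ + A₂)) * ρ₂ * t = σ * k ^ 2 + γ := by
      rw [ht]; exact mul_div_cancel₀ _ d.ne'
    refine ⟨b + 1 + t, by linarith, ?_⟩
    have l := (abs_le.mp (as (b + 1 + t) (by linarith))).1
    have u2 := b2 0 F₂.mem0
    have w : t ≤ (U₂ 0 - (b + 1 + t)) ^ 2 := by nlinarith
    have w1 := mul_le_mul_of_nonneg_left w d.le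
    have w2 : 0 ≤ (k - (A₁ + A₂)) * (ρ₁ * (U₁ 0 - (b + 1 + t)) ^ 2) :=
      mul_nonneg (by linarith) (by positivity)
    linarith
  obtain ⟨c₁, hc₁, hG⟩ := hbig
  obtain ⟨c, hc, ec⟩ := root_exists f0 m1' m2 hb1 hc₁ hG
  have hcb : b < c := by linarith
  refine ⟨c, hcb, ⟨fun x hx e => n1 c hcb x hx (by exact_mod_cast e),
    fun x hx e => n2 c hcb x hx (by exact_mod_cast e), f₁ c, f₂ c, hf₁ c hcb, hf₂ c hcb, ?_⟩, ?_, ?_⟩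
  · rw [← ec]; push_cast; ring
  · intro c' hc' H'
    obtain ⟨s₁, s₂, H₁, H₂, -, hre, -⟩ := H'.re
    rcases lt_trichotomy c' c with hlt | heq | hgt
    · exfalso
      refine root_unique (lo := a) (f₁ := ρ₁ * s₁.re + ρ₂ * s₂.re) (f₂ := ρ₁ * f₁ c + ρ₂ * f₂ c)
        (by linarith) hlt G0 ?_ hre.symm ec
      have q1 := mul_le_mul_of_nonneg_left (H₁.mono1 F₁ a1 b1 hc' hlt.le (hf₁ c hcb)) r1.le
      have q2 := mul_le_mul_of_nonneg_left (H₂.mono1 F₂ a2 b2 hc' hlt.le (hf₂ c hcb)) r2.le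
      simp only [Complex.ofReal_re] at q1 q2
      linarith
    · exact heq
    · exfalso
      refine root_unique (lo := a) (f₂ := ρ₁ * s₁.re + ρ₂ * s₂.re) (f₁ := ρ₁ * f₁ c + ρ₂ * f₂ c)
        (by linarith) hgt G0 ?_ ec hre.symm
      have q1 := mul_le_mul_of_nonneg_left ((hf₁ c hcb).mono1 F₁ a1 b1 hcb hgt.le H₁) r1.le
      have q2 := mul_le_mul_of_nonneg_left ((hf₂ c hcb).mono1 F₂ a2 b2 hcb hgt.le H₂) r2.le
      simp only [Complex.ofReal_re] at q1 q2
      linarith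
  · have := as c hc
    rw [ec] at this
    exact AS k c (by linarith) (by linarith) hc this
end

section
variable {h k : ℝ} {U U' U'' U''' : ℝ → ℝ}

theorem ShearFlow.neg (F : ShearFlow h U U' U'' U''') : ShearFlow h (fun x => -U x)
    (fun x => -U' x) (fun x => -U'' x) (fun x => -U''' x) :=
  ⟨F.pos, fun x hx => (F.d1 x hx).neg, fun x hx => (F.d2 x hx).neg, fun x hx => (F.d3 x hx).neg,
    F.c3.neg, fun x hx => neg_ne_zero.mpr (F.ne x hx)⟩

theorem CSol.neg {c s : ℂ} (H : CSol h k U U' U'' c s) :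
    CSol h k (fun x => -U x) (fun x => -U' x) (fun x => -U'' x) (-c) s := by
  obtain ⟨v, v', v'', hv, vh, v0, rfl⟩ := H
  refine ⟨fun x => -v x, fun x => -v' x, fun x => -v'' x, fun x hx =>
    ⟨(hv x hx).1.neg, (hv x hx).2.1.neg, ?_⟩, by simp [vh], ?_, ?_⟩
  · have := (hv x hx).2.2
    have e : ((-U'' x : ℝ) : ℂ) / (((-U x : ℝ) : ℂ) - -c) = (U'' x : ℂ) / ((U x : ℂ) - c) := by
      push_cast
      rw [← neg_div_neg_eq]
      congr 1 <;> ring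
    rw [e]
    linear_combination -this
  · simp only [v0]; push_cast; ring
  · push_cast; ring

theorem PMode.neg {h₁ h₂ : ℝ} {U₁ U₁' U₁'' U₂ U₂' U₂'' : ℝ → ℝ} {ρ₁ ρ₂ G k : ℝ} {c : ℂ}
    (H : PMode h₁ h₂ U₁ U₁' U₁'' U₂ U₂' U₂'' ρ₁ ρ₂ G k c) :
    PMode h₁ h₂ (fun x => -U₁ x) (fun x => -U₁' x) (fun x => -U₁'' x)
      (fun x => -U₂ x) (fun x => -U₂' x) (fun x => -U₂'' x) ρ₁ ρ₂ G k (-c) := by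
  obtain ⟨n1, n2, s₁, s₂, H₁, H₂, e⟩ := H
  refine ⟨fun x hx q => n1 x hx ?_, fun x hx q => n2 x hx ?_, s₁, s₂, H₁.neg, H₂.neg, e⟩
  · push_cast at q; exact neg_injective q
  · push_cast at q; exact neg_injective q
end


section
variable {hp hm g σ ρp ρm : ℝ} {Up Up' Up'' Um Um' Um'' : ℝ → ℝ}

theorem refl_deriv {E : Type*} [NormedAddCommGroup E] [NormedSpace ℝ E] {f : ℝ → E} {f' : E} {x : ℝ}
    (H : HasDerivAt f f' (-x)) : HasDerivAt (fun y => f (-y)) (-f') x := by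
  have := HasDerivAt.scomp x H (hasDerivAt_neg x)
  rw [neg_one_smul] at this
  exact this

theorem refl_deriv_neg {E : Type*} [NormedAddCommGroup E] [NormedSpace ℝ E] {f : ℝ → E} {f' : E}
    {x : ℝ} (H : HasDerivAt f f' (-x)) : HasDerivAt (fun y => -f (-y)) f' x := by
  have := (refl_deriv H).neg
  rw [neg_neg] at this
  exact this

theorem mode_iff {k : ℝ} {c : ℂ} :
    IsNonSingularMode hp hm ρp ρm g σ Up Um Up' Um' Up'' Um'' k c ↔
    PMode hp hm Up Up' Up'' (fun x => Um (-x)) (fun x => -Um' (-x)) (fun x => Um'' (-x)) ρp ρm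
      (σ * |k| ^ 2 + g * (ρm - ρp)) |k| c := by
  have kk : ((|k| : ℝ) : ℂ) ^ 2 = (k : ℂ) ^ 2 := by
    rw [← Complex.ofReal_pow, sq_abs, Complex.ofReal_pow]
  have rm : ∀ x, x ∈ Icc (0:ℝ) hm → -x ∈ Icc (-hm) 0 := fun x hx =>
    ⟨by linarith [hx.2], by linarith [hx.1]⟩
  have rm' : ∀ x, x ∈ Icc (-hm) 0 → -x ∈ Icc (0:ℝ) hm := fun x hx =>
    ⟨by linarith [hx.2], by linarith [hx.1]⟩
  constructor
  · rintro ⟨nm, np, vp, vp', vp'', vm, vm', vm'', dp, dm, vph, vmh, vp0, vm0, e⟩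
    refine ⟨np, fun x hx => nm _ (rm x hx), _, _, ⟨vp, vp', vp'', ?_, vph, vp0, rfl⟩,
      ⟨fun x => vm (-x), fun x => -vm' (-x), fun x => vm'' (-x), ?_, vmh, ?_, rfl⟩, ?_⟩
    · intro x hx; rw [kk]; exact dp x hx
    · intro x hx; rw [kk]
      obtain ⟨d1, d2, d3⟩ := dm (-x) (rm x hx)
      refine ⟨refl_deriv d1, ?_, d3⟩
      exact refl_deriv_neg d2
    · simpa using vm0
    · simp only [neg_zero]
      push_cast at e ⊢
      rw [kk]
      linear_combination -e
  · rintro ⟨np, nm, _, _, ⟨vp, vp', vp'', dp, vph, vp0, rfl⟩, ⟨v, v', v'', dm, vh, v0, rfl⟩, e⟩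
    refine ⟨fun x hx => by simpa using nm _ (rm' x hx), np, vp, vp', vp'', fun x => v (-x),
      fun x => -v' (-x), fun x => v'' (-x), ?_, ?_, vph, by simpa using vh, vp0, ?_, ?_⟩
    · intro x hx; rw [← kk]; exact dp x hx
    · intro x hx; rw [← kk]
      obtain ⟨d1, d2, d3⟩ := dm (-x) (rm' x hx)
      refine ⟨refl_deriv d1, ?_, ?_⟩
      · exact refl_deriv_neg d2
      · simpa using d3
    · simpa using v0
    · simp only [neg_zero] at e ⊢
      push_cast at e ⊢
      rw [kk] at e
      linear_combination -e
end

/-- For all large wave numbers there are exactly two non-singular modes `c⁺(k) > b` and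
`c⁻(k) < a`, both real, with the stated asymptotic location. -/
theorem two_nonsingular_modes_large_k
    (hp hm : ℝ) (hhp : 0 < hp) (hhm : 0 < hm)
    (g σ ρp ρm : ℝ) (hg : 0 < g) (hσ : 0 < σ) (hρp : 0 < ρp) (hρ : ρp < ρm)
    (Up Up' Up'' Up''' : ℝ → ℝ) (Um Um' Um'' Um''' : ℝ → ℝ)
    (hUp : ∀ x ∈ Icc (0:ℝ) hp, HasDerivAt Up (Up' x) x)
    (hUp' : ∀ x ∈ Icc (0:ℝ) hp, HasDerivAt Up' (Up'' x) x)
    (hUp'' : ∀ x ∈ Icc (0:ℝ) hp, HasDerivAt Up'' (Up''' x) x)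
    (hUpc : ContinuousOn Up''' (Icc (0:ℝ) hp))
    (hUpne : ∀ x ∈ Icc (0:ℝ) hp, Up' x ≠ 0)
    (hUm : ∀ x ∈ Icc (-hm) (0:ℝ), HasDerivAt Um (Um' x) x)
    (hUm' : ∀ x ∈ Icc (-hm) (0:ℝ), HasDerivAt Um' (Um'' x) x)
    (hUm'' : ∀ x ∈ Icc (-hm) (0:ℝ), HasDerivAt Um'' (Um''' x) x)
    (hUmc : ContinuousOn Um''' (Icc (-hm) (0:ℝ)))
    (hUmne : ∀ x ∈ Icc (-hm) (0:ℝ), Um' x ≠ 0)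
    (a b : ℝ)
    (ha : a = sInf (Um '' Icc (-hm) 0 ∪ Up '' Icc 0 hp))
    (hb : b = sSup (Um '' Icc (-hm) 0 ∪ Up '' Icc 0 hp)) :
    ∃ k₀ > 0, ∃ C > 0, ∀ k : ℝ, k₀ < |k| →
      ∃ cp cm : ℝ, b < cp ∧ cm < a ∧ cm ≠ cp ∧
        {c : ℂ | IsNonSingularMode hp hm ρp ρm g σ Up Um Up' Um' Up'' Um'' k c}
          = {(cp : ℂ), (cm : ℂ)} ∧
        |cp - (Up 0 * (ρp / ρm) + Um 0) / (1 + ρp / ρm)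
            - Real.sqrt (-(ρp / ρm) * (Up 0 - Um 0) ^ 2 / (1 + ρp / ρm) ^ 2
                + σ * |k| / (ρm * (1 + ρp / ρm)))| ≤ C ∧
        |cm - (Up 0 * (ρp / ρm) + Um 0) / (1 + ρp / ρm)
            + Real.sqrt (-(ρp / ρm) * (Up 0 - Um 0) ^ 2 / (1 + ρp / ρm) ^ 2
                + σ * |k| / (ρm * (1 + ρp / ρm)))| ≤ C := by
  have F₁ : ShearFlow hp Up Up' Up'' Up''' := ⟨hhp, hUp, hUp', hUp'', hUpc, hUpne⟩
  have rm : ∀ x, x ∈ Icc (0:ℝ) hm → -x ∈ Icc (-hm) 0 := fun x hx =>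
    ⟨by linarith [hx.2], by linarith [hx.1]⟩
  have F₂ : ShearFlow hm (fun x => Um (-x)) (fun x => -Um' (-x)) (fun x => Um'' (-x))
      (fun x => -Um''' (-x)) := by
    refine ⟨hhm, fun x hx => refl_deriv (hUm _ (rm x hx)), fun x hx => ?_,
      fun x hx => refl_deriv (hUm'' _ (rm x hx)), ?_, fun x hx => neg_ne_zero.mpr (hUmne _ (rm x hx))⟩
    · exact refl_deriv_neg (hUm' _ (rm x hx))
    · exact (hUmc.comp continuousOn_neg rm).neg
  have hcomp : IsCompact (Um '' Icc (-hm) 0 ∪ Up '' Icc 0 hp) :=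
    (isCompact_Icc.image_of_continuousOn (cont_of_deriv hUm)).union
      (isCompact_Icc.image_of_continuousOn (cont_of_deriv hUp))
  have a1 : ∀ x ∈ Icc 0 hp, a ≤ Up x := fun x hx => by
    rw [ha]; exact csInf_le hcomp.bddBelow (Or.inr ⟨x, hx, rfl⟩)
  have b1 : ∀ x ∈ Icc 0 hp, Up x ≤ b := fun x hx => by
    rw [hb]; exact le_csSup hcomp.bddAbove (Or.inr ⟨x, hx, rfl⟩)
  have a2 : ∀ x ∈ Icc 0 hm, a ≤ Um (-x) := fun x hx => by
    rw [ha]; exact csInf_le hcomp.bddBelow (Or.inl ⟨-x, rm x hx, rfl⟩)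
  have b2 : ∀ x ∈ Icc 0 hm, Um (-x) ≤ b := fun x hx => by
    rw [hb]; exact le_csSup hcomp.bddAbove (Or.inl ⟨-x, rm x hx, rfl⟩)
  have hab : a ≤ b := (a1 0 F₁.mem0).trans (b1 0 F₁.mem0)
  have hρm : 0 < ρm := by linarith
  have hγ : 0 < g * (ρm - ρp) := mul_pos hg (by linarith)
  obtain ⟨l₁, hl₁, EX⟩ := exclusion F₁ F₂ hρp hρm hσ hγ a1 a2 b1 b2
  obtain ⟨l₂, hl₂, C₂, hC₂, UP⟩ := upper_half F₁ F₂ hρp hρm hσ hγ a1 a2 b1 b2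
  obtain ⟨l₃, hl₃, C₃, hC₃, DN⟩ := upper_half F₁.neg F₂.neg hρp hρm hσ hγ (a := -b) (b := -a)
    (fun x hx => neg_le_neg (b1 x hx)) (fun x hx => neg_le_neg (b2 x hx))
    (fun x hx => neg_le_neg (a1 x hx)) (fun x hx => neg_le_neg (a2 x hx))
  refine ⟨l₁ + l₂ + l₃, by positivity, C₂ + C₃, by positivity, fun k hk => ?_⟩
  obtain ⟨cp, hcp, Mp, up, asp⟩ := UP |k| (by linarith)
  obtain ⟨cn, hcn, Mn, un, asn⟩ := DN |k| (by linarith)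
  have EX' := EX |k| (by linarith)
  have Mn' := Mn.neg
  simp only [neg_neg] at Mn'
  refine ⟨cp, -cn, hcp, by linarith, by linarith, ?_, ?_, ?_⟩
  · ext c
    simp only [mem_ofPred_eq, mem_insert_iff, mem_singleton_iff]
    rw [mode_iff]
    constructor
    · intro H
      obtain ⟨him, hre⟩ := EX' c H
      have ec : c = (c.re : ℂ) := by apply Complex.ext <;> simp [him]
      rcases hre with hre | hre
      · right
        have Hn := H.neg
        rw [ec, ← Complex.ofReal_neg] at Hn
        have := un (-c.re) (by linarith) Hn
        rw [ec, ← this]; simp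
      · left
        rw [ec] at H ⊢
        rw [up c.re hre H]
    · rintro (rfl | rfl)
      · exact Mp
      · rw [Complex.ofReal_neg]; exact Mn'
  · simp only [neg_zero] at asp
    linarith
  · simp only [neg_zero] at asn
    have e1 : (-Up 0 * (ρp / ρm) + -Um 0) / (1 + ρp / ρm) =
        -((Up 0 * (ρp / ρm) + Um 0) / (1 + ρp / ρm)) := by ring
    have e2 : (-Up 0 - -Um 0) ^ 2 = (Up 0 - Um 0) ^ 2 := by ring
    rw [e1, e2] at asn
    rw [abs_sub_comm] at asn
    have : ∀ x y z : ℝ, |y - (x - -z)| = |-x - z + y| := fun x y z => by congr 1; ring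
    rw [this] at asn
    linarith
end

section
/- Asymptotics of the two branches: Under the setup of the previous theorem (h₊, h₋ > 0, g > 0, σ > 0, 0 < ρ⁺ < ρ⁻, U⁺ ∈ C³([0, h₊]; ℝ), U⁻ ∈ C³([−h₋, 0]; ℝ) with (U^±)' ≠ 0, a and b the min and max of U⁻([−h₋, 0]) ∪ U⁺([0, h₊])), let k₀ > 0 be such that for each |k| > k₀ there are exactly two c ∈ ℂ \ (U⁻([−h₋, 0]) ∪ U⁺([0, h₊])) for which (c, k) is a non-singular mode, denoted c⁺(k) > b and c⁻(k) < a (both real). Then lim_{|k| → ∞} c⁺(k) / √( σ|k|/(ρ⁻ + ρ⁺) ) = 1 and lim_{|k| → ∞} c⁻(k) / √( σ|k|/(ρ⁻ + ρ⁺) ) = −1. -/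
open Set MeasureTheory intervalIntegral Filter Topology

/-- Energy comparison for `(p w')' = κ² p w`, `w 0 = 1`, `w h = 0`. -/
theorem energy_bounds (h κ A B : ℝ) (hh : 0 < h) (hκ : 0 < κ) (hA : 0 ≤ A)
    (p w w' W : ℝ → ℝ)
    (hw : ∀ x ∈ Icc (0:ℝ) h, HasDerivAt w (w' x) x)
    (hW : ∀ x ∈ Icc (0:ℝ) h, HasDerivAt W (κ ^ 2 * p x * w x) x)
    (hWp : ∀ x ∈ Icc (0:ℝ) h, W x = p x * w' x)
    (hpA : ∀ x ∈ Icc (0:ℝ) h, A ≤ p x) (hpB : ∀ x ∈ Icc (0:ℝ) h, p x ≤ B)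
    (hw0 : w 0 = 1) (hwh : w h = 0) :
    A * (κ * (Real.cosh (κ * h) / Real.sinh (κ * h))) ≤ - W 0 ∧
    - W 0 ≤ B * (κ * (Real.cosh (κ * h) / Real.sinh (κ * h))) := by
  have hs : 0 < Real.sinh (κ * h) := Real.sinh_pos_iff.2 (by positivity)
  set s := Real.sinh (κ * h) with hsdef
  set φ : ℝ → ℝ := fun x => Real.sinh (κ * (h - x)) / s with hφ
  set ψ : ℝ → ℝ := fun x => -(κ * Real.cosh (κ * (h - x)) / s) with hψ
  have hin : ∀ x : ℝ, HasDerivAt (fun x : ℝ => κ * (h - x)) (-κ) x := by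
    intro x
    have := ((hasDerivAt_id x).const_sub h).const_mul κ
    simpa using this
  have dφ : ∀ x, HasDerivAt φ (ψ x) x := by
    intro x
    have := ((Real.hasDerivAt_sinh _).comp x (hin x)).div_const s
    refine this.congr_deriv ?_
    simp only [hψ]; ring
  have dψ : ∀ x, HasDerivAt ψ (κ ^ 2 * φ x) x := by
    intro x
    have := ((((Real.hasDerivAt_cosh _).comp x (hin x)).const_mul κ).div_const s).neg
    refine this.congr_deriv ?_
    simp only [hφ]; ring
  have φ0 : φ 0 = 1 := by simp only [hφ, sub_zero]; exact div_self hs.ne'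
  have φh : φ h = 0 := by simp [hφ]
  have ψ0 : ψ 0 = -(κ * (Real.cosh (κ * h) / s)) := by simp only [hψ, sub_zero]; ring
  have h0m : (0:ℝ) ∈ Icc (0:ℝ) h := ⟨le_rfl, hh.le⟩
  have hhm : h ∈ Icc (0:ℝ) h := ⟨hh.le, le_rfl⟩
  constructor
  · have d : ∀ x ∈ Icc (0:ℝ) h,
        HasDerivAt (fun x => W x * w x - A * (2 * (ψ x * w x) - φ x * ψ x))
        (κ ^ 2 * p x * w x * w x + W x * w' x - A * (2 * (κ ^ 2 * φ x * w x + ψ x * w' x)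
          - (ψ x * ψ x + φ x * (κ ^ 2 * φ x)))) x := by
      intro x hx
      exact ((hW x hx).mul (hw x hx)).sub
        (((((dψ x).mul (hw x hx)).const_mul 2).sub ((dφ x).mul (dψ x))).const_mul A)
    have mono : MonotoneOn (fun x => W x * w x - A * (2 * (ψ x * w x) - φ x * ψ x)) (Icc 0 h) := by
      apply monotoneOn_of_deriv_nonneg (convex_Icc 0 h)
      · exact fun x hx => (d x hx).continuousAt.continuousWithinAt
      · exact fun x hx => (d x (interior_subset hx)).differentiableAt.differentiableWithinAt
      · intro x hx
        have hx := interior_subset hx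
        rw [(d x hx).deriv, hWp x hx]
        have h1 : 0 ≤ (p x - A) * (κ ^ 2 * w x ^ 2 + w' x ^ 2) :=
          mul_nonneg (sub_nonneg.2 (hpA x hx)) (by positivity)
        have h2 : 0 ≤ A * (κ ^ 2 * (w x - φ x) ^ 2 + (w' x - ψ x) ^ 2) :=
          mul_nonneg hA (by positivity)
        nlinarith
    have := mono h0m hhm hh.le
    simp only [hw0, hwh, φ0, φh, ψ0] at this
    linarith
  · have d : ∀ x ∈ Icc (0:ℝ) h,
        HasDerivAt (fun x => B * (ψ x * φ x) - 2 * (W x * φ x) + W x * w x)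
        (B * (κ ^ 2 * φ x * φ x + ψ x * ψ x) - 2 * (κ ^ 2 * p x * w x * φ x + W x * ψ x)
          + (κ ^ 2 * p x * w x * w x + W x * w' x)) x := by
      intro x hx
      exact ((((dψ x).mul (dφ x)).const_mul B).sub (((hW x hx).mul (dφ x)).const_mul 2)).add
        ((hW x hx).mul (hw x hx))
    have mono : MonotoneOn (fun x => B * (ψ x * φ x) - 2 * (W x * φ x) + W x * w x) (Icc 0 h) := by
      apply monotoneOn_of_deriv_nonneg (convex_Icc 0 h)
      · exact fun x hx => (d x hx).continuousAt.continuousWithinAt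
      · exact fun x hx => (d x (interior_subset hx)).differentiableAt.differentiableWithinAt
      · intro x hx
        have hx := interior_subset hx
        rw [(d x hx).deriv, hWp x hx]
        have h1 : 0 ≤ (B - p x) * (κ ^ 2 * φ x ^ 2 + ψ x ^ 2) :=
          mul_nonneg (sub_nonneg.2 (hpB x hx)) (by positivity)
        have h2 : 0 ≤ p x * (κ ^ 2 * (w x - φ x) ^ 2 + (w' x - ψ x) ^ 2) :=
          mul_nonneg (hA.trans (hpA x hx)) (by positivity)
        nlinarith
    have := mono h0m hhm hh.le
    simp only [hw0, hwh, φ0, φh, ψ0] at this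
    linarith

/-- Rayleigh version of the energy bounds, with real solutions on `[0,h]`. -/
theorem rayleigh_bounds (h k c M : ℝ) (hh : 0 < h) (hk : k ≠ 0)
    (U U' U'' v v' v'' : ℝ → ℝ)
    (hU : ∀ x ∈ Icc (0:ℝ) h, HasDerivAt U (U' x) x)
    (hU' : ∀ x ∈ Icc (0:ℝ) h, HasDerivAt U' (U'' x) x)
    (hM : ∀ x ∈ Icc (0:ℝ) h, |U x| ≤ M)
    (hc : ∀ x ∈ Icc (0:ℝ) h, U x ≠ c)
    (hv : ∀ x ∈ Icc (0:ℝ) h, HasDerivAt v (v' x) x)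
    (hv' : ∀ x ∈ Icc (0:ℝ) h, HasDerivAt v' (v'' x) x)
    (hR : ∀ x ∈ Icc (0:ℝ) h, -v'' x + (k ^ 2 + U'' x / (U x - c)) * v x = 0)
    (hv0 : v 0 = U 0 - c) (hvh : v h = 0) :
    (max (|c| - M) 0) ^ 2 * (|k| * (Real.cosh (|k| * h) / Real.sinh (|k| * h)))
      ≤ - ((U 0 - c) * v' 0 - U' 0 * v 0) ∧
    - ((U 0 - c) * v' 0 - U' 0 * v 0)
      ≤ (|c| + M) ^ 2 * (|k| * (Real.cosh (|k| * h) / Real.sinh (|k| * h))) := by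
  have hne : ∀ x ∈ Icc (0:ℝ) h, U x - c ≠ 0 := fun x hx => sub_ne_zero.2 (hc x hx)
  have h0m : (0:ℝ) ∈ Icc (0:ℝ) h := ⟨le_rfl, hh.le⟩
  refine energy_bounds h |k| _ _ hh (abs_pos.2 hk) (sq_nonneg _)
    (fun x => (U x - c) ^ 2) (fun x => v x / (U x - c))
    (fun x => (v' x * (U x - c) - v x * U' x) / (U x - c) ^ 2)
    (fun x => (U x - c) * v' x - U' x * v x) ?_ ?_ ?_ ?_ ?_ ?_ ?_
  · intro x hx
    exact (hv x hx).div ((hU x hx).sub_const c) (hne x hx)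
  · intro x hx
    refine ((((hU x hx).sub_const c).mul (hv' x hx)).sub ((hU' x hx).mul (hv x hx))).congr_deriv ?_
    have e := hR x hx
    have e' : v'' x = (k ^ 2 + U'' x / (U x - c)) * v x := by linarith
    have := hne x hx
    rw [e', sq_abs]
    field_simp
    ring
  · intro x hx
    have := hne x hx
    field_simp
  · intro x hx
    rw [← sq_abs (U x - c)]
    apply pow_le_pow_left₀ (le_max_right _ _)
    apply max_le _ (abs_nonneg _)
    have h1 := abs_sub_abs_le_abs_sub c (U x)
    rw [abs_sub_comm] at h1
    linarith [hM x hx]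
  · intro x hx
    show (U x - c) ^ 2 ≤ _
    rw [← sq_abs (U x - c)]
    apply pow_le_pow_left₀ (abs_nonneg _)
    have h1 := abs_sub (U x) c
    linarith [hM x hx]
  · show v 0 / (U 0 - c) = 1
    rw [hv0]; exact div_self (hne 0 h0m)
  · simp [hvh]

theorem mode_bounds (hp hm ρp ρm g σ : ℝ) (hhp : 0 < hp) (hhm : 0 < hm)
    (hρp : 0 < ρp) (hρm : 0 < ρm)
    (Up Um Up' Um' Up'' Um'' : ℝ → ℝ) (k c M : ℝ) (hk : k ≠ 0)
    (hUp : ∀ x ∈ Icc (0:ℝ) hp, HasDerivAt Up (Up' x) x)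
    (hUp' : ∀ x ∈ Icc (0:ℝ) hp, HasDerivAt Up' (Up'' x) x)
    (hUm : ∀ x ∈ Icc (-hm) (0:ℝ), HasDerivAt Um (Um' x) x)
    (hUm' : ∀ x ∈ Icc (-hm) (0:ℝ), HasDerivAt Um' (Um'' x) x)
    (hMp : ∀ x ∈ Icc (0:ℝ) hp, |Up x| ≤ M)
    (hMm : ∀ x ∈ Icc (-hm) (0:ℝ), |Um x| ≤ M)
    (H : IsNonSingularMode hp hm ρp ρm g σ Up Um Up' Um' Up'' Um'' k (c : ℂ)) :
    (max (|c| - M) 0) ^ 2 * (|k| * (ρp * (Real.cosh (|k| * hp) / Real.sinh (|k| * hp))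
        + ρm * (Real.cosh (|k| * hm) / Real.sinh (|k| * hm))))
      ≤ σ * k ^ 2 + g * (ρm - ρp) ∧
    σ * k ^ 2 + g * (ρm - ρp)
      ≤ (|c| + M) ^ 2 * (|k| * (ρp * (Real.cosh (|k| * hp) / Real.sinh (|k| * hp))
        + ρm * (Real.cosh (|k| * hm) / Real.sinh (|k| * hm)))) := by
  obtain ⟨hcm, hcp, vp, vp', vp'', vm, vm', vm'', hvp, hvm, vphp, vmhm, vp0, vm0, hI⟩ := H
  have reD : ∀ (f : ℝ → ℂ) (f' : ℂ) (x : ℝ), HasDerivAt f f' x →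
      HasDerivAt (fun y => (f y).re) f'.re x := by
    intro f f' x hf
    exact (Complex.reCLM.hasFDerivAt.comp_hasDerivAt x hf)
  have reR : ∀ (a b u : ℝ) (z y : ℂ),
      -z + ((k : ℂ) ^ 2 + (a : ℂ) / ((b : ℂ) - (c : ℂ))) * y = 0 →
      -z.re + (k ^ 2 + a / (b - c)) * y.re = 0 := by
    intro a b u z y e
    have e2 : -z + ((k ^ 2 + a / (b - c) : ℝ) : ℂ) * y = 0 := by push_cast; exact e
    have := congrArg Complex.re e2
    rw [Complex.add_re, Complex.re_ofReal_mul] at this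
    simpa using this
  have P := rayleigh_bounds hp k c M hhp hk Up Up' Up'' (fun x => (vp x).re)
    (fun x => (vp' x).re) (fun x => (vp'' x).re) hUp hUp' hMp
    (fun x hx e => hcp x hx (by rw [e]))
    (fun x hx => reD _ _ _ (hvp x hx).1) (fun x hx => reD _ _ _ (hvp x hx).2.1)
    (fun x hx => reR _ _ 0 _ _ (hvp x hx).2.2) (by simp [vp0]) (by simp [vphp])
  have hneg : ∀ x ∈ Icc (0:ℝ) hm, -x ∈ Icc (-hm) (0:ℝ) := by
    intro x hx; exact ⟨by linarith [hx.2], by linarith [hx.1]⟩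
  have negD : ∀ (f : ℝ → ℝ) (f' : ℝ) (x : ℝ), HasDerivAt f f' (-x) →
      HasDerivAt (fun y => f (-y)) (-f') x := by
    intro f f' x hf
    have := hf.comp x (hasDerivAt_neg x)
    exact this.congr_deriv (by ring)
  have Q := rayleigh_bounds hm k c M hhm hk (fun x => Um (-x)) (fun x => -Um' (-x))
    (fun x => Um'' (-x)) (fun x => (vm (-x)).re)
    (fun x => -(vm' (-x)).re) (fun x => (vm'' (-x)).re)
    (fun x hx => negD _ _ _ (hUm _ (hneg x hx)))
    (fun x hx => (negD _ _ _ (hUm' _ (hneg x hx))).neg.congr_deriv (neg_neg _))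
    (fun x hx => hMm _ (hneg x hx))
    (fun x hx e => hcm _ (hneg x hx) (by rw [e]))
    (fun x hx => negD (fun y => (vm y).re) _ _ (reD _ _ _ (hvm _ (hneg x hx)).1))
    (fun x hx =>
      (negD (fun y => (vm' y).re) _ _ (reD _ _ _ (hvm _ (hneg x hx)).2.1)).neg.congr_deriv
        (neg_neg _))
    (fun x hx => reR _ _ 0 _ _ (hvm _ (hneg x hx)).2.2) (by simp [vm0]) (by simp [vmhm])
  simp only [neg_zero] at Q
  have I := congrArg Complex.re hI
  have I2 : g * (ρp - ρm) - σ * k ^ 2 = ρm * Um' 0 * (vm 0).re - ρp * Up' 0 * (vp 0).re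
      + ρp * (vp' 0).re * (Up 0 - c) - ρm * (vm' 0).re * (Um 0 - c) := by
    rw [Complex.ofReal_re] at I
    rw [I]
    simp
  have P1 := mul_le_mul_of_nonneg_left P.1 hρp.le
  have P2 := mul_le_mul_of_nonneg_left P.2 hρp.le
  have Q1 := mul_le_mul_of_nonneg_left Q.1 hρm.le
  have Q2 := mul_le_mul_of_nonneg_left Q.2 hρm.le
  constructor <;> nlinarith

theorem tendsto_coth : Tendsto (fun x : ℝ => Real.cosh x / Real.sinh x) atTop (𝓝 1) := by
  have h1 : Tendsto (fun x : ℝ => Real.exp (-(2 * x))) atTop (𝓝 0) :=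
    Real.tendsto_exp_neg_atTop_nhds_zero.comp (tendsto_id.const_mul_atTop (by norm_num : (0:ℝ) < 2))
  have h2 : Tendsto (fun x : ℝ => (1 + Real.exp (-(2 * x))) / (1 - Real.exp (-(2 * x)))) atTop
      (𝓝 ((1 + 0) / (1 - 0))) :=
    (h1.const_add 1).div (h1.const_sub 1) (by norm_num)
  rw [show ((1:ℝ) + 0) / (1 - 0) = 1 by norm_num] at h2
  refine h2.congr' ?_
  filter_upwards [eventually_gt_atTop 0] with x hx
  have e : Real.exp (-(2 * x)) = Real.exp (-x) / Real.exp x := by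
    rw [← Real.exp_sub]; congr 1; ring
  have hlt : Real.exp (-x) < Real.exp x := Real.exp_lt_exp.2 (by linarith)
  have := Real.exp_pos x
  have h3 : Real.exp x - Real.exp (-x) ≠ 0 := by linarith
  rw [Real.cosh_eq, Real.sinh_eq, e]
  field_simp

/-- Capillary-wave asymptotics of the two branches `c^±(k)` of wave speeds as
`|k| → ∞`: `c^±(k)/√(σ|k|/(ρ⁻ + ρ⁺)) → ±1`. -/
theorem branches_asymptotics
    (hp hm : ℝ) (hhp : 0 < hp) (hhm : 0 < hm)
    (g σ ρp ρm : ℝ) (hg : 0 < g) (hσ : 0 < σ) (hρp : 0 < ρp) (hρ : ρp < ρm)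
    (Up Up' Up'' Up''' : ℝ → ℝ) (Um Um' Um'' Um''' : ℝ → ℝ)
    (hUp : ∀ x ∈ Icc (0:ℝ) hp, HasDerivAt Up (Up' x) x)
    (hUp' : ∀ x ∈ Icc (0:ℝ) hp, HasDerivAt Up' (Up'' x) x)
    (hUp'' : ∀ x ∈ Icc (0:ℝ) hp, HasDerivAt Up'' (Up''' x) x)
    (hUpc : ContinuousOn Up''' (Icc (0:ℝ) hp))
    (hUpne : ∀ x ∈ Icc (0:ℝ) hp, Up' x ≠ 0)
    (hUm : ∀ x ∈ Icc (-hm) (0:ℝ), HasDerivAt Um (Um' x) x)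
    (hUm' : ∀ x ∈ Icc (-hm) (0:ℝ), HasDerivAt Um' (Um'' x) x)
    (hUm'' : ∀ x ∈ Icc (-hm) (0:ℝ), HasDerivAt Um'' (Um''' x) x)
    (hUmc : ContinuousOn Um''' (Icc (-hm) (0:ℝ)))
    (hUmne : ∀ x ∈ Icc (-hm) (0:ℝ), Um' x ≠ 0)
    (a b : ℝ)
    (ha : a = sInf (Um '' Icc (-hm) 0 ∪ Up '' Icc 0 hp))
    (hb : b = sSup (Um '' Icc (-hm) 0 ∪ Up '' Icc 0 hp))
    (k₀ : ℝ) (hk₀ : 0 < k₀)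
    (cp cm : ℝ → ℝ)
    (hmode : ∀ k : ℝ, k₀ < |k| →
      b < cp k ∧ cm k < a ∧
      {c : ℂ | IsNonSingularMode hp hm ρp ρm g σ Up Um Up' Um' Up'' Um'' k c}
        = {(cp k : ℂ), (cm k : ℂ)}) :
    Tendsto (fun k : ℝ => cp k / Real.sqrt (σ * |k| / (ρm + ρp)))
      (comap (fun k : ℝ => |k|) atTop) (𝓝 1) ∧
    Tendsto (fun k : ℝ => cm k / Real.sqrt (σ * |k| / (ρm + ρp)))
      (comap (fun k : ℝ => |k|) atTop) (𝓝 (-1)) := by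
  have hρm : 0 < ρm := hρp.trans hρ
  obtain ⟨M1, hM1⟩ := isCompact_Icc.exists_bound_of_continuousOn
    (f := Up) (s := Icc (0:ℝ) hp) (fun x hx => (hUp x hx).continuousAt.continuousWithinAt)
  obtain ⟨M2, hM2⟩ := isCompact_Icc.exists_bound_of_continuousOn
    (f := Um) (s := Icc (-hm) (0:ℝ)) (fun x hx => (hUm x hx).continuousAt.continuousWithinAt)
  set M := max M1 M2 with hMdef
  have hMp : ∀ x ∈ Icc (0:ℝ) hp, |Up x| ≤ M := fun x hx => (hM1 x hx).trans (le_max_left _ _)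
  have hMm : ∀ x ∈ Icc (-hm) (0:ℝ), |Um x| ≤ M := fun x hx => (hM2 x hx).trans (le_max_right _ _)
  have hM0 : 0 ≤ M := (abs_nonneg _).trans (hMp 0 ⟨le_rfl, hhp.le⟩)
  set l : Filter ℝ := comap (fun k : ℝ => |k|) atTop with hl
  have hK : Tendsto (fun k : ℝ => |k|) l atTop := tendsto_comap
  set S : ℝ → ℝ := fun k => Real.sqrt (σ * |k| / (ρm + ρp)) with hS
  have hSt : Tendsto S l atTop := by
    refine Real.tendsto_sqrt_atTop.comp ?_
    exact (hK.const_mul_atTop hσ).atTop_div_const (by positivity)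
  set L : ℝ → ℝ := fun k => ρp * (Real.cosh (|k| * hp) / Real.sinh (|k| * hp))
        + ρm * (Real.cosh (|k| * hm) / Real.sinh (|k| * hm)) with hL
  have hLt : Tendsto L l (𝓝 (ρp + ρm)) := by
    have h1 := (tendsto_coth.comp (hK.atTop_mul_const hhp)).const_mul ρp
    have h2 := (tendsto_coth.comp (hK.atTop_mul_const hhm)).const_mul ρm
    simpa using h1.add h2
  set T : ℝ → ℝ := fun k => (1 + g * (ρm - ρp) / σ * (|k|⁻¹ * |k|⁻¹)) * ((ρm + ρp) / L k) with hT
  have hTt : Tendsto (fun k => Real.sqrt (T k)) l (𝓝 1) := by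
    have h1 : Tendsto (fun k : ℝ => |k|⁻¹) l (𝓝 0) := tendsto_inv_atTop_zero.comp hK
    have h2 := (((h1.mul h1).const_mul (g * (ρm - ρp) / σ)).const_add 1).mul
      ((tendsto_const_nhds (x := ρm + ρp)).div hLt (by positivity))
    rw [show (1 + g * (ρm - ρp) / σ * (0 * 0)) * ((ρm + ρp) / (ρp + ρm)) = 1 by
      rw [add_comm ρp ρm, div_self (by positivity)]; ring] at h2
    have h3 := (Real.continuous_sqrt.tendsto 1).comp h2
    rw [Real.sqrt_one] at h3
    exact h3
  have key : ∀ c : ℝ → ℝ, (∀ k, k₀ < |k| →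
      IsNonSingularMode hp hm ρp ρm g σ Up Um Up' Um' Up'' Um'' k (c k : ℂ)) →
      Tendsto (fun k => |c k| / S k) l (𝓝 1) := by
    intro c hc
    have hMS : Tendsto (fun k => M / S k) l (𝓝 0) := hSt.const_div_atTop M
    have lo := hTt.sub hMS
    have up := hTt.add hMS
    rw [sub_zero] at lo
    rw [add_zero] at up
    have ev : ∀ᶠ k in l, Real.sqrt (T k) - M / S k ≤ |c k| / S k ∧
        |c k| / S k ≤ Real.sqrt (T k) + M / S k := by
      filter_upwards [hK.eventually_gt_atTop k₀, hSt.eventually_gt_atTop 0,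
        hLt.eventually_const_lt (show 0 < ρp + ρm by positivity)] with k hk hSk hLk
      have hkp : 0 < |k| := hk₀.trans hk
      obtain ⟨b1, b2⟩ := mode_bounds hp hm ρp ρm g σ hhp hhm hρp hρm Up Um Up' Um' Up'' Um'' k
        (c k) M (abs_pos.1 hkp) hUp hUp' hUm hUm' hMp hMm (hc k hk)
      change _ * (|k| * L k) ≤ _ at b1
      change _ ≤ _ * (|k| * L k) at b2
      have hS2 : S k ^ 2 = σ * |k| / (ρm + ρp) := Real.sq_sqrt (by positivity)
      have eT : T k * S k ^ 2 * (|k| * L k) = σ * k ^ 2 + g * (ρm - ρp) := by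
        rw [hS2, ← sq_abs k]
        simp only [hT]
        field_simp
      have hpos : 0 < |k| * L k := by positivity
      rw [← eT] at b1 b2
      have b1 := le_of_mul_le_mul_right b1 hpos
      have b2 := le_of_mul_le_mul_right b2 hpos
      have hT0 : 0 ≤ T k := by
        have h2 : 0 ≤ ρm - ρp := by linarith
        simp only [hT]
        positivity
      have eq1 : Real.sqrt (T k * S k ^ 2) = Real.sqrt (T k) * S k := by
        rw [Real.sqrt_mul hT0, Real.sqrt_sq hSk.le]
      have c1 := Real.le_sqrt_of_sq_le b1
      have c2 := Real.sqrt_le_iff.2 ⟨by positivity, b2⟩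
      rw [eq1] at c1 c2
      have c1 := (le_max_left _ _).trans c1
      constructor
      · rw [le_div_iff₀ hSk, sub_mul, div_mul_cancel₀ _ hSk.ne']
        linarith
      · rw [div_le_iff₀ hSk, add_mul, div_mul_cancel₀ _ hSk.ne']
        linarith
    exact tendsto_of_tendsto_of_tendsto_of_le_of_le' lo up (ev.mono fun _ h => h.1)
      (ev.mono fun _ h => h.2)
  have large : ∀ c : ℝ → ℝ, Tendsto (fun k => |c k| / S k) l (𝓝 1) → ∀ B : ℝ,
      ∀ᶠ k in l, B < |c k| := by
    intro c hc B
    have h1 : Tendsto (fun k => |c k| / S k * S k) l atTop := hc.pos_mul_atTop one_pos hSt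
    filter_upwards [h1.eventually_gt_atTop B, hSt.eventually_gt_atTop 0] with k h2 h3
    rwa [div_mul_cancel₀ _ h3.ne'] at h2
  constructor
  · have h1 := key cp (fun k hk => by
      have : (cp k : ℂ) ∈ ({(cp k : ℂ), (cm k : ℂ)} : Set ℂ) := by simp
      rw [← (hmode k hk).2.2] at this
      exact this)
    refine h1.congr' ?_
    filter_upwards [hK.eventually_gt_atTop k₀, large cp h1 |b|] with k hk hB
    have h2 := (hmode k hk).1
    have h3 : 0 ≤ cp k := by
      by_contra hn
      rw [abs_of_neg (not_le.1 hn)] at hB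
      linarith [neg_abs_le b]
    rw [abs_of_nonneg h3]
  · have h1 := key cm (fun k hk => by
      have : (cm k : ℂ) ∈ ({(cp k : ℂ), (cm k : ℂ)} : Set ℂ) := by simp
      rw [← (hmode k hk).2.2] at this
      exact this)
    refine h1.neg.congr' ?_
    filter_upwards [hK.eventually_gt_atTop k₀, large cm h1 |a|] with k hk hB
    have h2 := (hmode k hk).2.1
    have h3 : cm k ≤ 0 := by
      by_contra hn
      rw [abs_of_pos (not_le.1 hn)] at hB
      linarith [le_abs_self a]
    rw [abs_of_nonpos h3]
    simp only [hS]
    ring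
end
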